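/- For a finite set A let X = A^ℤ and let S denote the shift. For 0 < c ≤ log|A|, denote by M_c the set of S-invariant Borel probability measures on X with Kolmogorov–Sinai entropy greater than or equal to c. There is a dense G_δ subset C ⊂ M_c (in the weak* topology) such that for all μ ∈ C the system (X,μ,S) has entropy equal to c and is isomorphic to a Bernoulli shift. -/

import Mathlib

open MeasureTheory Filter
open scoped ENNReal symmDiff Pointwise Classical

noncomputable section

/-- The shift action of a group `G` on `Λ^G` : `(gShift g ω) h = ω (h * g)`. -/
def gShift {G Λ : Type} [Group G] (g : G) (ω : G → Λ) : G → Λ := fun h => ω (h * g)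

/-- The shift on `ℤ`-indexed sequences: `(zShift k x) n = x (n + k)`. -/
def zShift {A : Type} (k : ℤ) (x : ℤ → A) : ℤ → A := fun n => x (n + k)

/-- Invariance of a measure on `Λ^G` under the `G`-shift. -/
def ShiftInvariant {G Λ : Type} [Group G] [MeasurableSpace Λ]
    (μ : Measure (G → Λ)) : Prop :=
  ∀ g : G, Measure.map (gShift g) μ = μ

/-- A finite set `F ⊆ G` is `(K,γ)`-invariant if `|KF ∆ F| < γ·|F|`. -/
def KInv {G : Type} [Group G] [DecidableEq G] (K : Finset G) (γ : ℝ) (F : Finset G) : Prop :=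
  (((K * F) ∆ F).card : ℝ) < γ * (F.card : ℝ)

/-- A Følner sequence in a countable group `G`: a sequence of nonempty finite sets that is
eventually `(K,γ)`-invariant for every finite `K` and `γ > 0`. -/
def IsFolnerSeq {G : Type} [Group G] [DecidableEq G] (Fs : ℕ → Finset G) : Prop :=
  (∀ n, (Fs n).Nonempty) ∧ ∀ (K : Finset G) (γ : ℝ), 0 < γ → ∀ᶠ n in atTop, KInv K γ (Fs n)

/-- Shannon entropy of the partition of `Λ^G` into cylinders over a finite set `F`. -/
def blockEnt {G Λ : Type} [Group G] [DecidableEq G] [Fintype Λ] [MeasurableSpace Λ]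
    (μ : Measure (G → Λ)) (F : Finset G) : ℝ :=
  ∑ α : { g // g ∈ F } → Λ,
    Real.negMulLog (μ {ω : G → Λ | ∀ g : { g // g ∈ F }, ω (g : G) = α g}).toReal

/-- Kolmogorov–Sinai entropy of a shift-invariant measure on `Λ^G`, computed by averaging the
Shannon entropies of block partitions along a (Følner) sequence `Fs`. -/
def entAlong {G Λ : Type} [Group G] [DecidableEq G] [Fintype Λ] [MeasurableSpace Λ]
    (Fs : ℕ → Finset G) (μ : Measure (G → Λ)) : ℝ :=
  limsup (fun n => blockEnt μ (Fs n) / ((Fs n).card : ℝ)) atTop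

/-- Conditional Shannon entropy of the `Λ`-block partition over `F` given the `Λ₁`-block
partition over `F` pulled back through the factor map `π`. -/
def condBlockEnt {G Λ Λ₁ : Type} [Group G] [DecidableEq G]
    [Fintype Λ] [MeasurableSpace Λ] [Fintype Λ₁] [MeasurableSpace Λ₁]
    (μ : Measure (G → Λ)) (π : (G → Λ) → (G → Λ₁)) (F : Finset G) : ℝ :=
  (∑ q : ({ g // g ∈ F } → Λ) × ({ g // g ∈ F } → Λ₁),
    Real.negMulLog (μ {ω : G → Λ |
      (∀ g : { g // g ∈ F }, ω (g : G) = q.1 g) ∧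
      (∀ g : { g // g ∈ F }, π ω (g : G) = q.2 g)}).toReal)
  - ∑ β : { g // g ∈ F } → Λ₁,
      Real.negMulLog (μ {ω : G → Λ | ∀ g : { g // g ∈ F }, π ω (g : G) = β g}).toReal

/-- Conditional (relative) Kolmogorov–Sinai entropy `h(μ | Ω₁)` of a shift-invariant measure on
`Λ^G` over the factor `π : Λ^G → Λ₁^G`, computed along the sequence `Fs`. -/
def condEntAlong {G Λ Λ₁ : Type} [Group G] [DecidableEq G]
    [Fintype Λ] [MeasurableSpace Λ] [Fintype Λ₁] [MeasurableSpace Λ₁]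
    (Fs : ℕ → Finset G) (μ : Measure (G → Λ)) (π : (G → Λ) → (G → Λ₁)) : ℝ :=
  limsup (fun n => condBlockEnt μ π (Fs n) / ((Fs n).card : ℝ)) atTop

/-- `ν` is the i.i.d. (product) measure on `Δ^G` with one-coordinate distribution `p`. -/
def IsIIDG {G Δ : Type} [Group G] [MeasurableSpace Δ]
    (ν : Measure (G → Δ)) (p : Δ → ℝ≥0∞) : Prop :=
  ∀ (F : Finset G) (α : { g // g ∈ F } → Δ),
    ν {ω : G → Δ | ∀ g : { g // g ∈ F }, ω (g : G) = α g} = ∏ g : { g // g ∈ F }, p (α g)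

/-- A measure-theoretic isomorphism between two measure-preserving `G`-systems. -/
def IsMeasIsoG {G Y Z : Type} [Group G] [MeasurableSpace Y] [MeasurableSpace Z]
    (μ : Measure Y) (ν : Measure Z) (S : G → Y → Y) (T : G → Z → Z) : Prop :=
  ∃ (f : Y → Z) (f' : Z → Y), Measurable f ∧ Measurable f' ∧
    Measure.map f μ = ν ∧ Measure.map f' ν = μ ∧
    (∀ g : G, ∀ᵐ y ∂μ, f (S g y) = T g (f y)) ∧
    (∀ᵐ y ∂μ, f' (f y) = y) ∧ (∀ᵐ z ∂ν, f (f' z) = z)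

/-- A measure-preserving `G`-system is Bernoulli if it is measure-theoretically isomorphic to an
i.i.d. `G`-process (over a finite alphabet). -/
def IsBernoulliG {G Y : Type} [Group G] [MeasurableSpace Y]
    (μ : Measure Y) (S : G → Y → Y) : Prop :=
  ∃ (n : ℕ) (p : Fin n → ℝ≥0∞) (ν : Measure (G → Fin n)),
    (∑ i, p i) = 1 ∧ IsIIDG ν p ∧ IsMeasIsoG μ ν S gShift

/-- A measure-preserving `G`-system `(Y,μ,τY)` is Bernoulli relative to a factor
`(B,νB,τB)` along the factor map `proj` if it is isomorphic, by an isomorphism whose first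
coordinate is `proj`, to the direct product of the factor with an i.i.d. `G`-process. -/
def IsRelBernoulliG {G Y B : Type} [Group G] [MeasurableSpace Y] [MeasurableSpace B]
    (μ : Measure Y) (τY : G → Y → Y) (νB : Measure B) (τB : G → B → B) (proj : Y → B) : Prop :=
  ∃ (n : ℕ) (p : Fin n → ℝ≥0∞) (ν : Measure (G → Fin n)),
    (∑ i, p i) = 1 ∧ IsIIDG ν p ∧
    ∃ (f : Y → B × (G → Fin n)) (f' : B × (G → Fin n) → Y),
      Measurable f ∧ Measurable f' ∧
      Measure.map f μ = νB.prod ν ∧ Measure.map f' (νB.prod ν) = μ ∧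
      (∀ g : G, ∀ᵐ y ∂μ, f (τY g y) = (τB g (f y).1, gShift g (f y).2)) ∧
      (∀ᵐ y ∂μ, f' (f y) = y) ∧ (∀ᵐ z ∂(νB.prod ν), f (f' z) = z) ∧
      (∀ᵐ y ∂μ, (f y).1 = proj y)

/-- Ergodicity of a shift-invariant measure on `Λ^G`. -/
def ErgodicShiftG {G Λ : Type} [Group G] [MeasurableSpace Λ] (μ : Measure (G → Λ)) : Prop :=
  ∀ s : Set (G → Λ), MeasurableSet s → (∀ g : G, gShift g ⁻¹' s = s) → μ s = 0 ∨ μ s = 1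

/-- Freeness of a shift-invariant measure on `Λ^G`. -/
def FreeShift {G Λ : Type} [Group G] [MeasurableSpace Λ] (μ : Measure (G → Λ)) : Prop :=
  ∀ g : G, g ≠ 1 → μ {ω : G → Λ | gShift g ω = ω} = 0

/-- A measurable measure-preserving action of a group `G` on a measure space. -/
def IsMPAction {G X : Type} [Group G] [MeasurableSpace X]
    (μ : Measure X) (τ : G → X → X) : Prop :=
  (∀ x, τ 1 x = x) ∧ (∀ g h x, τ (g * h) x = τ g (τ h x)) ∧
  (∀ g, Measurable (τ g)) ∧ (∀ g, Measure.map (τ g) μ = μ)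

/-- Freeness of a measure-preserving action. -/
def IsFreeAction {G X : Type} [Group G] [MeasurableSpace X]
    (μ : Measure X) (τ : G → X → X) : Prop :=
  ∀ g : G, g ≠ 1 → μ {x : X | τ g x = x} = 0

/-- The itinerary (tiling factor map) of a point with respect to the bases `B i`:
`itin τ B x g = some i` iff `τ g x` lies in the base `B i`. -/
def itin {G X : Type} [Group G] {m : ℕ} (τ : G → X → X) (B : Fin m → Set X) (x : X) :
    G → Option (Fin m) :=
  fun g => if h : ∃ i, τ g x ∈ B i then some h.choose else none

/-- Shannon entropy of the length-`n` block partition of `A^ℤ`. -/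
def blockEntZ {A : Type} [Fintype A] [MeasurableSpace A]
    (μ : Measure (ℤ → A)) (n : ℕ) : ℝ :=
  ∑ α : Fin n → A,
    Real.negMulLog (μ {x : ℤ → A | ∀ i : Fin n, x ((i : ℕ) : ℤ) = α i}).toReal

/-- Kolmogorov–Sinai entropy of a shift-invariant measure on `A^ℤ`. -/
def entZ {A : Type} [Fintype A] [MeasurableSpace A] (μ : Measure (ℤ → A)) : ℝ :=
  limsup (fun n => blockEntZ μ n / (n : ℝ)) atTop

/-- `ν` is the i.i.d. (product) measure on `Δ^ℤ` with one-coordinate distribution `p`. -/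
def IsIIDZ {Δ : Type} [MeasurableSpace Δ] (ν : Measure (ℤ → Δ)) (p : Δ → ℝ≥0∞) : Prop :=
  ∀ (F : Finset ℤ) (α : { n // n ∈ F } → Δ),
    ν {x : ℤ → Δ | ∀ n : { n // n ∈ F }, x (n : ℤ) = α n} = ∏ n : { n // n ∈ F }, p (α n)

/-- A measure-theoretic isomorphism between two measure-preserving `ℤ`-systems
(given by single transformations). -/
def IsMeasIsoZ {Y Z : Type} [MeasurableSpace Y] [MeasurableSpace Z]
    (μ : Measure Y) (ν : Measure Z) (S : Y → Y) (T : Z → Z) : Prop :=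
  ∃ (f : Y → Z) (f' : Z → Y), Measurable f ∧ Measurable f' ∧
    Measure.map f μ = ν ∧ Measure.map f' ν = μ ∧
    (∀ᵐ y ∂μ, f (S y) = T (f y)) ∧
    (∀ᵐ y ∂μ, f' (f y) = y) ∧ (∀ᵐ z ∂ν, f (f' z) = z)

/-- A measure-preserving `ℤ`-system is Bernoulli if it is isomorphic to an i.i.d. `ℤ`-process. -/
def IsBernoulliZ {Y : Type} [MeasurableSpace Y] (μ : Measure Y) (S : Y → Y) : Prop :=
  ∃ (n : ℕ) (p : Fin n → ℝ≥0∞) (ν : Measure (ℤ → Fin n)),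
    (∑ i, p i) = 1 ∧ IsIIDZ ν p ∧ IsMeasIsoZ μ ν S (zShift 1)

/-- A measure-preserving `ℤ`-system `(Y,μ,T)` is Bernoulli relative to a factor `(B,νB,TB)`
along the factor map `proj` if it is isomorphic, by an isomorphism whose first coordinate is
`proj`, to the direct product of the factor with an i.i.d. `ℤ`-process. -/
def IsRelBernoulliZ {Y B : Type} [MeasurableSpace Y] [MeasurableSpace B]
    (μ : Measure Y) (T : Y → Y) (νB : Measure B) (TB : B → B) (proj : Y → B) : Prop :=
  ∃ (n : ℕ) (p : Fin n → ℝ≥0∞) (ν : Measure (ℤ → Fin n)),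
    (∑ i, p i) = 1 ∧ IsIIDZ ν p ∧
    ∃ (f : Y → B × (ℤ → Fin n)) (f' : B × (ℤ → Fin n) → Y),
      Measurable f ∧ Measurable f' ∧
      Measure.map f μ = νB.prod ν ∧ Measure.map f' (νB.prod ν) = μ ∧
      (∀ᵐ y ∂μ, f (T y) = (TB (f y).1, zShift 1 (f y).2)) ∧
      (∀ᵐ y ∂μ, f' (f y) = y) ∧ (∀ᵐ z ∂(νB.prod ν), f (f' z) = z) ∧
      (∀ᵐ y ∂μ, (f y).1 = proj y)

/-- The `n`-th power (`n ∈ ℤ`) of an invertible transformation given by `f` and its inverse. -/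
def zIter {Y : Type} (f finv : Y → Y) (n : ℤ) : Y → Y :=
  if 0 ≤ n then f^[n.toNat] else finv^[(-n).toNat]

/-- The `(R, [n₁, n₁+N-1])`-name of a point: the atom of `⋁_{i=n₁}^{n₁+N-1} T^{-i} R`
containing it, where the partition `R` is given by a map into a finite set `W`. -/
def wordOf {Y W : Type} (f finv : Y → Y) (R : Y → W) (n₁ : ℤ) (N : ℕ) (y : Y) : Fin N → W :=
  fun k => R (zIter f finv (n₁ + ((k : ℕ) : ℤ)) y)

/-- The distribution of the partition (given by) `R` conditioned on the set `E`. -/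
def condDist {Y W : Type} [MeasurableSpace Y] (μ : Measure Y) (R : Y → W) (E : Set Y) :
    W → ℝ := fun w => (μ (E ∩ R ⁻¹' {w})).toReal / (μ E).toReal

/-- ℓ¹ distance between two distributions on a finite set. -/
def distL1 {W : Type} [Fintype W] (p q : W → ℝ) : ℝ := ∑ w, |p w - q w|

/-- Normalized Hamming distance between two words of length `N`. -/
def hammDist {W : Type} [DecidableEq W] {N : ℕ} (a b : Fin N → W) : ℝ :=
  ((Finset.univ.filter (fun k => a k ≠ b k)).card : ℝ) / (N : ℝ)

/-- The `d̄`-distance between two distributions on words of length `N`: the infimum over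
couplings of the expected normalized Hamming distance. -/
def dbarN {W : Type} [Fintype W] [DecidableEq W] (N : ℕ) (p q : (Fin N → W) → ℝ) : ℝ :=
  sInf {r : ℝ | ∃ ξ : ((Fin N → W) × (Fin N → W)) → ℝ,
    (∀ pr, 0 ≤ ξ pr) ∧ (∀ a, (∑ b, ξ (a, b)) = p a) ∧ (∀ b, (∑ a, ξ (a, b)) = q b) ∧
    r = ∑ pr : (Fin N → W) × (Fin N → W), ξ pr * hammDist pr.1 pr.2}

/-- The partition `R` is very weakly Bernoulli relative to the partition `Q` for the invertible
transformation given by `f`, `finv`. -/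
def IsVWBrel {Y W V : Type} [MeasurableSpace Y] [Fintype W] [DecidableEq W]
    (μ : Measure Y) (f finv : Y → Y) (R : Y → W) (Q : Y → V) : Prop :=
  ∀ ε : ℝ, 0 < ε → ∃ N k₀ : ℕ, 0 < N ∧ ∀ k : ℕ, k₀ ≤ k →
    ∃ 𝒢 : Set ((Fin k → W) × (Fin (2 * k + 1) → V)),
      (μ {y | (wordOf f finv R (-(k : ℤ)) k y, wordOf f finv Q (-(k : ℤ)) (2 * k + 1) y) ∈ 𝒢}).toReal
        > 1 - ε ∧
      ∀ (a : Fin k → W) (b : Fin (2 * k + 1) → V), (a, b) ∈ 𝒢 →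
        dbarN N
          (condDist μ (wordOf f finv R 0 N)
            {y | wordOf f finv R (-(k : ℤ)) k y = a ∧ wordOf f finv Q (-(k : ℤ)) (2 * k + 1) y = b})
          (condDist μ (wordOf f finv R 0 N)
            {y | wordOf f finv Q (-(k : ℤ)) (2 * k + 1) y = b}) < ε

/-- Shannon entropy of a finite partition given by a map `R : Y → W`. -/
def partEnt {Y W : Type} [MeasurableSpace Y] [Fintype W] (μ : Measure Y) (R : Y → W) : ℝ :=
  ∑ w : W, Real.negMulLog (μ (R ⁻¹' {w})).toReal

/-- Conditional Shannon entropy `H(R | Q)` of finite partitions. -/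
def condEnt {Y W V : Type} [MeasurableSpace Y] [Fintype W] [Fintype V]
    (μ : Measure Y) (R : Y → W) (Q : Y → V) : ℝ :=
  partEnt μ (fun y => (R y, Q y)) - partEnt μ Q

/-- `R₀` is conditionally `ε`-independent of `R₂` given `R₁`. -/
def CondEpsIndep {Y W₀ W₁ W₂ : Type} [MeasurableSpace Y] [Fintype W₀]
    (μ : Measure Y) (R₀ : Y → W₀) (R₁ : Y → W₁) (R₂ : Y → W₂) (ε : ℝ) : Prop :=
  ∃ 𝒞 : Set (W₁ × W₂),
    (μ {y | (R₁ y, R₂ y) ∈ 𝒞}).toReal > 1 - ε ∧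
    ∀ c ∈ 𝒞, distL1 (condDist μ R₀ {y | R₁ y = c.1 ∧ R₂ y = c.2})
      (condDist μ R₀ {y | R₁ y = c.1}) < ε

/-- A family `S` of sets generates the full sigma-algebra modulo `μ`-null sets. -/
def IsGenMod {Y : Type} [MeasurableSpace Y] (μ : Measure Y) (S : Set (Set Y)) : Prop :=
  ∀ s : Set Y, MeasurableSet s →
    ∃ t : Set Y, MeasurableSet[MeasurableSpace.generateFrom S] t ∧ μ (s ∆ t) = 0

end



/-- All fibre unions of `R` are measurable, i.e. `R` is measurable for the discrete σ-algebra. -/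
def FMeas {Y W : Type} [MeasurableSpace Y] (R : Y → W) : Prop :=
  ∀ s : Set W, MeasurableSet (R ⁻¹' s)

section Entropy

lemma hellinger_term {q r : ℝ} (hq : 0 ≤ q) (hr : 0 ≤ r) (h0 : r = 0 → q = 0) :
    (√q - √r) ^ 2 + (q - r) ≤ q * Real.log q - q * Real.log r := by
  rcases hq.eq_or_lt with rfl | hq'
  · simp [Real.sq_sqrt hr]
  have hr' : 0 < r := lt_of_le_of_ne hr fun h => hq'.ne' (h0 h.symm)
  have hsq := Real.sqrt_pos.2 hq'
  have hsr := Real.sqrt_pos.2 hr'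
  have h1 : Real.log (√r / √q) ≤ √r / √q - 1 := Real.log_le_sub_one_of_pos (by positivity)
  rw [Real.log_div hsr.ne' hsq.ne', Real.log_sqrt hr, Real.log_sqrt hq] at h1
  have h2 : q * (√r / √q) = √q * √r := by
    rw [mul_div_assoc', div_eq_iff hsq.ne']
    nlinarith [Real.mul_self_sqrt hq]
  nlinarith [Real.mul_self_sqrt hq, Real.mul_self_sqrt hr, mul_le_mul_of_nonneg_left h1 hq]

lemma sum_hellinger_le {ι : Type} [Fintype ι] (q r : ι → ℝ) (hq : ∀ i, 0 ≤ q i)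
    (hr : ∀ i, 0 ≤ r i) (hs : ∑ i, r i ≤ ∑ i, q i) (h0 : ∀ i, r i = 0 → q i = 0) :
    ∑ i, (√(q i) - √(r i)) ^ 2 ≤ ∑ i, (q i * Real.log (q i) - q i * Real.log (r i)) := by
  have := Finset.sum_le_sum fun i (_ : i ∈ Finset.univ) => hellinger_term (hq i) (hr i) (h0 i)
  rw [Finset.sum_add_distrib, Finset.sum_sub_distrib (f := q)] at this
  linarith

lemma sum_negMulLog_le {ι : Type} [Fintype ι] (q r : ι → ℝ) (hq : ∀ i, 0 ≤ q i)
    (hr : ∀ i, 0 ≤ r i) (hs : ∑ i, r i ≤ ∑ i, q i) (h0 : ∀ i, r i = 0 → q i = 0) :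
    ∑ i, Real.negMulLog (q i) ≤ - ∑ i, q i * Real.log (r i) := by
  have h1 := sum_hellinger_le q r hq hr hs h0
  have h2 : 0 ≤ ∑ i, (√(q i) - √(r i)) ^ 2 := Finset.sum_nonneg fun i _ => sq_nonneg _
  rw [Finset.sum_sub_distrib] at h1
  simp only [Real.negMulLog, neg_mul, Finset.sum_neg_distrib]
  linarith

lemma negMulLog_sum_le {ι : Type} (s : Finset ι) (q : ι → ℝ) (hq : ∀ i, 0 ≤ q i) :
    Real.negMulLog (∑ i ∈ s, q i) ≤ ∑ i ∈ s, Real.negMulLog (q i) := by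
  rw [Real.negMulLog, neg_mul, Finset.sum_mul, ← Finset.sum_neg_distrib]
  refine Finset.sum_le_sum fun i hi => ?_
  rcases (hq i).eq_or_lt with h | h
  · simp [← h]
  · have : q i ≤ ∑ i ∈ s, q i := Finset.single_le_sum (fun i _ => hq i) hi
    have := Real.log_le_log h this
    rw [Real.negMulLog]
    nlinarith

variable {Y W V : Type} [MeasurableSpace Y]

lemma FMeas.comp {R : Y → W} (hR : FMeas R) (f : W → V) : FMeas (fun y => f (R y)) :=
  fun s => hR (f ⁻¹' s)

lemma FMeas.of_fintype [Finite W] {R : Y → W} (h : ∀ w, MeasurableSet (R ⁻¹' {w})) : FMeas R := by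
  intro s
  have : R ⁻¹' s = ⋃ w ∈ s, R ⁻¹' {w} := by ext; simp
  rw [this]
  exact MeasurableSet.biUnion (Set.to_countable s) fun w _ => h w

lemma FMeas.prod [Finite W] [Finite V] {R : Y → W} {Q : Y → V} (hR : FMeas R) (hQ : FMeas Q) :
    FMeas (fun y => (R y, Q y)) := by
  refine .of_fintype fun w => ?_
  have : (fun y => (R y, Q y)) ⁻¹' {w} = R ⁻¹' {w.1} ∩ Q ⁻¹' {w.2} := by
    ext; simp [Prod.ext_iff]
  rw [this]
  exact (hR _).inter (hQ _)

lemma FMeas.pi {ι : Type} [Finite ι] [Finite W] {R : ι → Y → W} (hR : ∀ i, FMeas (R i)) :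
    FMeas (fun y i => R i y) := by
  refine .of_fintype fun w => ?_
  have : (fun y i => R i y) ⁻¹' {w} = ⋂ i, R i ⁻¹' {w i} := by
    ext; simp [funext_iff]
  rw [this]
  exact MeasurableSet.iInter fun i => hR i _

variable (μ : Measure Y) [IsProbabilityMeasure μ]

lemma sum_real_fiber [Fintype W] {R : Y → W} (hR : FMeas R) (t : Set W) :
    ∑ w with w ∈ t, μ.real (R ⁻¹' {w}) = μ.real (R ⁻¹' t) := by
  rw [← measureReal_biUnion_finset]
  · congr 1; ext; simp
  · intro i _ j _ hij
    exact Disjoint.preimage _ (by simpa using hij)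
  · exact fun w _ => hR _

lemma sum_real_fiber_univ [Fintype W] {R : Y → W} (hR : FMeas R) :
    ∑ w, μ.real (R ⁻¹' {w}) = 1 := by
  have := sum_real_fiber μ hR Set.univ
  simpa using this

lemma sum_real_pair_snd [Fintype W] [Fintype V] {R : Y → W} {Q : Y → V} (hR : FMeas R)
    (hQ : FMeas Q) (w : W) :
    ∑ v, μ.real ((fun y => (R y, Q y)) ⁻¹' {(w, v)}) = μ.real (R ⁻¹' {w}) := by
  have h := sum_real_fiber μ (hR.prod hQ) {p | p.1 = w}
  have h2 : (fun y => (R y, Q y)) ⁻¹' {p | p.1 = w} = R ⁻¹' {w} := by ext; simp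
  rw [h2] at h
  rw [← h, Finset.sum_filter, Fintype.sum_prod_type, Finset.sum_eq_single w]
  · simp
  · intro b _ hb; simp [hb]
  · simp

lemma sum_real_pair_fst [Fintype W] [Fintype V] {R : Y → W} {Q : Y → V} (hR : FMeas R)
    (hQ : FMeas Q) (v : V) :
    ∑ w, μ.real ((fun y => (R y, Q y)) ⁻¹' {(w, v)}) = μ.real (Q ⁻¹' {v}) := by
  rw [← sum_real_pair_snd μ hQ hR v]
  refine Finset.sum_congr rfl fun w _ => ?_
  congr 1; ext; simp [and_comm]

omit [IsProbabilityMeasure μ] in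
lemma partEnt_eq [Fintype W] (R : Y → W) :
    partEnt μ R = ∑ w, Real.negMulLog (μ.real (R ⁻¹' {w})) := rfl

lemma partEnt_nonneg [Fintype W] (R : Y → W) : 0 ≤ partEnt μ R :=
  Finset.sum_nonneg fun _ _ => Real.negMulLog_nonneg measureReal_nonneg measureReal_le_one

lemma partEnt_comp_le [Fintype W] [Fintype V] {R : Y → W} (hR : FMeas R) (f : W → V) :
    partEnt μ (fun y => f (R y)) ≤ partEnt μ R := by
  rw [partEnt_eq, partEnt_eq]
  have h : ∀ v, μ.real ((fun y => f (R y)) ⁻¹' {v}) = ∑ w with f w = v, μ.real (R ⁻¹' {w}) := by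
    intro v
    exact (sum_real_fiber μ hR (f ⁻¹' {v})).symm
  calc _ ≤ ∑ v, ∑ w with f w = v, Real.negMulLog (μ.real (R ⁻¹' {w})) := by
        refine Finset.sum_le_sum fun v _ => ?_
        rw [h]
        exact negMulLog_sum_le _ _ fun _ => measureReal_nonneg
    _ = _ := Finset.sum_fiberwise _ _ _

lemma partEnt_prod_le [Fintype W] [Fintype V] {R : Y → W} {Q : Y → V} (hR : FMeas R)
    (hQ : FMeas Q) : partEnt μ (fun y => (R y, Q y)) ≤ partEnt μ R + partEnt μ Q := by
  rw [partEnt_eq, partEnt_eq, partEnt_eq]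
  have hm1 : ∀ p : W × V, μ.real ((fun y => (R y, Q y)) ⁻¹' {p}) ≤ μ.real (R ⁻¹' {p.1}) :=
    fun p => measureReal_mono (fun y hy => by simp_all [Prod.ext_iff])
  have hm2 : ∀ p : W × V, μ.real ((fun y => (R y, Q y)) ⁻¹' {p}) ≤ μ.real (Q ⁻¹' {p.2}) :=
    fun p => measureReal_mono (fun y hy => by simp_all [Prod.ext_iff])
  have hg := sum_negMulLog_le (fun p : W × V => μ.real ((fun y => (R y, Q y)) ⁻¹' {p}))
    (fun p => μ.real (R ⁻¹' {p.1}) * μ.real (Q ⁻¹' {p.2})) (fun _ => measureReal_nonneg)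
    (fun _ => mul_nonneg measureReal_nonneg measureReal_nonneg) ?_ ?_
  · refine hg.trans (le_of_eq ?_)
    have h1 : ∀ p : W × V, μ.real ((fun y => (R y, Q y)) ⁻¹' {p}) *
        Real.log (μ.real (R ⁻¹' {p.1}) * μ.real (Q ⁻¹' {p.2})) =
        μ.real ((fun y => (R y, Q y)) ⁻¹' {p}) * Real.log (μ.real (R ⁻¹' {p.1})) +
        μ.real ((fun y => (R y, Q y)) ⁻¹' {p}) * Real.log (μ.real (Q ⁻¹' {p.2})) := by
      intro p
      by_cases hz : μ.real ((fun y => (R y, Q y)) ⁻¹' {p}) = 0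
      · simp [hz]
      · have hp : 0 < μ.real ((fun y => (R y, Q y)) ⁻¹' {p}) :=
          lt_of_le_of_ne measureReal_nonneg (Ne.symm hz)
        rw [Real.log_mul (hp.trans_le (hm1 p)).ne' (hp.trans_le (hm2 p)).ne', mul_add]
    simp only [h1]
    rw [Finset.sum_add_distrib, Fintype.sum_prod_type, Fintype.sum_prod_type_right]
    simp only [← Finset.sum_mul, sum_real_pair_snd μ hR hQ, sum_real_pair_fst μ hR hQ,
      Real.negMulLog, neg_mul, Finset.sum_neg_distrib]
    ring
  · rw [sum_real_fiber_univ μ (hR.prod hQ), Fintype.sum_prod_type]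
    simp only [← Finset.mul_sum, sum_real_fiber_univ μ hQ, mul_one]
    exact (sum_real_fiber_univ μ hR).le
  · intro p hp
    rcases mul_eq_zero.1 hp with h | h
    · exact le_antisymm (h ▸ hm1 p) measureReal_nonneg
    · exact le_antisymm (h ▸ hm2 p) measureReal_nonneg

lemma partEnt_le_log_card [Fintype W] {R : Y → W} (hR : FMeas R) :
    partEnt μ R ≤ Real.log (Fintype.card W) := by
  obtain ⟨y⟩ : Nonempty Y := nonempty_of_isProbabilityMeasure μ
  have : Nonempty W := ⟨R y⟩
  have hc : (0 : ℝ) < Fintype.card W := by exact_mod_cast Fintype.card_pos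
  have := sum_negMulLog_le (fun w => μ.real (R ⁻¹' {w})) (fun _ => (Fintype.card W : ℝ)⁻¹)
    (fun _ => measureReal_nonneg) (fun _ => by positivity)
    (by simp [sum_real_fiber_univ μ hR, hc.ne']) (fun _ h => by simp at h)
  rw [partEnt_eq]
  refine this.trans (le_of_eq ?_)
  rw [← Finset.sum_mul, sum_real_fiber_univ μ hR, Real.log_inv]
  ring

lemma partEnt_congr_of_law {Y' : Type} [MeasurableSpace Y'] [Fintype W] {μ : Measure Y}
    {μ' : Measure Y'} {R : Y → W} {R' : Y' → W}
    (h : ∀ w, μ (R ⁻¹' {w}) = μ' (R' ⁻¹' {w})) : partEnt μ R = partEnt μ' R' := by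
  simp only [partEnt, h]

lemma partEnt_pi_le [Fintype W] (n : ℕ) {R : Fin n → Y → W} (hR : ∀ i, FMeas (R i)) :
    partEnt μ (fun y i => R i y) ≤ ∑ i, partEnt μ (R i) := by
  induction n with
  | zero =>
    refine (partEnt_le_log_card μ (FMeas.pi hR)).trans ?_
    simp
  | succ n ih =>
    have h2 : FMeas fun y (i : Fin n) => R i.succ y := FMeas.pi fun i : Fin n => hR i.succ
    have h1 : (fun y i => R i y) = fun y => Fin.consEquiv (fun _ => W)
        (R 0 y, fun i => R (Fin.succ i) y) := by
      funext y i
      refine Fin.cases ?_ (fun j => ?_) i <;> simp [Fin.consEquiv]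
    rw [h1, Fin.sum_univ_succ]
    have h3 := partEnt_prod_le μ (hR 0) h2
    have h4 := ih (R := fun i => R i.succ) fun i => hR i.succ
    have h5 := partEnt_comp_le μ (R := fun y => (R 0 y, fun i : Fin n => R i.succ y))
      ((hR 0).prod h2) (Fin.consEquiv fun _ => W)
    linarith

/-- A finite-valued variable which is constant off a set of small probability has small entropy. -/
lemma exists_partEnt_lt (W : Type) [Fintype W] {τ : ℝ} (hτ : 0 < τ) :
    ∃ ε > 0, ∀ {Y : Type} [MeasurableSpace Y] (μ : Measure Y) [IsProbabilityMeasure μ]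
      {R : Y → W} (_ : FMeas R) (w₀ : W), μ.real {y | R y ≠ w₀} < ε → partEnt μ R < τ := by
  have hcont : ∀ x₀ : ℝ, Real.negMulLog x₀ = 0 → ∃ ε > 0, ∀ x, |x - x₀| < ε →
      Real.negMulLog x < τ / (Fintype.card W + 1) := by
    intro x₀ h0
    have := (Metric.continuous_iff.1 Real.continuous_negMulLog) x₀ (τ / (Fintype.card W + 1))
      (by positivity)
    obtain ⟨ε, he, h⟩ := this
    refine ⟨ε, he, fun x hx => ?_⟩
    have := h x hx
    rw [h0, Real.dist_eq, sub_zero] at this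
    exact (le_abs_self _).trans_lt this
  obtain ⟨ε₀, h0, H0⟩ := hcont 0 (by simp)
  obtain ⟨ε₁, h1, H1⟩ := hcont 1 (by simp)
  refine ⟨min ε₀ ε₁, lt_min h0 h1, ?_⟩
  intro Y _ μ _ R hR w₀ hlt
  have hle : ∀ w, Real.negMulLog (μ.real (R ⁻¹' {w})) ≤ τ / (Fintype.card W + 1) := by
    intro w
    by_cases hw : w = w₀
    · subst hw
      refine (H1 _ ?_).le
      have := probReal_compl_eq_one_sub (μ := μ) (hR {w})
      have h3 : (R ⁻¹' {w})ᶜ = {y | R y ≠ w} := by ext; simp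
      rw [h3] at this
      rw [abs_sub_comm, ← this, abs_of_nonneg measureReal_nonneg]
      exact hlt.trans_le (min_le_right _ _)
    · refine (H0 _ ?_).le
      rw [sub_zero, abs_of_nonneg measureReal_nonneg]
      refine (measureReal_mono ?_).trans_lt (hlt.trans_le (min_le_left _ _))
      intro y hy
      simp only [Set.mem_preimage, Set.mem_singleton_iff] at hy
      simp [hy, hw]
  rw [partEnt_eq]
  refine (Finset.sum_le_sum fun w _ => hle w).trans_lt ?_
  simp only [Finset.sum_const, Finset.card_univ, nsmul_eq_mul]
  rw [mul_div_assoc', div_lt_iff₀ (by positivity)]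
  nlinarith

end Entropy


section Stationary

variable {D : Type}

lemma zShift_zShift (j k : ℤ) (x : ℤ → D) : zShift j (zShift k x) = zShift (j + k) x := by
  funext n; simp [zShift, add_assoc]

lemma zShift_zero (x : ℤ → D) : zShift 0 x = x := by
  funext n; simp [zShift]

variable [MeasurableSpace D]

lemma measurable_zShift (k : ℤ) : Measurable (zShift k : (ℤ → D) → ℤ → D) :=
  measurable_pi_lambda _ fun n => measurable_pi_apply (n + k)

/-- Shift-invariance of a measure on `D^ℤ`. -/
def Stat (μ : Measure (ℤ → D)) : Prop := Measure.map (zShift 1) μ = μ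

variable {μ : Measure (ℤ → D)}

lemma Stat.map_zShift (h : Stat μ) (k : ℤ) : Measure.map (zShift k) μ = μ := by
  have hinv : Measure.map (zShift (-1)) μ = μ := by
    conv_lhs => rw [← h]
    rw [Measure.map_map (measurable_zShift _) (measurable_zShift _)]
    have : (zShift (-1) ∘ zShift 1 : (ℤ → D) → ℤ → D) = id := by
      funext x; simp [zShift_zShift, zShift_zero]
    rw [this, Measure.map_id]
  induction k using Int.induction_on with
  | zero =>
    have : (zShift 0 : (ℤ → D) → ℤ → D) = id := by funext x; simp [zShift_zero]
    rw [this, Measure.map_id]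
  | succ n ih =>
    have : (zShift ((n : ℤ) + 1) : (ℤ → D) → ℤ → D) = zShift 1 ∘ zShift n := by
      funext x; simp [zShift_zShift, add_comm]
    rw [this, ← Measure.map_map (measurable_zShift _) (measurable_zShift _), ih, h]
  | pred n ih =>
    have : (zShift (-(n : ℤ) - 1) : (ℤ → D) → ℤ → D) = zShift (-1) ∘ zShift (-n) := by
      funext x; simp only [Function.comp, zShift_zShift]; congr 1; ring
    rw [this, ← Measure.map_map (measurable_zShift _) (measurable_zShift _), ih, hinv]

lemma Stat.measure_preimage (h : Stat μ) (k : ℤ) {s : Set (ℤ → D)} (hs : MeasurableSet s) :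
    μ (zShift k ⁻¹' s) = μ s := by
  conv_rhs => rw [← h.map_zShift k]
  rw [Measure.map_apply (measurable_zShift k) hs]

lemma Stat.real_preimage (h : Stat μ) (k : ℤ) {s : Set (ℤ → D)} (hs : MeasurableSet s) :
    μ.real (zShift k ⁻¹' s) = μ.real s := by
  simp only [Measure.real, h.measure_preimage k hs]

variable [DiscreteMeasurableSpace D] {W V : Type}

lemma fMeas_coord (π : D → W) (n : ℤ) : FMeas (fun z : ℤ → D => π (z n)) :=
  fun s => (measurable_pi_apply n : Measurable fun z : ℤ → D => z n) (MeasurableSet.of_discrete (s := π ⁻¹' s))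

/-- `f` depends only on the coordinates in `[-m, m]`. -/
def Loc {D W : Type} (m : ℕ) (f : (ℤ → D) → W) : Prop :=
  ∀ x y : ℤ → D, (∀ i : ℤ, -m ≤ i → i ≤ m → x i = y i) → f x = f y

omit [MeasurableSpace D] [DiscreteMeasurableSpace D] in
lemma Loc.mono {m m' : ℕ} (hm : m ≤ m') {f : (ℤ → D) → W} (hf : Loc m f) : Loc m' f :=
  fun x y h => hf x y fun i h1 h2 => h i (by omega) (by omega)

omit [MeasurableSpace D] [DiscreteMeasurableSpace D] in
lemma Loc.exists_factor {m : ℕ} {f : (ℤ → D) → W} (hf : Loc m f) :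
    ∃ F : (Fin (2 * m + 1) → D) → W, ∀ x, f x = F (fun i => x ((i : ℤ) - m)) := by
  refine ⟨fun w => f fun n => w ⟨min (n + m).toNat (2 * m), by omega⟩, fun x => hf _ _ ?_⟩
  intro i h1 h2
  dsimp only
  congr 1
  push_cast
  omega

lemma Loc.fMeas [Finite D] {m : ℕ} {f : (ℤ → D) → W} (hf : Loc m f) : FMeas f := by
  obtain ⟨F, hF⟩ := hf.exists_factor
  have := (FMeas.pi fun i : Fin (2 * m + 1) => fMeas_coord (D := D) id ((i : ℤ) - m)).comp F
  simpa [← hF] using this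

/-- Entropy of the `n`-block of the letter-to-letter image of a process. -/
noncomputable def hp [Fintype W] (μ : Measure (ℤ → D)) (π : D → W) (n : ℕ) : ℝ :=
  partEnt μ (fun z (i : Fin n) => π (z (i : ℤ)))

/-- Entropy of the letter-to-letter image of a process. -/
noncomputable def hent [Fintype W] (μ : Measure (ℤ → D)) (π : D → W) : ℝ :=
  limsup (fun n => hp μ π n / (n : ℝ)) atTop

lemma fMeas_block [Finite W] (π : D → W) (n : ℕ) (k : ℤ) :
    FMeas (fun (z : ℤ → D) (i : Fin n) => π (z ((i : ℤ) + k))) :=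
  FMeas.pi fun i : Fin n => fMeas_coord π ((i : ℤ) + k)

lemma Stat.hp_eq [Fintype W] (h : Stat μ) (π : D → W) (n : ℕ) (k : ℤ) :
    partEnt μ (fun z (i : Fin n) => π (z ((i : ℤ) + k))) = hp μ π n := by
  refine partEnt_congr_of_law fun w => ?_
  have := fMeas_block (D := D) π n 0 {w}
  simp only [add_zero] at this
  rw [← h.measure_preimage k this]
  rfl

variable [IsProbabilityMeasure μ]

omit [DiscreteMeasurableSpace D] in
lemma hp_nonneg [Fintype W] (π : D → W) (n : ℕ) : 0 ≤ hp μ π n := partEnt_nonneg _ _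

lemma hp_le [Fintype W] (π : D → W) (n : ℕ) : hp μ π n ≤ n * Real.log (Fintype.card W) := by
  have := partEnt_le_log_card μ (fMeas_block (D := D) π n 0)
  simpa [hp] using this

lemma Stat.subadditive [Fintype W] (h : Stat μ) (π : D → W) : Subadditive (hp μ π) := by
  intro m n
  have h1 : FMeas (fun (z : ℤ → D) (i : Fin m) => π (z (i : ℤ))) := by
    simpa using fMeas_block (D := D) π m 0
  have h2 := fMeas_block (D := D) π n m
  have h3 := partEnt_prod_le μ h1 h2
  rw [h.hp_eq π n m] at h3
  have h4 := partEnt_comp_le μ (h1.prod h2)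
    (fun p => (Fin.append p.1 p.2 : Fin (m + n) → W))
  refine le_trans (le_of_eq ?_) (h4.trans h3)
  unfold hp
  congr 1
  funext z i
  refine Fin.addCases (fun i => ?_) (fun i => ?_) i
  · simp
  · simp [add_comm]

omit [DiscreteMeasurableSpace D] in
lemma bddBelow_hp [Fintype W] (π : D → W) :
    BddBelow (Set.range fun n : ℕ => hp μ π n / (n : ℝ)) :=
  ⟨0, by rintro _ ⟨n, rfl⟩; exact div_nonneg (hp_nonneg π n) (by positivity)⟩

lemma Stat.tendsto_hent [Fintype W] (h : Stat μ) (π : D → W) :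
    Tendsto (fun n : ℕ => hp μ π n / (n : ℝ)) atTop (nhds (hent μ π)) := by
  have h1 := (h.subadditive π).tendsto_lim (bddBelow_hp π)
  rw [hent, h1.limsup_eq]
  exact h1

lemma Stat.hent_le [Fintype W] (h : Stat μ) (π : D → W) {n : ℕ} (hn : n ≠ 0) :
    hent μ π ≤ hp μ π n / n := by
  have h1 := (h.subadditive π).tendsto_lim (bddBelow_hp π)
  rw [hent, h1.limsup_eq]
  exact (h.subadditive π).lim_le_div (bddBelow_hp π) hn

lemma Stat.mul_hent_le [Fintype W] (h : Stat μ) (π : D → W) (n : ℕ) :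
    n * hent μ π ≤ hp μ π n := by
  rcases Nat.eq_zero_or_pos n with rfl | hn
  · simpa using hp_nonneg π 0
  · have := h.hent_le π hn.ne'
    rw [le_div_iff₀ (by exact_mod_cast hn)] at this
    linarith

lemma Stat.le_hent [Fintype W] (h : Stat μ) (π : D → W) {c K : ℝ}
    (hc : ∀ n : ℕ, n * c ≤ hp μ π n + K) : c ≤ hent μ π := by
  have h1 : Tendsto (fun n : ℕ => hp μ π n / (n : ℝ) + K / n) atTop (nhds (hent μ π + 0)) :=
    (h.tendsto_hent π).add (tendsto_const_div_atTop_nhds_zero_nat K)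
  rw [add_zero] at h1
  refine ge_of_tendsto h1 ?_
  filter_upwards [eventually_gt_atTop 0] with n hn
  have : (0 : ℝ) < n := by exact_mod_cast hn
  rw [← add_div, le_div_iff₀ this]
  linarith [hc n]

/-- If the process `π` is determined, up to an error of entropy `τ`, by a finite code of the process
`ρ`, then its entropy is at most that of `ρ` plus `τ`. -/
lemma Stat.hent_le_of_code [Fintype W] [Fintype V] (h : Stat μ) (π : D → W) (ρ : D → V) {m : ℕ}
    {f : (ℤ → V) → W} (hf : Loc m f) {τ : ℝ}
    (hτ : partEnt μ (fun z : ℤ → D => if π (z 0) = f (fun i => ρ (z i)) then none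
      else some (π (z 0))) ≤ τ) :
    hent μ π ≤ hent μ ρ + τ := by
  obtain ⟨F, hF⟩ := hf.exists_factor
  set Z : (ℤ → D) → Option W := fun z => if π (z 0) = f (fun i => ρ (z i)) then none
      else some (π (z 0)) with hZ
  have hwin : FMeas (fun (z : ℤ → D) (i : Fin (2 * m + 1)) => ρ (z ((i : ℤ) - m))) := by
    simpa [sub_eq_add_neg] using fMeas_block (D := D) ρ (2 * m + 1) (-m)
  have hZm : FMeas Z := by
    have := ((fMeas_coord (D := D) π 0).prod hwin).comp
      (fun p => if p.1 = F p.2 then none else some p.1)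
    simpa [hZ, hF] using this
  have hZs : ∀ k : ℤ, FMeas (fun z => Z (zShift k z)) := fun k s =>
    measurable_zShift k (hZm s)
  have hZent : ∀ k : ℤ, partEnt μ (fun z => Z (zShift k z)) = partEnt μ Z := fun k =>
    partEnt_congr_of_law fun w => h.measure_preimage k (hZm {w})
  have key : ∀ n : ℕ, hp μ π n ≤ n * τ + hp μ ρ n + hp μ ρ (2 * m) := by
    intro n
    have hb := fMeas_block (D := D) ρ (n + 2 * m) (-m)
    have hZp : FMeas fun z (i : Fin n) => Z (zShift (i : ℤ) z) := FMeas.pi fun i => hZs _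
    have e1 := partEnt_prod_le μ hb hZp
    rw [h.hp_eq] at e1
    have e2 := partEnt_pi_le μ n (R := fun (i : Fin n) z => Z (zShift (i : ℤ) z)) fun i => hZs _
    simp only [hZent, Finset.sum_const, Finset.card_univ, Fintype.card_fin, nsmul_eq_mul] at e2
    have e3 := partEnt_comp_le μ (hb.prod hZp) (fun p (i : Fin n) =>
      (p.2 i).getD (F fun j : Fin (2 * m + 1) => p.1 ⟨i + j, by omega⟩))
    have e4 : hp μ π n = partEnt μ (fun z => (fun p : (Fin (n + 2 * m) → V) × (Fin n → Option W) =>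
        fun (i : Fin n) => (p.2 i).getD (F fun j : Fin (2 * m + 1) => p.1 ⟨i + j, by omega⟩))
        (fun i : Fin (n + 2 * m) => ρ (z ((i : ℤ) + -m)), fun i : Fin n => Z (zShift (i : ℤ) z))) := by
      unfold hp
      congr 1
      funext z i
      have hw : (F fun j : Fin (2 * m + 1) => ρ (z (((i + j : ℕ) : ℤ) + -m))) =
          f (fun k => ρ (zShift (i : ℤ) z k)) := by
        rw [hF]
        congr 1; funext j; simp only [zShift]; congr 2; push_cast; ring
      dsimp only
      rw [hw]
      simp only [hZ]
      have h0 : zShift (i : ℤ) z 0 = z i := by simp [zShift]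
      rw [h0]
      split_ifs with hh
      · simpa using hh
      · simp
    have e5 := h.subadditive ρ n (2 * m)
    have e6 : (n : ℝ) * partEnt μ Z ≤ n * τ := by gcongr
    linarith
  have := h.tendsto_hent π
  have hr : Tendsto (fun n : ℕ => τ + hp μ ρ n / (n : ℝ) + hp μ ρ (2 * m) / n) atTop
      (nhds (τ + hent μ ρ + 0)) :=
    ((h.tendsto_hent ρ).const_add τ).add (tendsto_const_div_atTop_nhds_zero_nat _)
  rw [add_zero, add_comm] at hr
  refine le_of_tendsto_of_tendsto this hr ?_
  filter_upwards [eventually_gt_atTop 0] with n hn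
  have hn' : (0 : ℝ) < n := by exact_mod_cast hn
  have := key n
  rw [div_le_iff₀ hn']
  field_simp
  linarith

end Stationary


section Coupling

variable {B : Type} [Fintype B]

lemma sum_abs_sub_le {q p : B → ℝ} (hq : ∀ b, 0 ≤ q b) (hp : ∀ b, 0 < p b) (hq1 : ∑ b, q b = 1)
    (hp1 : ∑ b, p b = 1) {θ : ℝ} (hθ : 0 < θ) :
    ∑ b, |q b - p b| ≤ θ + (∑ b, (q b * Real.log (q b) - q b * Real.log (p b))) / θ := by
  have h1 := sum_hellinger_le q p hq (fun b => (hp b).le) (by rw [hq1, hp1])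
    (fun b h => absurd h (hp b).ne')
  have h2 : ∀ b, |q b - p b| ≤ (√(q b) - √(p b)) ^ 2 / θ + θ * (q b + p b) / 2 := by
    intro b
    have e1 := Real.mul_self_sqrt (hq b)
    have e2 := Real.mul_self_sqrt (hp b).le
    set x := √(q b)
    set y := √(p b)
    have e3 : q b - p b = (x - y) * (x + y) := by rw [← e1, ← e2]; ring
    rw [e3, ← e1, ← e2]
    have hT : ((x - y) ^ 2 / θ + θ * (x * x + y * y) / 2) * θ =
        (x - y) ^ 2 + θ ^ 2 * (x * x + y * y) / 2 := by field_simp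
    refine abs_le.2 ⟨neg_le.1 (le_of_mul_le_mul_right ?_ hθ), le_of_mul_le_mul_right ?_ hθ⟩
    · rw [hT]
      have : 0 ≤ ((x - y) + θ * (x + y) / 2) ^ 2 + θ ^ 2 * (x - y) ^ 2 / 4 := by positivity
      nlinarith
    · rw [hT]
      have : 0 ≤ ((x - y) - θ * (x + y) / 2) ^ 2 + θ ^ 2 * (x - y) ^ 2 / 4 := by positivity
      nlinarith
  calc _ ≤ ∑ b, ((√(q b) - √(p b)) ^ 2 / θ + θ * (q b + p b) / 2) :=
        Finset.sum_le_sum fun b _ => h2 b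
    _ = (∑ b, (√(q b) - √(p b)) ^ 2) / θ + θ := by
        rw [Finset.sum_add_distrib, ← Finset.sum_div, ← Finset.sum_div, ← Finset.mul_sum,
          Finset.sum_add_distrib, hq1, hp1]
        ring
    _ ≤ _ := by
        rw [add_comm]; gcongr

lemma exists_coupling {q p : B → ℝ} (hq : ∀ b, 0 ≤ q b) (hp : ∀ b, 0 ≤ p b)
    (hqp : ∑ b, q b = ∑ b, p b) :
    ∃ γ : B → B → ℝ, (∀ b b', 0 ≤ γ b b') ∧ (∀ b, ∑ b', γ b b' = q b) ∧
      (∀ b', ∑ b, γ b b' = p b') ∧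
      ∑ b, ∑ b', γ b b' * (if b ≠ b' then 1 else 0) ≤ ∑ b, |q b - p b| := by
  set m : B → ℝ := fun b => min (q b) (p b)
  set s := ∑ b, (q b - m b) with hs
  have hs' : ∑ b, (p b - m b) = s := by
    rw [hs, Finset.sum_sub_distrib, Finset.sum_sub_distrib, hqp]
  have hqm : ∀ b, 0 ≤ q b - m b := fun b => sub_nonneg.2 (min_le_left _ _)
  have hpm : ∀ b, 0 ≤ p b - m b := fun b => sub_nonneg.2 (min_le_right _ _)
  have hs0 : 0 ≤ s := Finset.sum_nonneg fun b _ => hqm b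
  have hss : ∀ x, 0 ≤ x → x ≤ s → x * s / s = x := by
    intro x h0 hx
    by_cases h : s = 0
    · rw [h] at hx ⊢; simp [le_antisymm hx h0]
    · field_simp
  refine ⟨fun b b' => (if b = b' then m b else 0) + (q b - m b) * (p b' - m b') / s, ?_, ?_, ?_, ?_⟩
  · intro b b'
    have : 0 ≤ m b := le_min (hq b) (hp b)
    have := hqm b
    have := hpm b'
    dsimp only
    split_ifs <;> positivity
  · intro b
    rw [Finset.sum_add_distrib, ← Finset.sum_div, ← Finset.mul_sum, hs', hss _ (hqm b)
      (Finset.single_le_sum (f := fun b => q b - m b) (fun b _ => hqm b) (Finset.mem_univ b))]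
    simp
  · intro b
    rw [Finset.sum_add_distrib, ← Finset.sum_div, ← Finset.sum_mul, ← hs, mul_comm, hss _ (hpm b)
      (hs' ▸ Finset.single_le_sum (f := fun b => p b - m b) (fun b _ => hpm b) (Finset.mem_univ b))]
    simp
  · calc _ ≤ ∑ b, ∑ b', (q b - m b) * (p b' - m b') / s := by
          refine Finset.sum_le_sum fun b _ => Finset.sum_le_sum fun b' _ => ?_
          have : 0 ≤ (q b - m b) * (p b' - m b') / s :=
            div_nonneg (mul_nonneg (hqm b) (hpm b')) hs0
          by_cases h : b = b' <;> simp [h]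
          rw [← h]; simpa [h] using this
      _ = s := by
          simp only [← Finset.sum_div, ← Finset.mul_sum, hs', ← Finset.sum_mul, ← hs]
          exact hss s hs0 le_rfl
      _ ≤ _ := by
          refine Finset.sum_le_sum fun b _ => ?_
          rcases le_total (q b) (p b) with h | h
          · simp [m, h]
          · simp only [m, min_eq_right h]; exact le_abs_self _

/-- The number of coordinates at which two words differ. -/
noncomputable def mism {n : ℕ} (x y : Fin n → B) : ℝ := ∑ i, if x i ≠ y i then 1 else 0

omit [Fintype B] in
lemma mism_cons {n : ℕ} (b b' : B) (x y : Fin n → B) :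
    mism (Fin.cons b x : Fin (n + 1) → B) (Fin.cons b' y) =
      (if b ≠ b' then 1 else 0) + mism x y := by
  simp [mism, Fin.sum_univ_succ]

lemma sum_fin_cons {n : ℕ} (F : (Fin (n + 1) → B) → ℝ) :
    ∑ x, F x = ∑ b, ∑ x : Fin n → B, F (Fin.cons b x) := by
  rw [← (Fin.consEquiv fun _ : Fin (n + 1) => B).sum_comp, Fintype.sum_prod_type]
  rfl

lemma exists_coupling_pow {p : B → ℝ} (hp : ∀ b, 0 < p b) (hp1 : ∑ b, p b = 1) {θ : ℝ}
    (hθ : 0 < θ) (n : ℕ) (q : (Fin n → B) → ℝ) (hq : ∀ x, 0 ≤ q x) (hq1 : ∑ x, q x = 1) :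
    ∃ ξ : (Fin n → B) → (Fin n → B) → ℝ, (∀ x y, 0 ≤ ξ x y) ∧ (∀ x, ∑ y, ξ x y = q x) ∧
      (∀ y, ∑ x, ξ x y = ∏ i, p (y i)) ∧
      ∑ x, ∑ y, ξ x y * mism x y ≤ n * θ +
        (∑ x, (q x * Real.log (q x) - q x * ∑ i, Real.log (p (x i)))) / θ := by
  induction n with
  | zero =>
    have hu : q default = 1 := by simpa using hq1
    have hd : ∀ x, q x = 1 := fun x => by rw [Subsingleton.elim x default, hu]
    exact ⟨fun _ _ => 1, fun _ _ => zero_le_one, fun x => by simp [hd], fun y => by simp,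
      by simp [mism, hd]⟩
  | succ n ih =>
    set q₁ : B → ℝ := fun b => ∑ x : Fin n → B, q (Fin.cons b x) with hq₁
    have hpow : ∀ m, ∑ x : Fin m → B, ∏ i, p (x i) = 1 := fun m => by
      rw [← Fintype.piFinset_univ, Finset.sum_prod_piFinset (s := Finset.univ) (g := fun _ b => p b)]
      simp [hp1]
    have hq₁0 : ∀ b, 0 ≤ q₁ b := fun b => Finset.sum_nonneg fun x _ => hq _
    have hq₁1 : ∑ b, q₁ b = 1 := by rw [← hq1, sum_fin_cons]
    set qc : B → (Fin n → B) → ℝ := fun b x =>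
      if q₁ b = 0 then ∏ i, p (x i) else q (Fin.cons b x) / q₁ b with hqc
    have hqc0 : ∀ b x, 0 ≤ qc b x := by
      intro b x
      simp only [hqc]
      split_ifs
      · exact Finset.prod_nonneg fun i _ => (hp _).le
      · exact div_nonneg (hq _) (hq₁0 _)
    have hqc1 : ∀ b, ∑ x, qc b x = 1 := by
      intro b
      simp only [hqc]
      split_ifs with h
      · exact hpow n
      · rw [← Finset.sum_div]; exact div_self h
    have hqq : ∀ b x, q (Fin.cons b x) = q₁ b * qc b x := by
      intro b x
      simp only [hqc]
      split_ifs with h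
      · rw [h, zero_mul]
        exact (Finset.sum_eq_zero_iff_of_nonneg fun x _ => hq _).1 h x (Finset.mem_univ x)
      · field_simp
    have IH := fun b => ih (qc b) (hqc0 b) (hqc1 b)
    choose ξ hξ0 hξ1 hξ2 hξ3 using IH
    obtain ⟨γ, hγ0, hγ1, hγ2, hγ3⟩ := exists_coupling hq₁0 (fun b => (hp b).le)
      (by rw [hq₁1, hp1])
    have hTV := hγ3.trans (sum_abs_sub_le hq₁0 hp hq₁1 hp1 hθ)
    refine ⟨fun x y => γ (x 0) (y 0) * ξ (x 0) (Fin.tail x) (Fin.tail y), ?_, ?_, ?_, ?_⟩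
    · exact fun x y => mul_nonneg (hγ0 _ _) (hξ0 _ _ _)
    · intro x
      rw [sum_fin_cons]
      simp only [Fin.cons_zero, Fin.tail_cons, ← Finset.mul_sum, hξ1, ← Finset.sum_mul, hγ1]
      rw [← hqq, Fin.cons_self_tail]
    · intro y
      rw [sum_fin_cons]
      simp only [Fin.cons_zero, Fin.tail_cons, ← Finset.mul_sum, hξ2, ← Finset.sum_mul, hγ2]
      rw [Fin.prod_univ_succ]
      rfl
    · have hkl : ∑ x, (q x * Real.log (q x) - q x * ∑ i, Real.log (p (x i))) =
          ∑ b, (q₁ b * Real.log (q₁ b) - q₁ b * Real.log (p b)) +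
          ∑ b, q₁ b * ∑ x, (qc b x * Real.log (qc b x) - qc b x * ∑ i, Real.log (p (x i))) := by
        rw [sum_fin_cons, ← Finset.sum_add_distrib]
        refine Finset.sum_congr rfl fun b _ => ?_
        have hterm : ∀ x : Fin n → B, q (Fin.cons b x) * Real.log (q (Fin.cons b x)) -
            q (Fin.cons b x) * ∑ i : Fin (n + 1), Real.log (p ((Fin.cons b x : Fin (n + 1) → B) i)) =
            (q₁ b * Real.log (q₁ b) - q₁ b * Real.log (p b)) * qc b x +
            q₁ b * (qc b x * Real.log (qc b x) - qc b x * ∑ i, Real.log (p (x i))) := by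
          intro x
          rw [hqq, Fin.sum_univ_succ]
          simp only [Fin.cons_zero, Fin.cons_succ]
          by_cases h1 : q₁ b = 0
          · simp [h1]
          by_cases h2 : qc b x = 0
          · simp [h2]
          rw [Real.log_mul h1 h2]
          ring
        rw [Finset.sum_congr rfl fun x _ => hterm x, Finset.sum_add_distrib, ← Finset.mul_sum,
          ← Finset.mul_sum, hqc1, mul_one]
      have hL : ∑ x, ∑ y, γ (x 0) (y 0) * ξ (x 0) (Fin.tail x) (Fin.tail y) * mism x y =
          ∑ b, ∑ b', γ b b' * (if b ≠ b' then 1 else 0) +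
          ∑ b, q₁ b * ∑ x, ∑ y, ξ b x y * mism x y := by
        rw [sum_fin_cons, ← Finset.sum_add_distrib]
        refine Finset.sum_congr rfl fun b _ => ?_
        have hy : ∀ x : Fin n → B, ∑ y : Fin (n + 1) → B, γ ((Fin.cons b x : Fin (n + 1) → B) 0)
            (y 0) * ξ ((Fin.cons b x : Fin (n + 1) → B) 0) (Fin.tail (Fin.cons b x : Fin (n + 1) → B))
              (Fin.tail y) * mism (Fin.cons b x : Fin (n + 1) → B) y =
            ∑ b', (γ b b' * (if b ≠ b' then 1 else 0)) * qc b x +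
            ∑ b', γ b b' * ∑ y, ξ b x y * mism x y := by
          intro x
          rw [sum_fin_cons, ← Finset.sum_add_distrib]
          refine Finset.sum_congr rfl fun b' _ => ?_
          simp only [Fin.cons_zero, Fin.tail_cons, mism_cons]
          rw [← hξ1 b x, Finset.mul_sum, Finset.mul_sum, ← Finset.sum_add_distrib]
          exact Finset.sum_congr rfl fun y _ => by ring
        rw [Finset.sum_congr rfl fun x _ => hy x, Finset.sum_add_distrib]
        simp only [← Finset.sum_mul, hγ1, ← Finset.mul_sum, hqc1, mul_one]
      rw [hkl, hL]
      have h3 : ∑ b, q₁ b * ∑ x, ∑ y, ξ b x y * mism x y ≤ ∑ b, q₁ b * (n * θ +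
          (∑ x, (qc b x * Real.log (qc b x) - qc b x * ∑ i, Real.log (p (x i)))) / θ) :=
        Finset.sum_le_sum fun b _ => mul_le_mul_of_nonneg_left (hξ3 b) (hq₁0 b)
      simp only [mul_add, ← mul_div_assoc] at h3
      rw [Finset.sum_add_distrib, ← Finset.sum_mul, ← Finset.sum_div, hq₁1] at h3
      rw [add_div]
      push_cast
      linarith

end Coupling


section Typical

variable {S : Type} [Fintype S]

lemma sum_prod_pow {ι : Type} [Fintype ι] [DecidableEq ι] (g : ι → S → ℝ) :
    ∑ s : ι → S, ∏ i, g i (s i) = ∏ i, ∑ a, g i a := by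
  rw [← Fintype.piFinset_univ, Finset.sum_prod_piFinset]

lemma sum_prod_pow_eq_one {ι : Type} [Fintype ι] [DecidableEq ι] {q : S → ℝ} (hq1 : ∑ a, q a = 1) :
    ∑ s : ι → S, ∏ i, q (s i) = 1 := by
  rw [sum_prod_pow]; simp [hq1]

lemma second_moment {q : S → ℝ} (hq1 : ∑ a, q a = 1) {g : S → ℝ} (hg : ∑ a, q a * g a = 0)
    (L : ℕ) :
    ∑ s : Fin L → S, (∏ i, q (s i)) * (∑ i, g (s i)) ^ 2 = L * ∑ a, q a * g a ^ 2 := by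
  have h1 : ∀ L : ℕ, ∑ s : Fin L → S, (∏ i, q (s i)) * ∑ i, g (s i) = 0 := by
    intro L
    induction L with
    | zero => simp
    | succ L ih =>
      rw [sum_fin_cons]
      simp only [Fin.prod_univ_succ, Fin.sum_univ_succ, Fin.cons_zero, Fin.cons_succ]
      have : ∀ a, ∑ x : Fin L → S, q a * (∏ i, q (x i)) * (g a + ∑ i, g (x i)) = q a * g a := by
        intro a
        have e : ∀ x : Fin L → S, q a * (∏ i, q (x i)) * (g a + ∑ i, g (x i)) =
            q a * g a * (∏ i, q (x i)) + q a * ((∏ i, q (x i)) * ∑ i, g (x i)) := fun x => by ring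
        simp only [e]
        rw [Finset.sum_add_distrib, ← Finset.mul_sum, ← Finset.mul_sum, ih,
          sum_prod_pow_eq_one hq1]
        ring
      simp only [this, hg]
  induction L with
  | zero => simp
  | succ L ih =>
    rw [sum_fin_cons]
    simp only [Fin.prod_univ_succ, Fin.sum_univ_succ, Fin.cons_zero, Fin.cons_succ]
    have : ∀ a, ∑ x : Fin L → S, q a * (∏ i, q (x i)) * (g a + ∑ i, g (x i)) ^ 2 =
        q a * g a ^ 2 + q a * (L * ∑ a, q a * g a ^ 2) := by
      intro a
      have e : ∀ x : Fin L → S, q a * (∏ i, q (x i)) * (g a + ∑ i, g (x i)) ^ 2 =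
          q a * g a ^ 2 * (∏ i, q (x i)) + 2 * q a * g a * ((∏ i, q (x i)) * ∑ i, g (x i)) +
          q a * ((∏ i, q (x i)) * (∑ i, g (x i)) ^ 2) := fun x => by ring
      simp only [e]
      rw [Finset.sum_add_distrib, Finset.sum_add_distrib, ← Finset.mul_sum, ← Finset.mul_sum,
        ← Finset.mul_sum, ih, h1, sum_prod_pow_eq_one hq1]
      ring
    simp only [this]
    rw [Finset.sum_add_distrib, ← Finset.sum_mul, hq1]
    push_cast
    ring

lemma chebyshev_pow {q : S → ℝ} (hq : ∀ a, 0 ≤ q a) (hq1 : ∑ a, q a = 1) (f : S → ℝ) {τ : ℝ}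
    (hτ : 0 < τ) {L : ℕ} (hL : 0 < L) :
    ∑ s : Fin L → S with τ * L < |∑ i, f (s i) - L * ∑ a, q a * f a|, ∏ i, q (s i) ≤
      (∑ a, q a * (f a - ∑ a, q a * f a) ^ 2) / τ ^ 2 / L := by
  set m := ∑ a, q a * f a with hm
  have hg : ∑ a, q a * (f a - m) = 0 := by
    simp only [mul_sub, Finset.sum_sub_distrib, ← Finset.sum_mul, hq1, ← hm]; ring
  have h2 := second_moment hq1 hg L
  have hLp : (0 : ℝ) < L := by exact_mod_cast hL
  rw [div_div, le_div_iff₀ (by positivity), Finset.sum_mul]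
  have : ∑ s : Fin L → S with τ * L < |∑ i, f (s i) - L * m|, (∏ i, q (s i)) * (τ * L) ^ 2 ≤
      L * ∑ a, q a * (f a - m) ^ 2 := by
    rw [← h2]
    have hP : ∀ s : Fin L → S, 0 ≤ ∏ i, q (s i) := fun s => Finset.prod_nonneg fun i _ => hq _
    refine (Finset.sum_le_sum fun s hs => ?_).trans (Finset.sum_le_univ_sum_of_nonneg
      fun s => mul_nonneg (hP s) (sq_nonneg _))
    refine mul_le_mul_of_nonneg_left ?_ (hP s)
    have hs := (Finset.mem_filter.1 hs).2
    have e : ∑ i, (f (s i) - m) = ∑ i, f (s i) - L * m := by simp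
    rw [e, ← sq_abs (_ - _)]
    gcongr
  have e : ∀ s : Fin L → S, (∏ i, q (s i)) * (τ * L) ^ 2 = ((∏ i, q (s i)) * (τ ^ 2 * L)) * L :=
    fun s => by ring
  simp only [e] at this
  rw [← Finset.sum_mul, mul_comm (L : ℝ) (∑ a, q a * (f a - m) ^ 2)] at this
  exact le_of_mul_le_mul_right this hLp

lemma lln_pow {J : Type} [Fintype J] {q : S → ℝ} (hq : ∀ a, 0 ≤ q a) (hq1 : ∑ a, q a = 1)
    (F : J → S → ℝ) {τ δ : ℝ} (hτ : 0 < τ) (hδ : 0 < δ) :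
    ∃ L₀ : ℕ, ∀ L ≥ L₀,
      ∑ s : Fin L → S with ∃ j, τ * L < |∑ i, F j (s i) - L * ∑ a, q a * F j a|,
        ∏ i, q (s i) < δ := by
  set C := ∑ j, (∑ a, q a * (F j a - ∑ a, q a * F j a) ^ 2) / τ ^ 2
  obtain ⟨L₀, hL₀⟩ := exists_nat_gt (C / δ)
  refine ⟨L₀ + 1, fun L hL => ?_⟩
  have hL0 : 0 < L := by omega
  have hLp : (0 : ℝ) < L := by exact_mod_cast hL0
  calc _ ≤ ∑ j, ∑ s : Fin L → S with τ * L < |∑ i, F j (s i) - L * ∑ a, q a * F j a|,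
        ∏ i, q (s i) := by
        simp only [Finset.sum_filter]
        rw [Finset.sum_comm]
        refine Finset.sum_le_sum fun s _ => ?_
        have hP : 0 ≤ ∏ i, q (s i) := Finset.prod_nonneg fun i _ => hq _
        have hnn : ∀ j ∈ (Finset.univ : Finset J), 0 ≤
            if τ * L < |∑ i, F j (s i) - L * ∑ a, q a * F j a| then ∏ i, q (s i) else 0 :=
          fun j _ => by split_ifs <;> simp [hP]
        split_ifs with h
        · obtain ⟨j, hj⟩ := h
          have := Finset.single_le_sum hnn (Finset.mem_univ j)
          rwa [if_pos hj] at this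
        · exact Finset.sum_nonneg hnn
    _ ≤ ∑ j, (∑ a, q a * (F j a - ∑ a, q a * F j a) ^ 2) / τ ^ 2 / L :=
        Finset.sum_le_sum fun j _ => chebyshev_pow hq hq1 (F j) hτ hL0
    _ = C / L := by rw [← Finset.sum_div]
    _ < δ := by
        rw [div_lt_iff₀ hLp, mul_comm, ← div_lt_iff₀ hδ]
        refine hL₀.trans ?_
        exact_mod_cast (by omega : L₀ < L)

end Typical

section Matching

variable {U W J : Type} [Fintype U] [Fintype W] [Fintype J]

lemma sum_pairs_fst {q : U × W → ℝ} {L : ℕ} (φ : (Fin L → U) → ℝ) :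
    ∑ s : Fin L → U × W, φ (fun i => (s i).1) * ∏ i, q (s i) =
      ∑ u, φ u * ∏ i, ∑ w, q (u i, w) := by
  rw [← (Equiv.arrowProdEquivProdArrow (Fin L) (fun _ => U) (fun _ => W)).symm.sum_comp,
    Fintype.sum_prod_type]
  refine Finset.sum_congr rfl fun u _ => ?_
  rw [← sum_prod_pow, Finset.mul_sum]
  rfl

lemma sum_pairs_snd {q : U × W → ℝ} {L : ℕ} (φ : (Fin L → W) → ℝ) :
    ∑ s : Fin L → U × W, φ (fun i => (s i).2) * ∏ i, q (s i) =
      ∑ w, φ w * ∏ i, ∑ u, q (u, w i) := by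
  rw [← (Equiv.arrowProdEquivProdArrow (Fin L) (fun _ => U) (fun _ => W)).symm.sum_comp,
    Fintype.sum_prod_type_right]
  refine Finset.sum_congr rfl fun w _ => ?_
  rw [← sum_prod_pow, Finset.mul_sum]
  rfl

set_option maxHeartbeats 1000000 in
/-- A coupling whose first marginal has larger entropy than the second one admits, on long i.i.d.
words, an injective selection of typical first coordinates. -/
lemma exists_matching {q : U × W → ℝ} (hq : ∀ a, 0 ≤ q a) (hq1 : ∑ a, q a = 1)
    (hent : ∑ w, Real.negMulLog (∑ u, q (u, w)) < ∑ u, Real.negMulLog (∑ w, q (u, w)))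
    (F : J → U × W → ℝ) {τ δ : ℝ} (hτ : 0 < τ) (hδ : 0 < δ) :
    ∃ L₀ : ℕ, ∀ L ≥ L₀, ∃ (T : Finset (Fin L → W)) (ψ : (Fin L → W) → Fin L → U),
      Set.InjOn ψ T ∧ (∀ w ∈ T, ∀ i, 0 < q (ψ w i, w i)) ∧
      (∀ w ∈ T, ∀ j, L * (∑ a, q a * F j a - τ) ≤ ∑ i, F j (ψ w i, w i)) ∧
      1 - δ < ∑ w ∈ T, ∏ i, ∑ u, q (u, w i) := by
  set qU : U → ℝ := fun u => ∑ w, q (u, w) with hqU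
  set qW : W → ℝ := fun w => ∑ u, q (u, w) with hqW
  have hqU0 : ∀ u, 0 ≤ qU u := fun u => Finset.sum_nonneg fun w _ => hq _
  have hqW0 : ∀ w, 0 ≤ qW w := fun w => Finset.sum_nonneg fun u _ => hq _
  have hqW1 : ∑ w, qW w = 1 := by rw [← hq1, Fintype.sum_prod_type_right]
  set HU := ∑ u, Real.negMulLog (qU u) with hHU
  set HW := ∑ w, Real.negMulLog (qW w) with hHW
  set κ := (HU - HW) / 4 with hκ
  have hκ0 : 0 < κ := by rw [hκ]; linarith
  set F' : (J ⊕ Bool) → U × W → ℝ := fun j => Sum.elim F (fun b a =>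
    if b then Real.log (qU a.1) else Real.log (qW a.2)) j with hF'
  have hmU : ∑ a, q a * F' (Sum.inr true) a = -HU := by
    simp only [hF', Sum.elim_inr, if_true]
    rw [Fintype.sum_prod_type]
    simp only [← Finset.sum_mul, hHU, Real.negMulLog, neg_mul, Finset.sum_neg_distrib, neg_neg]
    rfl
  have hmW : ∑ a, q a * F' (Sum.inr false) a = -HW := by
    simp only [hF', Sum.elim_inr, Bool.false_eq_true, if_false]
    rw [Fintype.sum_prod_type_right]
    simp only [← Finset.sum_mul, hHW, Real.negMulLog, neg_mul, Finset.sum_neg_distrib, neg_neg]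
    rfl
  obtain ⟨L₁, hL₁⟩ := lln_pow hq hq1 F' (lt_min hτ hκ0) (half_pos hδ)
  obtain ⟨L₂, hL₂⟩ := exists_nat_gt (-Real.log (δ / 2) / (2 * κ))
  refine ⟨max L₁ L₂, fun L hL => ?_⟩
  have hlln := hL₁ L (le_trans (le_max_left _ _) hL)
  have hexp : Real.exp (-(L * (2 * κ))) < δ / 2 := by
    rw [← Real.lt_log_iff_exp_lt (half_pos hδ), neg_lt, ← div_lt_iff₀ (by positivity)]
    refine hL₂.trans_le ?_
    exact_mod_cast le_trans (le_max_right _ _) hL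
  have hLp : (0 : ℝ) ≤ L := Nat.cast_nonneg L
  -- jointly typical pairs of words
  set G : (Fin L → U) → (Fin L → W) → Prop := fun u w =>
    (∀ i, 0 < q (u i, w i)) ∧
      ∀ j, |∑ i, F' j (u i, w i) - L * ∑ a, q a * F' j a| ≤ min τ κ * L with hG
  have hGU : ∀ u w, G u w → ∏ i, qU (u i) ≤ Real.exp (-(L * (HU - κ))) := by
    rintro u w ⟨h1, h2⟩
    have hpos : ∀ i, 0 < qU (u i) := fun i =>
      (h1 i).trans_le (Finset.single_le_sum (f := fun w => q (u i, w)) (fun w _ => hq _)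
        (Finset.mem_univ (w i)))
    have h3 := (abs_le.1 (h2 (Sum.inr true))).2
    rw [hmU] at h3
    simp only [hF', Sum.elim_inr, if_true] at h3
    rw [← Real.log_prod fun i _ => (hpos i).ne'] at h3
    rw [← Real.log_le_iff_le_exp (Finset.prod_pos fun i _ => hpos i)]
    have : min τ κ * L ≤ κ * L := by gcongr; exact min_le_right _ _
    linarith
  have hGW : ∀ u w, G u w → Real.exp (-(L * (HW + κ))) ≤ ∏ i, qW (w i) := by
    rintro u w ⟨h1, h2⟩
    have hpos : ∀ i, 0 < qW (w i) := fun i =>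
      (h1 i).trans_le (Finset.single_le_sum (f := fun u => q (u, w i)) (fun u _ => hq _)
        (Finset.mem_univ (u i)))
    have h3 := (abs_le.1 (h2 (Sum.inr false))).1
    rw [hmW] at h3
    simp only [hF', Sum.elim_inr] at h3
    simp only [Bool.false_eq_true, if_false] at h3
    rw [← Real.log_prod fun i _ => (hpos i).ne'] at h3
    rw [← Real.le_log_iff_exp_le (Finset.prod_pos fun i _ => hpos i)]
    have : min τ κ * L ≤ κ * L := by gcongr; exact min_le_right _ _
    linarith
  set good : Finset (Finset (Fin L → W)) := Finset.univ.filter fun T =>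
    ∃ ψ : (Fin L → W) → Fin L → U, Set.InjOn ψ T ∧ ∀ w ∈ T, G (ψ w) w with hgood
  obtain ⟨s₀, hs₀⟩ : ∃ s : Fin L → U × W, True := by
    by_contra! hne
    have := sum_prod_pow_eq_one (ι := Fin L) hq1
    rw [Finset.sum_eq_zero fun s _ => (hne s).elim] at this
    exact zero_ne_one this
  obtain ⟨T, hT, hmax⟩ := good.exists_max_image Finset.card
    ⟨∅, Finset.mem_filter.2 ⟨Finset.mem_univ _, fun _ i => (s₀ i).1, by simp, by simp⟩⟩
  obtain ⟨ψ, hinj, hψ⟩ := (Finset.mem_filter.1 hT).2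
  refine ⟨T, ψ, hinj, fun w hw => (hψ w hw).1, fun w hw j => ?_, ?_⟩
  · have h3 := (abs_le.1 ((hψ w hw).2 (Sum.inl j))).1
    simp only [hF', Sum.elim_inl] at h3
    have : min τ κ * L ≤ τ * L := by gcongr; exact min_le_left _ _
    linarith
  have hext : ∀ u w, G u w → w ∉ T → u ∈ T.image ψ := by
    intro u w hG hw
    by_contra hu
    have hne : ∀ x ∈ T, x ≠ w := fun x hx h => hw (h ▸ hx)
    have : insert w T ∈ good := by
      refine Finset.mem_filter.2 ⟨Finset.mem_univ _, Function.update ψ w u, ?_, ?_⟩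
      · rw [Finset.coe_insert, Set.injOn_insert (by simpa using hw)]
        refine ⟨fun x hx y hy hxy => ?_, ?_⟩
        · rw [Function.update_of_ne (hne x hx), Function.update_of_ne (hne y hy)] at hxy
          exact hinj hx hy hxy
        · rintro ⟨x, hx, hxu⟩
          rw [Function.update_self, Function.update_of_ne (hne x hx)] at hxu
          exact hu (Finset.mem_image.2 ⟨x, hx, hxu⟩)
      · intro x hx
        rcases Finset.mem_insert.1 hx with rfl | hx
        · rwa [Function.update_self]
        · rw [Function.update_of_ne (hne x hx)]; exact hψ x hx
    have := hmax _ this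
    rw [Finset.card_insert_of_notMem hw] at this
    omega
  have hPW : ∀ w : Fin L → W, 0 ≤ ∏ i, qW (w i) := fun w => Finset.prod_nonneg fun i _ => hqW0 _
  have hP : ∀ s : Fin L → U × W, 0 ≤ ∏ i, q (s i) := fun s => Finset.prod_nonneg fun i _ => hq _
  have hPU : ∀ u : Fin L → U, 0 ≤ ∏ i, qU (u i) := fun u => Finset.prod_nonneg fun i _ => hqU0 _
  have htot : ∑ w : Fin L → W, ∏ i, qW (w i) = 1 := sum_prod_pow_eq_one hqW1
  have hcard : (T.card : ℝ) * Real.exp (-(L * (HW + κ))) ≤ 1 := by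
    rw [← htot, ← nsmul_eq_mul, ← Finset.sum_const]
    exact (Finset.sum_le_sum fun w hw => hGW _ _ (hψ w hw)).trans
      (Finset.sum_le_univ_sum_of_nonneg hPW)
  have himage : ∑ u ∈ T.image ψ, ∏ i, qU (u i) < δ / 2 := by
    have h1 : ∑ u ∈ T.image ψ, ∏ i, qU (u i) ≤ T.card * Real.exp (-(L * (HU - κ))) := by
      rw [Finset.sum_image fun x hx y hy h => hinj hx hy h, ← nsmul_eq_mul, ← Finset.sum_const]
      exact Finset.sum_le_sum fun w hw => hGU _ _ (hψ w hw)
    have h2 : Real.exp (-(L * (HU - κ))) =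
        Real.exp (-(L * (HW + κ))) * Real.exp (-(L * (2 * κ))) := by
      rw [← Real.exp_add]; congr 1; rw [hκ]; ring
    rw [h2, ← mul_assoc] at h1
    have h3 := mul_le_mul_of_nonneg_right hcard (Real.exp_pos (-(L * (2 * κ)))).le
    linarith
  have hcompl : ∑ w ∈ Tᶜ, ∏ i, qW (w i) < δ := by
    have e1 : ∑ w ∈ Tᶜ, ∏ i, qW (w i) =
        ∑ s : Fin L → U × W, (if (fun i => (s i).2) ∈ Tᶜ then 1 else 0) * ∏ i, q (s i) := by
      rw [sum_pairs_snd (q := q) fun w => if w ∈ Tᶜ then (1 : ℝ) else 0]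
      simp only [ite_mul, one_mul, zero_mul]
      rw [← Finset.sum_filter, Finset.filter_mem_eq_inter, Finset.univ_inter]
    have e2 : ∑ u ∈ T.image ψ, ∏ i, qU (u i) =
        ∑ s : Fin L → U × W, (if (fun i => (s i).1) ∈ T.image ψ then 1 else 0) *
          ∏ i, q (s i) := by
      rw [sum_pairs_fst (q := q) fun u => if u ∈ T.image ψ then (1 : ℝ) else 0]
      simp only [ite_mul, one_mul, zero_mul]
      rw [← Finset.sum_filter, Finset.filter_mem_eq_inter, Finset.univ_inter]
    rw [e2] at himage
    rw [e1]
    rw [Finset.sum_filter] at hlln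
    refine lt_of_le_of_lt ?_ ((add_lt_add hlln himage).trans_eq (add_halves δ))
    rw [← Finset.sum_add_distrib]
    refine Finset.sum_le_sum fun s _ => ?_
    by_cases hz : ∏ i, q (s i) = 0
    · simp [hz]
    have hpos : ∀ i, 0 < q (s i) := fun i =>
      lt_of_le_of_ne (hq _) fun h => hz (Finset.prod_eq_zero (Finset.mem_univ i) h.symm)
    by_cases hw : (fun i => (s i).2) ∈ Tᶜ
    · by_cases hb : ∃ j, min τ κ * L < |∑ i, F' j (s i) - L * ∑ a, q a * F' j a|
      · rw [if_pos hw, if_pos hb, one_mul]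
        have : 0 ≤ (if (fun i => (s i).1) ∈ T.image ψ then (1 : ℝ) else 0) * ∏ i, q (s i) :=
          mul_nonneg (by split_ifs <;> simp) (hP s)
        linarith
      · push Not at hb
        have := hext (fun i => (s i).1) (fun i => (s i).2) ⟨hpos, hb⟩ (Finset.mem_compl.1 hw)
        rw [if_pos hw, if_pos this]
        have : 0 ≤ (if ∃ j, min τ κ * L < |∑ i, F' j (s i) - L * ∑ a, q a * F' j a|
          then ∏ i, q (s i) else 0) := by split_ifs <;> simp [hP s]
        linarith
    · rw [if_neg hw, zero_mul]
      exact add_nonneg (by split_ifs <;> simp [hP s])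
        (mul_nonneg (by split_ifs <;> simp) (hP s))
  have := Finset.sum_add_sum_compl T fun w => ∏ i, qW (w i)
  rw [htot] at this
  show 1 - δ < ∑ w ∈ T, ∏ i, qW (w i)
  linarith

end Matching


section Windows

variable {D : Type} [MeasurableSpace D]

/-- The word read in the window `[-m, m]`. -/
def win (m : ℕ) (x : ℤ → D) : Fin (2 * m + 1) → D := fun i => x ((i : ℤ) - m)

omit [MeasurableSpace D] in
lemma loc_win (m : ℕ) : Loc m (win m : (ℤ → D) → _) := fun x y h => by
  funext i
  exact h _ (by omega) (by omega)

omit [MeasurableSpace D] in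
lemma Loc.exists_win {W : Type} {m : ℕ} {f : (ℤ → D) → W} (hf : Loc m f) :
    ∃ F : (Fin (2 * m + 1) → D) → W, ∀ x, f x = F (win m x) := hf.exists_factor

variable [DiscreteMeasurableSpace D] [Finite D]

lemma fMeas_win (m : ℕ) : FMeas (win m : (ℤ → D) → _) := (loc_win m).fMeas

/-- Two probability measures with the same window laws are equal. -/
lemma ext_win {μ ν : Measure (ℤ → D)} [IsProbabilityMeasure μ] [IsProbabilityMeasure ν]
    (h : ∀ m (a : Fin (2 * m + 1) → D), μ.real (win m ⁻¹' {a}) = ν.real (win m ⁻¹' {a})) :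
    μ = ν := by
  have := Fintype.ofFinite D
  refine ext_of_generate_finite (measurableCylinders fun _ : ℤ => D)
    (generateFrom_measurableCylinders (α := fun _ : ℤ => D)).symm
    (isPiSystem_measurableCylinders (α := fun _ : ℤ => D)) ?_ (by simp)
  intro t ht
  obtain ⟨s, S, _, rfl⟩ := (mem_measurableCylinders _).1 ht
  obtain ⟨m, hm⟩ : ∃ m : ℕ, ∀ i ∈ s, -(m : ℤ) ≤ i ∧ i ≤ m := by
    refine ⟨s.sup Int.natAbs, fun i hi => ?_⟩
    have := Finset.le_sup (f := Int.natAbs) hi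
    omega
  have hl : Loc m (fun x : ℤ → D => x ∈ cylinder s S) := by
    intro x y hxy
    simp only [mem_cylinder]
    have : s.restrict x = s.restrict y := by
      funext i
      exact hxy i (hm i i.2).1 (hm i i.2).2
    rw [this]
  obtain ⟨F, hF⟩ := hl.exists_win
  have e : cylinder s S = win m ⁻¹' {a | F a} := by
    ext x; exact iff_of_eq (hF x)
  have h1 := sum_real_fiber μ (fMeas_win (D := D) m) {a | F a}
  have h2 := sum_real_fiber ν (fMeas_win (D := D) m) {a | F a}
  simp only [h] at h1
  rw [e]
  exact (measureReal_eq_measureReal_iff (by simp) (by simp)).1 (h1.symm.trans h2)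

end Windows

section IID

variable {B : Type} [MeasurableSpace B]

/-- Real-valued form of independence with one-letter law `p`. -/
def Iid (ν : Measure (ℤ → B)) (p : B → ℝ) : Prop :=
  ∀ (s : Finset ℤ) (a : ℤ → B), ν.real {x | ∀ n ∈ s, x n = a n} = ∏ n ∈ s, p (a n)

variable {ν : Measure (ℤ → B)} {p : B → ℝ} [IsProbabilityMeasure ν]

omit [IsProbabilityMeasure ν] in
lemma Iid.real_eq [Nonempty B] (h : Iid ν p) {ι : Type} [Fintype ι] {e : ι → ℤ}
    (he : e.Injective) (a : ι → B) : ν.real {x | ∀ i, x (e i) = a i} = ∏ i, p (a i) := by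
  have := h (Finset.univ.image e) (Function.extend e a fun _ => Classical.arbitrary B)
  rw [Finset.prod_image fun x _ y _ hxy => he hxy] at this
  simpa [he.extend_apply] using this

variable [DiscreteMeasurableSpace B] [Fintype B] [Nonempty B]

lemma Iid.unique (h : Iid ν p) {ν' : Measure (ℤ → B)} [IsProbabilityMeasure ν'] (h' : Iid ν' p) :
    ν = ν' := by
  refine ext_win fun m a => ?_
  have e : win m ⁻¹' {a} = {x : ℤ → B | ∀ i : Fin (2 * m + 1), x ((i : ℤ) - m) = a i} := by
    ext x; simp [win, funext_iff]
  have hi : Function.Injective fun i : Fin (2 * m + 1) => (i : ℤ) - m := fun i j hij => by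
    simp only at hij; omega
  rw [e, h.real_eq hi, h'.real_eq hi]

lemma Iid.stat (h : Iid ν p) : Stat ν := by
  have : IsProbabilityMeasure (Measure.map (zShift 1) ν) :=
    Measure.isProbabilityMeasure_map (measurable_zShift 1).aemeasurable
  refine (Iid.unique h fun s a => ?_).symm
  have hm : MeasurableSet {x : ℤ → B | ∀ n ∈ s, x n = a n} := by
    have : {x : ℤ → B | ∀ n ∈ s, x n = a n} = ⋂ n ∈ s, (fun x => x n) ⁻¹' {a n} := by
      ext; simp
    rw [this]
    exact Finset.measurableSet_biInter _ fun n _ => fMeas_coord id n _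
  rw [map_measureReal_apply (measurable_zShift 1) hm]
  have := h (s.map (addRightEmbedding 1)) fun n => a (n - 1)
  rw [Finset.prod_map] at this
  simpa [zShift] using this

lemma Loc.measurableSet {D : Type} [MeasurableSpace D] [DiscreteMeasurableSpace D] [Finite D]
    {m : ℕ} {E : Set (ℤ → D)} (hE : Loc m (· ∈ E)) : MeasurableSet E := by
  have := hE.fMeas {True}
  convert this using 1
  ext x; simp

/-- Marker words of arbitrarily small probability occur in long windows with high probability. -/
lemma Iid.avoid (h : Iid ν p) (hp : ∀ b, 0 < p b) (hp1 : ∑ b, p b = 1) (b₁ : B) (K : ℕ)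
    {η : ℝ} (hη : 0 < η) :
    ∃ R : ℕ, ν.real {x | ∀ r : ℕ, r ≤ R → ∃ i < K, x (-(r : ℤ) + (i : ℕ)) ≠ b₁} < η := by
  set u : Fin K → B := fun _ => b₁
  set P : (Fin K → B) → ℝ := fun a => ∏ i, p (a i)
  have hP1 : ∑ a, P a = 1 := sum_prod_pow_eq_one hp1
  have hPu : 0 < P u := Finset.prod_pos fun i _ => hp _
  have hlt : 1 - P u < 1 := by linarith
  have hle : 0 ≤ 1 - P u := by
    have := Finset.single_le_sum (f := P) (fun a _ => Finset.prod_nonneg fun i _ => (hp _).le)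
      (Finset.mem_univ u)
    linarith
  obtain ⟨J, hJ⟩ := exists_pow_lt_of_lt_one hη hlt
  refine ⟨J * K, lt_of_le_of_lt ?_ hJ⟩
  set Q : (ℤ → B) → Fin J → Fin K → B := fun x j i => x (-(((j + 1) * K : ℕ) : ℤ) + (i : ℕ)) with hQ
  have hQm : FMeas Q := FMeas.pi fun j => FMeas.pi fun i => fMeas_coord id _
  have hlaw : ∀ a, ν.real (Q ⁻¹' {a}) = ∏ j, P (a j) := by
    intro a
    have hi : Function.Injective fun s : Fin J × Fin K =>
        -(((s.1 + 1) * K : ℕ) : ℤ) + ((s.2 : ℕ) : ℤ) := by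
      rintro ⟨j, i⟩ ⟨j', i'⟩ hji
      simp only at hji
      have hK : 0 < K := i.pos
      have h1 : ((j' : ℕ) + 1) * K + i = (j + 1) * K + i' := by
        zify; push_cast at hji; linarith
      have h2 := congrArg (· / K) h1
      simp only [Nat.mul_comm _ K, Nat.mul_add_div hK, Nat.div_eq_of_lt i.2,
        Nat.div_eq_of_lt i'.2] at h2
      have h3 : j = j' := Fin.ext (by omega)
      subst h3
      exact Prod.ext rfl (Fin.ext (Nat.add_left_cancel h1))
    have := h.real_eq hi fun s => a s.1 s.2
    rw [Fintype.prod_prod_type] at this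
    rw [← this]
    congr 1
    ext x
    simp only [hQ, Set.mem_preimage, Set.mem_singleton_iff, funext_iff, Set.mem_ofPred_eq,
      Prod.forall]
  have h1 := sum_real_fiber ν hQm {a | ∀ j, a j ≠ u}
  calc _ ≤ ν.real (Q ⁻¹' {a | ∀ j, a j ≠ u}) := by
        refine measureReal_mono ?_
        intro x hx j hj
        obtain ⟨i, hi, hne⟩ := hx ((j + 1) * K) (Nat.mul_le_mul_right K j.2)
        exact hne (congrFun hj ⟨i, hi⟩)
    _ = ∑ a : Fin J → Fin K → B, ∏ j, if a j ≠ u then P (a j) else 0 := by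
        rw [← h1, Finset.sum_filter]
        refine Finset.sum_congr rfl fun a _ => ?_
        rw [hlaw]
        simp only [Set.mem_ofPred_eq]
        rw [Finset.prod_ite_zero]
        simp
    _ = (1 - P u) ^ J := by
        rw [sum_prod_pow fun _ a => if a ≠ u then P a else 0]
        simp only [Finset.prod_const, Finset.card_univ, Fintype.card_fin]
        congr 1
        rw [← Finset.sum_filter, Finset.filter_ne', ← hP1, ← Finset.sum_erase_add _ _ (Finset.mem_univ u)]
        ring

/-- A Rokhlin tower with finitely determined base, avoiding a given set in proportion. -/
lemma Iid.exists_tower (h : Iid ν p) (hp : ∀ b, 0 < p b) (hp1 : ∑ b, p b = 1)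
    {b₁ : B} (hb₁ : p b₁ < 1) {M : ℕ} (hM : 0 < M) {η : ℝ} (hη : 0 < η) {Bad : Set (ℤ → B)}
    (hBad : MeasurableSet Bad) :
    ∃ (R : ℕ) (E : Set (ℤ → B)), Loc R (· ∈ E) ∧
      (∀ x ∈ E, ∀ i : ℕ, 0 < i → i < M → zShift (i : ℤ) x ∉ E) ∧
      1 - η < M * ν.real E ∧ M * ν.real (E ∩ Bad) ≤ ν.real Bad := by
  have hst := h.stat
  have hMp : (0 : ℝ) < M := by exact_mod_cast hM
  obtain ⟨K, hK⟩ := exists_pow_lt_of_lt_one (div_pos (half_pos hη) hMp) hb₁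
  obtain ⟨R, hR⟩ := h.avoid hp hp1 b₁ K (half_pos hη)
  set V : ℤ → (ℤ → B) → Prop := fun t x => ∀ i < K, x (t + (i : ℕ)) = b₁ with hV
  have hVs : ∀ t s x, V t (zShift s x) ↔ V (t + s) x := by
    intro t s x
    simp only [hV, zShift]
    refine forall₂_congr fun i _ => ?_
    rw [show t + (i : ℤ) + s = t + s + i by ring]
  set E : Set (ℤ → B) := {x | ∃ r : ℕ, r ≤ R ∧ M ∣ r ∧ V (-r) x ∧
    ∀ t : ℤ, -r < t → t < M → ¬ V t x} with hE
  have hEloc : Loc (R + M + K) (· ∈ E) := by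
    intro x y hxy
    have hVxy : ∀ t : ℤ, -R ≤ t → t < M → (V t x ↔ V t y) := by
      intro t h1 h2
      refine forall₂_congr fun i hi => ?_
      rw [hxy _ (by omega) (by push_cast; omega)]
    simp only [hE, Set.mem_ofPred_eq, eq_iff_iff]
    refine exists_congr fun r => and_congr_right fun hr => and_congr_right fun _ =>
      and_congr (hVxy _ (by omega) (by omega)) (forall₃_congr fun t h1 h2 =>
        not_congr (hVxy t (by omega) h2))
  have hEm : MeasurableSet E := hEloc.measurableSet
  have hdisj : ∀ x ∈ E, ∀ i : ℕ, 0 < i → i < M → zShift (i : ℤ) x ∉ E := by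
    rintro x ⟨r, -, hr, hr1, hr2⟩ i hi hiM ⟨r', -, hr', hr1', hr2'⟩
    rw [hVs] at hr1'
    have h1 : ¬ (-(r : ℤ) < -r' + i) := fun hlt => hr2 _ hlt (by omega) hr1'
    have h2 : ¬ (-(r' : ℤ) < -r - i) := fun hlt => hr2' _ hlt (by omega)
      ((hVs _ _ _).2 (by simpa using hr1))
    have h3 : r' = r + i := by omega
    rw [h3] at hr'
    exact absurd (Nat.le_of_dvd hi ((Nat.dvd_add_right hr).1 hr')) (by omega)
  set E' : ℕ → Set (ℤ → B) := fun j => zShift (-(j : ℤ)) ⁻¹' E with hE'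
  have hE'm : ∀ j, MeasurableSet (E' j) := fun j => measurable_zShift _ hEm
  have hE'real : ∀ j, ν.real (E' j) = ν.real E := fun j => hst.real_preimage _ hEm
  have hpd : ∀ i < M, ∀ j < M, i < j → Disjoint (E' i) (E' j) := by
    intro i hi j hj hij
    refine Set.disjoint_left.2 fun x hx hx' => ?_
    refine hdisj _ hx' (j - i) (by omega) (by omega) ?_
    rw [zShift_zShift, Nat.cast_sub hij.le, show (j : ℤ) - i + -j = -i by ring]
    exact hx
  have hpd' : Set.PairwiseDisjoint (Finset.range M : Set ℕ) E' := by
    intro i hi j hj hij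
    simp only [Finset.coe_range, Set.mem_Iio] at hi hj
    rcases lt_or_gt_of_ne hij with hlt | hlt
    · exact hpd i hi j hj hlt
    · exact (hpd j hj i hi hlt).symm
  have hVm : ∀ t, MeasurableSet {x | V t x} := by
    intro t
    have : {x | V t x} = ⋂ i ∈ Finset.range K, (fun x : ℤ → B => x (t + (i : ℕ))) ⁻¹' {b₁} := by
      ext; simp [hV]
    rw [this]
    exact Finset.measurableSet_biInter _ fun n _ => fMeas_coord id _ _
  have hVreal : ∀ t, ν.real {x | V t x} = p b₁ ^ K := by
    intro t
    have := h.real_eq (e := fun i : Fin K => t + (i : ℕ)) (fun i j hij => by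
      simp only at hij; omega) fun _ => b₁
    simp only [Finset.prod_const, Finset.card_univ, Fintype.card_fin] at this
    rw [← this]
    congr 1
    ext x
    simp only [hV, Set.mem_ofPred_eq]
    exact ⟨fun hx i => hx i i.2, fun hx i hi => hx ⟨i, hi⟩⟩
  have hcover : (Set.univ : Set (ℤ → B)) ⊆ (⋃ i ∈ Finset.range M, E' i) ∪
      ({x | ∀ r : ℕ, r ≤ R → ∃ i < K, x (-(r : ℤ) + (i : ℕ)) ≠ b₁} ∪
      ⋃ t ∈ Finset.range M, {x | V ((t : ℕ) + 1) x}) := by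
    intro x _
    by_cases h1 : ∀ r : ℕ, r ≤ R → ∃ i < K, x (-(r : ℤ) + (i : ℕ)) ≠ b₁
    · exact Or.inr (Or.inl h1)
    by_cases h2 : ∃ t < M, V ((t : ℕ) + 1) x
    · obtain ⟨t, ht, hx⟩ := h2
      exact Or.inr (Or.inr (Set.mem_biUnion (Finset.mem_coe.2 (Finset.mem_range.2 ht)) hx))
    left
    push Not at h1 h2
    have hex : ∃ r : ℕ, r ≤ R ∧ V (-r) x := h1
    set r := Nat.find hex
    obtain ⟨hr1, hr2⟩ := Nat.find_spec hex
    have hmin : ∀ t : ℤ, -r < t → t < M → ¬ V t x := by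
      intro t ht1 ht2 hVt
      rcases le_or_gt t 0 with ht | ht
      · refine Nat.find_min hex (m := (-t).toNat) (by omega) ⟨by omega, ?_⟩
        rwa [show -(((-t).toNat : ℕ) : ℤ) = t by omega]
      · refine h2 (t - 1).toNat (by omega) ?_
        rwa [show (((t - 1).toNat : ℕ) : ℤ) + 1 = t by omega]
    refine Set.mem_biUnion (x := r % M) (Finset.mem_coe.2 (Finset.mem_range.2 (Nat.mod_lt _ hM))) ?_
    have hrM : ((M * (r / M) : ℕ) : ℤ) + (r % M : ℕ) = r := by exact_mod_cast Nat.div_add_mod r M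
    have hrle : r % M ≤ r := Nat.mod_le _ _
    refine ⟨M * (r / M), by omega, Dvd.intro _ rfl, ?_, ?_⟩
    · rw [hVs, show -((M * (r / M) : ℕ) : ℤ) + -((r % M : ℕ) : ℤ) = -r by omega]
      exact hr2
    · intro t ht1 ht2
      rw [hVs]
      exact hmin _ (by omega) (by omega)
  have hmass : 1 - η < M * ν.real E := by
    have h1 : (1 : ℝ) ≤ ν.real ((⋃ i ∈ Finset.range M, E' i) ∪
      ({x | ∀ r : ℕ, r ≤ R → ∃ i < K, x (-(r : ℤ) + (i : ℕ)) ≠ b₁} ∪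
      ⋃ t ∈ Finset.range M, {x | V ((t : ℕ) + 1) x})) := by
      rw [← probReal_univ (μ := ν)]
      exact measureReal_mono hcover
    have h2 := measureReal_union_le (μ := ν) (⋃ i ∈ Finset.range M, E' i)
      ({x | ∀ r : ℕ, r ≤ R → ∃ i < K, x (-(r : ℤ) + (i : ℕ)) ≠ b₁} ∪
      ⋃ t ∈ Finset.range M, {x | V ((t : ℕ) + 1) x})
    have h3 := measureReal_union_le (μ := ν)
      {x | ∀ r : ℕ, r ≤ R → ∃ i < K, x (-(r : ℤ) + (i : ℕ)) ≠ b₁}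
      (⋃ t ∈ Finset.range M, {x | V ((t : ℕ) + 1) x})
    have h4 := measureReal_biUnion_finset_le (μ := ν) (Finset.range M) E'
    have h5 := measureReal_biUnion_finset_le (μ := ν) (Finset.range M)
      fun t => {x | V ((t : ℕ) + 1) x}
    simp only [hE'real, hVreal, Finset.sum_const, Finset.card_range, nsmul_eq_mul] at h4 h5
    rw [lt_div_iff₀ hMp] at hK
    linarith
  have hsum : ∑ j ∈ Finset.range M, ν.real (E' j ∩ Bad) ≤ ∑ j ∈ Finset.range M, ν.real Bad / M := by
    rw [← measureReal_biUnion_finset (fun i hi j hj hij => (hpd' hi hj hij).mono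
      Set.inter_subset_left Set.inter_subset_left) fun j _ => (hE'm j).inter hBad]
    simp only [Finset.sum_const, Finset.card_range, nsmul_eq_mul]
    rw [mul_div_cancel₀ _ hMp.ne']
    exact measureReal_mono (Set.iUnion₂_subset fun _ _ => Set.inter_subset_right)
  obtain ⟨j, hj, hle⟩ := Finset.exists_le_of_sum_le ⟨0, Finset.mem_range.2 hM⟩ hsum
  have hjM := Finset.mem_range.1 hj
  refine ⟨R + M + K + M, E' j, ?_, ?_, ?_, ?_⟩
  · intro x y hxy
    exact hEloc _ _ fun i h1 h2 => hxy _ (by push_cast at *; omega) (by push_cast at *; omega)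
  · intro x hx i hi hiM hx'
    refine hdisj _ hx i hi hiM ?_
    rw [zShift_zShift, add_comm, ← zShift_zShift]
    exact hx'
  · rw [hE'real]; exact hmass
  · rw [le_div_iff₀ hMp] at hle
    linarith

end IID


section CodeWords

variable {A : Type} {N L : ℕ}

/-- The concatenation of a marker `a₁ ⋯ a₁` of length `N` with `L` words of length `N`. -/
noncomputable def codeWord (a₁ : A) (u : Fin L → Fin N → A) (s : ℕ) : A :=
  if h : ∃ (l : Fin L) (k : Fin N), s = (l + 1) * N + k then u h.choose h.choose_spec.choose else a₁

lemma block_index_unique {l l' : ℕ} {k k' : Fin N}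
    (h : (l + 1) * N + k = (l' + 1) * N + k') : l = l' ∧ k = k' := by
  have hN : 0 < N := k.pos
  have h2 := congrArg (· / N) h
  simp only [Nat.mul_comm _ N, Nat.mul_add_div hN, Nat.div_eq_of_lt k.2,
    Nat.div_eq_of_lt k'.2] at h2
  obtain rfl : l = l' := by omega
  exact ⟨rfl, Fin.ext (Nat.add_left_cancel h)⟩

lemma codeWord_block (a₁ : A) (u : Fin L → Fin N → A) (l : Fin L) (k : Fin N) :
    codeWord a₁ u ((l + 1) * N + k) = u l k := by
  have h : ∃ (l' : Fin L) (k' : Fin N), ((l : ℕ) + 1) * N + k = (l' + 1) * N + k' := ⟨l, k, rfl⟩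
  rw [codeWord, dif_pos h]
  obtain ⟨h1, h2⟩ := block_index_unique h.choose_spec.choose_spec
  rw [← h2, ← Fin.ext h1]

lemma codeWord_marker (a₁ : A) (u : Fin L → Fin N → A) {s : ℕ} (hs : s < N) :
    codeWord a₁ u s = a₁ := by
  rw [codeWord, dif_neg]
  rintro ⟨l, k, rfl⟩
  have : N ≤ (l + 1) * N := Nat.le_mul_of_pos_left _ (by omega)
  omega

lemma codeWord_injective {a₁ : A} {u u' : Fin L → Fin N → A}
    (h : ∀ s < (L + 1) * N, codeWord a₁ u s = codeWord a₁ u' s) : u = u' := by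
  funext l k
  have := h ((l + 1) * N + k) (by
    have : (l + 2) * N ≤ (L + 1) * N := Nat.mul_le_mul_right _ (by omega)
    have := k.2
    nlinarith)
  rwa [codeWord_block, codeWord_block] at this

/-- Words framed by a letter different from the marker letter. -/
def Framed (a₀ : A) (u : Fin N → A) : Prop := ∀ k : Fin N, (k : ℕ) = 0 ∨ (k : ℕ) + 1 = N → u k = a₀

lemma codeWord_not_overlap {a₀ a₁ : A} (ha : a₀ ≠ a₁) (hL : 0 < L)
    {u u' : Fin L → Fin N → A} (hu : ∀ l, Framed a₀ (u l)) {r : ℕ} (hr : 0 < r)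
    (hrM : r < (L + 1) * N) :
    ∃ s, s + r < (L + 1) * N ∧ codeWord a₁ u (s + r) ≠ codeWord a₁ u' s := by
  have hN : 0 < N := by
    rcases Nat.eq_zero_or_pos N with rfl | h
    · simp at hrM
    · exact h
  set j := (r + N - 1) / N with hj
  have hj1 : r ≤ j * N := by
    have := Nat.lt_div_mul_add (a := r + N - 1) hN
    rw [← hj] at this
    omega
  have hj2 : j * N < r + N := by
    have := Nat.div_mul_le_self (r + N - 1) N
    rw [← hj] at this
    omega
  have hj0 : 1 ≤ j := by
    rcases Nat.eq_zero_or_pos j with h | h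
    · rw [h] at hj1; omega
    · exact h
  by_cases hjM : j < L + 1
  · refine ⟨j * N - r, ?_, ?_⟩
    · rw [Nat.sub_add_cancel hj1]; exact Nat.mul_lt_mul_of_pos_right hjM hN
    · rw [Nat.sub_add_cancel hj1, codeWord_marker a₁ u' (by omega)]
      have := codeWord_block a₁ u ⟨j - 1, by omega⟩ ⟨0, hN⟩
      simp only [Nat.sub_add_cancel hj0, add_zero] at this
      rw [this, hu _ _ (Or.inl rfl)]
      exact ha
  · have h1 : (L + 1) * N ≤ j * N := Nat.mul_le_mul_right _ (by omega)
    refine ⟨(L + 1) * N - 1 - r, by omega, ?_⟩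
    rw [show (L + 1) * N - 1 - r + r = (L + 1) * N - 1 by omega,
      codeWord_marker a₁ u' (by omega)]
    have := codeWord_block a₁ u ⟨L - 1, by omega⟩ ⟨N - 1, by omega⟩
    simp only [Nat.sub_add_cancel hL] at this
    rw [show (L + 1) * N - 1 = L * N + (N - 1) by
      rw [Nat.add_mul, Nat.one_mul]; omega, this, hu _ _ (Or.inr (by simp; omega))]
    exact ha

/-- The framed code word and its phase can be read off a sequence. -/
lemma codeWord_phase_unique {a₀ a₁ : A} (ha : a₀ ≠ a₁) (hL : 0 < L)
    {u u' : Fin L → Fin N → A} (hu : ∀ l, Framed a₀ (u l)) (hu' : ∀ l, Framed a₀ (u' l))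
    {a : ℤ → A} {i i' : ℕ} (hi : i < (L + 1) * N) (hi' : i' < (L + 1) * N)
    (h : ∀ s < (L + 1) * N, a ((s : ℤ) - i) = codeWord a₁ u s)
    (h' : ∀ s < (L + 1) * N, a ((s : ℤ) - i') = codeWord a₁ u' s) : i = i' ∧ u = u' := by
  have key : ∀ {u u' : Fin L → Fin N → A} (hu : ∀ l, Framed a₀ (u l)) {i i' : ℕ}
      (hi : i < (L + 1) * N) (h : ∀ s < (L + 1) * N, a ((s : ℤ) - i) = codeWord a₁ u s)
      (h' : ∀ s < (L + 1) * N, a ((s : ℤ) - i') = codeWord a₁ u' s), ¬ i' < i := by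
    intro u u' hu i i' hi h h' hlt
    obtain ⟨s, hs, hne⟩ := codeWord_not_overlap (a₁ := a₁) (u' := u') ha hL hu
      (r := i - i') (by omega) (by omega)
    refine hne ?_
    rw [← h _ hs, ← h' s (by omega)]
    congr 1
    push_cast [Nat.cast_sub hlt.le]
    ring
  have e : i = i' := le_antisymm (not_lt.1 (key hu hi h h')) (not_lt.1 (key hu' hi' h' h))
  subst e
  exact ⟨rfl, codeWord_injective fun s hs => (h s hs).symm.trans (h' s hs)⟩

end CodeWords

section TowerBound

variable {B : Type} [MeasurableSpace B] {ν : Measure (ℤ → B)} [IsProbabilityMeasure ν]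

lemma mul_real_le_sum_real_inter {Y : Type} [MeasurableSpace Y] {μ : Measure Y}
    [IsProbabilityMeasure μ] {G : Set Y} (hG : MeasurableSet G) {ι : Type} (I : Finset ι)
    {C : ι → Set Y} (hC : ∀ i ∈ I, MeasurableSet (C i)) {c : ℝ}
    (h : ∀ y ∈ G, c ≤ ∑ i ∈ I, if y ∈ C i then 1 else 0) :
    c * μ.real G ≤ ∑ i ∈ I, μ.real (G ∩ C i) := by
  have e : ∀ i ∈ I, μ.real (G ∩ C i) = ∫ y in G, (C i).indicator (fun _ => (1 : ℝ)) y ∂μ := by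
    intro i hi
    rw [setIntegral_indicator (hC i hi), setIntegral_const]
    simp
  rw [Finset.sum_congr rfl e, ← integral_finsetSum]
  · have : c * μ.real G = ∫ y in G, c ∂μ := by rw [setIntegral_const]; simp [mul_comm]
    rw [this]
    refine setIntegral_mono_on (integrable_const _).integrableOn ?_ hG fun y hy => ?_
    · exact (integrable_finsetSum _ fun i hi => (integrable_const _).indicator (hC i hi)).integrableOn
    · simpa [Set.indicator_apply] using h y hy
  · exact fun i hi => ((integrable_const _).indicator (hC i hi)).integrableOn

/-- If every orbit segment of length `M` issued from the base of a tower visits `C` at least `c`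
times, then `C` has measure at least `c` times that of the base. -/
lemma tower_lower_bound (hst : Stat ν) {M : ℕ} {G C : Set (ℤ → B)} (hG : MeasurableSet G)
    (hC : MeasurableSet C) (hdisj : ∀ x ∈ G, ∀ i : ℕ, 0 < i → i < M → zShift (i : ℤ) x ∉ G)
    {c : ℝ} (h : ∀ y ∈ G, c ≤ ∑ s ∈ Finset.range M, if zShift (s : ℤ) y ∈ C then 1 else 0) :
    c * ν.real G ≤ ν.real C := by
  have h1 := mul_real_le_sum_real_inter (μ := ν) hG (Finset.range M)
    (C := fun s => zShift (s : ℤ) ⁻¹' C) (fun s _ => measurable_zShift _ hC) h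
  refine h1.trans ?_
  have e : ∀ s : ℕ, ν.real (G ∩ zShift (s : ℤ) ⁻¹' C) = ν.real (zShift (-(s : ℤ)) ⁻¹' G ∩ C) := by
    intro s
    rw [← hst.real_preimage (-(s : ℤ)) (hG.inter (measurable_zShift _ hC)), Set.preimage_inter,
      ← Set.preimage_comp]
    congr 2
    ext x
    simp [zShift_zShift, zShift_zero]
  simp only [e]
  rw [← measureReal_biUnion_finset]
  · exact measureReal_mono (Set.iUnion₂_subset fun _ _ => Set.inter_subset_right)
  · have hpd : ∀ i < M, ∀ j < M, i < j →
        Disjoint (zShift (-(i : ℤ)) ⁻¹' G ∩ C) (zShift (-(j : ℤ)) ⁻¹' G ∩ C) := by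
      intro i hi j hj hij
      refine Set.disjoint_left.2 fun x hx hx' => ?_
      refine hdisj _ hx'.1 (j - i) (by omega) (by omega) ?_
      rw [zShift_zShift, Nat.cast_sub hij.le, show (j : ℤ) - i + -j = -i by ring]
      exact hx.1
    intro i hi j hj hij
    simp only [Finset.coe_range, Set.mem_Iio] at hi hj
    rcases lt_or_gt_of_ne hij with hlt | hlt
    · exact hpd i hi j hj hlt
    · exact (hpd j hj i hi hlt).symm
  · exact fun s _ => (measurable_zShift _ hG).inter hC

end TowerBound


section JoinMap

variable {A B : Type}

/-- First coordinates of a sequence of pairs. -/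
def prA (z : ℤ → A × B) : ℤ → A := fun i => (z i).1

/-- Second coordinates of a sequence of pairs. -/
def prB (z : ℤ → A × B) : ℤ → B := fun i => (z i).2

/-- The graph of the stationary code with local rule `φ`. -/
def joinMap (φ : (ℤ → B) → A) (x : ℤ → B) : ℤ → A × B := fun n => (φ (zShift n x), x n)

lemma prB_joinMap (φ : (ℤ → B) → A) (x : ℤ → B) : prB (joinMap φ x) = x := rfl

lemma joinMap_zShift (φ : (ℤ → B) → A) (k : ℤ) (x : ℤ → B) :
    joinMap φ (zShift k x) = zShift k (joinMap φ x) := by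
  funext n; simp [joinMap, zShift_zShift, zShift]

lemma loc_prA {m : ℕ} {W : Type} {f : (ℤ → A) → W} (hf : Loc m f) :
    Loc m (fun z : ℤ → A × B => f (prA z)) :=
  fun x y h => hf _ _ fun i h1 h2 => by simp [prA, h i h1 h2]

lemma loc_prB {m : ℕ} {W : Type} {f : (ℤ → B) → W} (hf : Loc m f) :
    Loc m (fun z : ℤ → A × B => f (prB z)) :=
  fun x y h => hf _ _ fun i h1 h2 => by simp [prB, h i h1 h2]

variable [MeasurableSpace A] [MeasurableSpace B] [DiscreteMeasurableSpace A]
  [DiscreteMeasurableSpace B] [Finite A] [Finite B]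

omit [DiscreteMeasurableSpace A] [DiscreteMeasurableSpace B] [Finite A] [Finite B] in
lemma measurable_prA : Measurable (prA : (ℤ → A × B) → ℤ → A) :=
  measurable_pi_lambda _ fun i => (measurable_pi_apply i).fst

omit [DiscreteMeasurableSpace A] [DiscreteMeasurableSpace B] [Finite A] [Finite B] in
lemma measurable_prB : Measurable (prB : (ℤ → A × B) → ℤ → B) :=
  measurable_pi_lambda _ fun i => (measurable_pi_apply i).snd

omit [DiscreteMeasurableSpace A] [Finite A] in
lemma measurable_joinMap {m : ℕ} {φ : (ℤ → B) → A} (hφ : Loc m φ) : Measurable (joinMap φ) :=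
  measurable_pi_lambda _ fun n =>
    Measurable.prodMk (fun s _ => measurable_zShift n (hφ.fMeas s)) (measurable_pi_apply n)

lemma measurableSet_mismatch {m : ℕ} {f : (ℤ → B) → A} (hf : Loc m f) :
    MeasurableSet {z : ℤ → A × B | (z 0).1 ≠ f (prB z)} := by
  refine Loc.measurableSet (m := m) fun x y h => ?_
  simp only [Set.mem_ofPred_eq]
  have e : f (prB x) = f (prB y) := loc_prB hf x y h
  rw [e, h 0 (by omega) (by omega)]

lemma measurableSet_mismatch' {m : ℕ} {g : (ℤ → A) → B} (hg : Loc m g) :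
    MeasurableSet {z : ℤ → A × B | (z 0).2 ≠ g (prA z)} := by
  refine Loc.measurableSet (m := m) fun x y h => ?_
  simp only [Set.mem_ofPred_eq]
  have e : g (prA x) = g (prA y) := loc_prA hg x y h
  rw [e, h 0 (by omega) (by omega)]

omit [DiscreteMeasurableSpace A] [Finite A] in
lemma Stat.map_joinMap {ν : Measure (ℤ → B)} (h : Stat ν) {m : ℕ} {φ : (ℤ → B) → A}
    (hφ : Loc m φ) : Stat (ν.map (joinMap φ)) := by
  have hm := measurable_joinMap hφ
  unfold Stat
  rw [Measure.map_map (measurable_zShift 1) hm]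
  have : zShift 1 ∘ joinMap φ = joinMap φ ∘ zShift 1 := by
    funext x; exact (joinMap_zShift φ 1 x).symm
  rw [this, ← Measure.map_map hm (measurable_zShift 1), h]

end JoinMap

section BlockCode

variable {A B : Type} {N L : ℕ}

/-- The `L` words of length `N` following the marker block. -/
def readWords (N L : ℕ) (y : ℤ → B) : Fin L → Fin N → B :=
  fun l k => y (((l + 1) * N + k : ℕ) : ℤ)

/-- The code writing the marker and the words `ψ` above the blocks with base point in `G`. -/
noncomputable def blockCode (a₁ : A) (G : Set (ℤ → B))
    (ψ : (Fin L → Fin N → B) → Fin L → Fin N → A) (x : ℤ → B) : A :=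
  if h : ∃ i : ℕ, i < (L + 1) * N ∧ zShift (-(i : ℤ)) x ∈ G then
    codeWord a₁ (ψ (readWords N L (zShift (-(h.choose : ℤ)) x))) h.choose else a₁

lemma blockCode_eq (a₁ : A) {G : Set (ℤ → B)} (ψ : (Fin L → Fin N → B) → Fin L → Fin N → A)
    (hdisj : ∀ x ∈ G, ∀ i : ℕ, 0 < i → i < (L + 1) * N → zShift (i : ℤ) x ∉ G)
    {x : ℤ → B} {i : ℕ} (hi : i < (L + 1) * N) (hx : zShift (-(i : ℤ)) x ∈ G) :
    blockCode a₁ G ψ x = codeWord a₁ (ψ (readWords N L (zShift (-(i : ℤ)) x))) i := by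
  have h : ∃ i : ℕ, i < (L + 1) * N ∧ zShift (-(i : ℤ)) x ∈ G := ⟨i, hi, hx⟩
  have key : ∀ i j : ℕ, j < (L + 1) * N → zShift (-(i : ℤ)) x ∈ G → zShift (-(j : ℤ)) x ∈ G →
      ¬ i < j := by
    intro i j hj h1 h2 hlt
    refine hdisj _ h2 (j - i) (by omega) (by omega) ?_
    rwa [zShift_zShift, Nat.cast_sub hlt.le, show (j : ℤ) - i + -j = -i by ring]
  have e : h.choose = i := le_antisymm (not_lt.1 (key _ _ h.choose_spec.1 hx h.choose_spec.2))
    (not_lt.1 (key _ _ hi h.choose_spec.2 hx))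
  rw [blockCode, dif_pos h, e]

lemma loc_blockCode (a₁ : A) {G : Set (ℤ → B)} (ψ : (Fin L → Fin N → B) → Fin L → Fin N → A)
    (hdisj : ∀ x ∈ G, ∀ i : ℕ, 0 < i → i < (L + 1) * N → zShift (i : ℤ) x ∉ G)
    {R : ℕ} (hG : Loc R (· ∈ G)) : Loc (R + (L + 1) * N) (blockCode a₁ G ψ) := by
  intro x y hxy
  have hGxy : ∀ i : ℕ, i < (L + 1) * N →
      (zShift (-(i : ℤ)) x ∈ G ↔ zShift (-(i : ℤ)) y ∈ G) := by
    intro i hi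
    refine iff_of_eq (hG _ _ fun j h1 h2 => hxy _ ?_ ?_) <;> push_cast <;> zify at hi <;> linarith
  by_cases h : ∃ i : ℕ, i < (L + 1) * N ∧ zShift (-(i : ℤ)) x ∈ G
  · obtain ⟨i, hi, hx⟩ := h
    rw [blockCode_eq a₁ ψ hdisj hi hx, blockCode_eq a₁ ψ hdisj hi ((hGxy i hi).1 hx)]
    congr 2
    funext l k
    refine hxy _ ?_ ?_
    · push_cast; zify at hi; nlinarith [l.2, k.2]
    · have h1 : ((l : ℕ) + 1) * N + k < (L + 1) * N := by
        have : ((l : ℕ) + 2) * N ≤ (L + 1) * N := Nat.mul_le_mul_right _ (by omega)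
        have := k.2
        nlinarith
      zify at h1
      push_cast at h1 ⊢
      linarith
  · have h' : ¬ ∃ i : ℕ, i < (L + 1) * N ∧ zShift (-(i : ℤ)) y ∈ G := fun ⟨i, hi, hy⟩ =>
      h ⟨i, hi, (hGxy i hi).2 hy⟩
    rw [blockCode, dif_neg h, blockCode, dif_neg h']

lemma joinMap_blockCode (a₁ : A) {G : Set (ℤ → B)} (ψ : (Fin L → Fin N → B) → Fin L → Fin N → A)
    (hdisj : ∀ x ∈ G, ∀ i : ℕ, 0 < i → i < (L + 1) * N → zShift (i : ℤ) x ∉ G)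
    {y : ℤ → B} (hy : y ∈ G) {s : ℕ} (hs : s < (L + 1) * N) :
    joinMap (blockCode a₁ G ψ) y s = (codeWord a₁ (ψ (readWords N L y)) s, y s) := by
  have h0 : zShift (-(s : ℤ)) (zShift (s : ℤ) y) = y := by
    rw [zShift_zShift, neg_add_cancel, zShift_zero]
  simp only [joinMap]
  rw [blockCode_eq a₁ ψ hdisj hs (by rwa [h0]), h0]

/-- A letter `w l k` for some triple satisfying `P`. -/
noncomputable def pickLetter [Nonempty B] (P : (Fin L → Fin N → B) → Fin L → Fin N → Prop) : B :=
  if h : ∃ w l k, P w l k then h.choose h.choose_spec.choose h.choose_spec.choose_spec.choose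
  else Classical.arbitrary B

/-- The decoder associated to a family of code words. -/
noncomputable def decode [Nonempty B] (a₁ : A) (T : Finset (Fin L → Fin N → B))
    (ψ : (Fin L → Fin N → B) → Fin L → Fin N → A) (a : ℤ → A) : B :=
  pickLetter fun (w : Fin L → Fin N → B) (l : Fin L) (k : Fin N) => w ∈ T ∧
    ∀ s < (L + 1) * N, a ((s : ℤ) - ((l + 1) * N + k : ℕ)) = codeWord a₁ (ψ w) s

lemma block_lt (l : Fin L) (k : Fin N) : ((l : ℕ) + 1) * N + k < (L + 1) * N := by
  have : ((l : ℕ) + 2) * N ≤ (L + 1) * N := Nat.mul_le_mul_right _ (by omega)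
  have := k.2
  nlinarith

lemma decode_eq [Nonempty B] {a₀ a₁ : A} (ha : a₀ ≠ a₁)
    {T : Finset (Fin L → Fin N → B)} {ψ : (Fin L → Fin N → B) → Fin L → Fin N → A}
    (hinj : Set.InjOn ψ T) (hT : ∀ w ∈ T, ∀ l, Framed a₀ (ψ w l)) {a : ℤ → A}
    {w : Fin L → Fin N → B} (hw : w ∈ T) {l : Fin L} {k : Fin N}
    (h : ∀ s < (L + 1) * N, a ((s : ℤ) - ((l + 1) * N + k : ℕ)) = codeWord a₁ (ψ w) s) :
    decode a₁ T ψ a = w l k := by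
  have hex : ∃ (w : Fin L → Fin N → B) (l : Fin L) (k : Fin N), w ∈ T ∧
      ∀ s < (L + 1) * N, a ((s : ℤ) - ((l + 1) * N + k : ℕ)) = codeWord a₁ (ψ w) s :=
    ⟨w, l, k, hw, h⟩
  obtain ⟨h1, h2⟩ := hex.choose_spec.choose_spec.choose_spec
  obtain ⟨h3, h4⟩ := codeWord_phase_unique ha l.pos (hT _ h1) (hT _ hw) (block_lt _ _)
    (block_lt _ _) h2 h
  obtain ⟨h5, h6⟩ := block_index_unique h3
  rw [decode, pickLetter, dif_pos hex, h6, Fin.ext h5, hinj h1 hw h4]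

lemma loc_decode [Nonempty B] (a₁ : A) (T : Finset (Fin L → Fin N → B))
    (ψ : (Fin L → Fin N → B) → Fin L → Fin N → A) : Loc ((L + 1) * N) (decode a₁ T ψ) := by
  intro x y hxy
  refine congrArg pickLetter ?_
  funext w l k
  have hlk := block_lt l k
  refine propext (and_congr_right fun _ => forall₂_congr fun s hs => ?_)
  rw [hxy _ (by omega) (by omega)]

lemma sum_blocks_le {f : ℕ → ℝ} (hf : ∀ s, 0 ≤ f s) {I : Finset ℕ} (hI : I ⊆ Finset.range N) :
    ∑ l : Fin L, ∑ t ∈ I, f ((l + 1) * N + t) ≤ ∑ s ∈ Finset.range ((L + 1) * N), f s := by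
  rw [← Finset.sum_product']
  have hinj : Set.InjOn (fun q : Fin L × ℕ => ((q.1 : ℕ) + 1) * N + q.2)
      (Finset.univ ×ˢ I : Finset (Fin L × ℕ)) := by
    rintro ⟨l, t⟩ h ⟨l', t'⟩ h' he
    have ht := Finset.mem_range.1 (hI (Finset.mem_product.1 h).2)
    have ht' := Finset.mem_range.1 (hI (Finset.mem_product.1 h').2)
    obtain ⟨h1, h2⟩ := block_index_unique (k := ⟨t, ht⟩) (k' := ⟨t', ht'⟩) he
    exact Prod.ext (Fin.ext h1) (Fin.ext_iff.1 h2)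
  rw [← Finset.sum_image (f := f) hinj]
  refine Finset.sum_le_sum_of_subset_of_nonneg ?_ fun s _ _ => hf s
  intro s hs
  obtain ⟨⟨l, t⟩, h, rfl⟩ := Finset.mem_image.1 hs
  have ht := Finset.mem_range.1 (hI (Finset.mem_product.1 h).2)
  exact Finset.mem_range.2 (block_lt l ⟨t, ht⟩)

end BlockCode


section BlockCoding

variable {A B : Type}

/-- The word `u` with its two end letters replaced by `a₀`. -/
noncomputable def frame {N : ℕ} (a₀ : A) (u : Fin N → A) (j : Fin N) : A :=
  if (j : ℕ) = 0 ∨ (j : ℕ) + 1 = N then a₀ else u j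

lemma framed_frame {N : ℕ} (a₀ : A) (u : Fin N → A) : Framed a₀ (frame a₀ u) :=
  fun _ hk => if_pos hk

/-- Positions in `[0, N)` whose `k`-window avoids the end letters. -/
def innerRange (N k : ℕ) : Finset ℕ := {t ∈ Finset.range N | k < t ∧ t + k + 1 < N}

/-- The pair of words `a` reads the window `γ` at position `t`. -/
def SeesAt {N k : ℕ} (γ : Fin (2 * k + 1) → A × B) (t : ℕ) (a : (Fin N → A) × (Fin N → B)) :
    Prop :=
  ∀ (i : Fin (2 * k + 1)) (j : Fin N), (j : ℕ) + k = t + i → (a.1 j, a.2 j) = γ i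

lemma innerRange_subset (N k : ℕ) : innerRange N k ⊆ Finset.range N := Finset.filter_subset _ _

lemma card_innerRange (N k : ℕ) : (N : ℝ) - (2 * k + 2) ≤ (innerRange N k).card := by
  have h : Finset.Ico (k + 1) (N - k - 1) ⊆ innerRange N k := by
    intro t ht
    simp only [innerRange, Finset.mem_filter, Finset.mem_range, Finset.mem_Ico] at ht ⊢
    omega
  have := Finset.card_le_card h
  rw [Nat.card_Ico] at this
  have h2 : N ≤ (innerRange N k).card + (2 * k + 2) := by omega
  have h3 : (N : ℝ) ≤ (innerRange N k).card + (2 * k + 2) := by exact_mod_cast h2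
  linarith

variable [Fintype A] [Fintype B]
  [MeasurableSpace A] [MeasurableSpace B] [DiscreteMeasurableSpace A] [DiscreteMeasurableSpace B]

/-- The framed `A`-word and the `B`-word read on `[0, N)`. -/
noncomputable def pairWord (a₀ : A) (N : ℕ) (z : ℤ → A × B) : (Fin N → A) × (Fin N → B) :=
  (frame a₀ fun j => (z (j : ℤ)).1, fun j => (z (j : ℤ)).2)

omit [Fintype A] [Fintype B] [MeasurableSpace A] [MeasurableSpace B] [DiscreteMeasurableSpace A] [DiscreteMeasurableSpace B] in
lemma seesAt_pairWord {a₀ : A} {N k : ℕ} (γ : Fin (2 * k + 1) → A × B) {t : ℕ}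
    (ht : t ∈ innerRange N k) (z : ℤ → A × B) :
    SeesAt γ t (pairWord a₀ N z) ↔ win k (zShift (t : ℤ) z) = γ := by
  simp only [innerRange, Finset.mem_filter, Finset.mem_range] at ht
  have hfr : ∀ j : Fin N, 0 < (j : ℕ) → (j : ℕ) + 1 < N →
      ((pairWord a₀ N z).1 j, (pairWord a₀ N z).2 j) = z (j : ℤ) := by
    intro j h1 h2
    simp only [pairWord, frame]
    rw [if_neg (by omega)]
  constructor
  · intro h
    funext i
    have hi := i.2
    have hj : t + i - k < N := by omega
    rw [← h i ⟨t + i - k, hj⟩ (by simp only; omega), hfr _ (by simp only; omega) (by simp only; omega)]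
    simp only [win, zShift]
    congr 1
    omega
  · rintro rfl i j hij
    have hi := i.2
    rw [hfr _ (by omega) (by omega)]
    simp only [win, zShift]
    congr 1
    omega

omit [Fintype A] [Fintype B] in
lemma fMeas_pairWord [Finite A] [Finite B] (a₀ : A) (N : ℕ) :
    FMeas (pairWord a₀ N : (ℤ → A × B) → _) := by
  refine FMeas.prod ?_ ?_
  · refine FMeas.comp (R := fun (z : ℤ → A × B) (j : Fin N) => (z (j : ℤ)).1) ?_ (frame a₀)
    exact FMeas.pi fun j => fMeas_coord Prod.fst _
  · exact FMeas.pi fun j => fMeas_coord Prod.snd _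

variable {lam : Measure (ℤ → A × B)} [IsProbabilityMeasure lam]

omit [IsProbabilityMeasure lam] in
lemma measurableSet_win_fiber {D : Type} [MeasurableSpace D] [DiscreteMeasurableSpace D] [Finite D]
    (k : ℕ) (γ : Fin (2 * k + 1) → D) : MeasurableSet (win k ⁻¹' {γ}) := fMeas_win k {γ}

lemma sum_sees (hst : Stat lam) (a₀ : A) (N k : ℕ) (γ : Fin (2 * k + 1) → A × B) :
    ∑ a, lam.real (pairWord a₀ N ⁻¹' {a}) *
      (∑ t ∈ innerRange N k, if SeesAt γ t a then (1 : ℝ) else 0) =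
      (innerRange N k).card * lam.real (win k ⁻¹' {γ}) := by
  simp only [Finset.mul_sum]
  rw [Finset.sum_comm, ← nsmul_eq_mul, ← Finset.sum_const]
  refine Finset.sum_congr rfl fun t ht => ?_
  have := sum_real_fiber lam (fMeas_pairWord (B := B) a₀ N) {a | SeesAt γ t a}
  simp only [mul_ite, mul_one, mul_zero]
  rw [← Finset.sum_filter]
  refine Eq.trans ?_ (this.trans ?_)
  · rfl
  rw [← hst.real_preimage t (measurableSet_win_fiber k γ)]
  congr 1
  ext z
  exact seesAt_pairWord γ ht z

lemma hp_le_frame [Nonempty A] (a₀ : A) (N : ℕ) :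
    hp lam Prod.fst N ≤
      partEnt lam (fun z => (pairWord a₀ N z).1) + 2 * Real.log (Fintype.card A) := by
  have h1 : FMeas (fun z : ℤ → A × B => (pairWord a₀ N z).1) :=
    (fMeas_pairWord a₀ N).comp Prod.fst
  have h2 := fMeas_coord (Prod.fst : A × B → A) 0
  have h3 := fMeas_coord (Prod.fst : A × B → A) ((N : ℤ) - 1)
  have h4 := partEnt_prod_le lam h1 (h2.prod h3)
  have h5 := partEnt_prod_le lam h2 h3
  have h6 := partEnt_le_log_card lam h2
  have h7 := partEnt_le_log_card lam h3
  have h8 := partEnt_comp_le lam (h1.prod (h2.prod h3)) (fun (w : (Fin N → A) × A × A) (j : Fin N) =>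
    if (j : ℕ) = 0 then w.2.1 else if (j : ℕ) + 1 = N then w.2.2 else w.1 j)
  have h9 : (fun z : ℤ → A × B => (fun (w : (Fin N → A) × A × A) (j : Fin N) =>
      if (j : ℕ) = 0 then w.2.1 else if (j : ℕ) + 1 = N then w.2.2 else w.1 j)
      ((pairWord a₀ N z).1, (z 0).1, (z ((N : ℤ) - 1)).1)) =
      fun z (j : Fin N) => (z (j : ℤ)).1 := by
    funext z j
    simp only [pairWord, frame]
    split_ifs with h h' h''
    · simp [h]
    · rw [show (N : ℤ) - 1 = (j : ℕ) by omega]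
    · tauto
    · rfl
  rw [h9] at h8
  rw [hp]
  linarith

variable {ν : Measure (ℤ → B)} [IsProbabilityMeasure ν] {p : B → ℝ}

omit [Fintype A] [IsProbabilityMeasure lam] [IsProbabilityMeasure ν] [DiscreteMeasurableSpace A] in
lemma real_word_snd [Nonempty B] (hν : Iid ν p) (hB : lam.map prB = ν) (N : ℕ) (w : Fin N → B) :
    lam.real ((fun (z : ℤ → A × B) (j : Fin N) => (z (j : ℤ)).2) ⁻¹' {w}) = ∏ i, p (w i) := by
  rw [← hν.real_eq (e := fun i : Fin N => ((i : ℕ) : ℤ)) (fun i j h => Fin.ext (by simpa using h)) w,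
    ← hB, map_measureReal_apply measurable_prB]
  · congr 1
    ext z
    simp [prB, funext_iff]
  · rw [show {x : ℤ → B | ∀ i : Fin N, x ((i : ℕ) : ℤ) = w i} =
      ⋂ i : Fin N, (fun x : ℤ → B => x ((i : ℕ) : ℤ)) ⁻¹' {w i} by ext; simp]
    exact MeasurableSet.iInter fun i => measurable_pi_apply _ (measurableSet_singleton _)

omit [IsProbabilityMeasure ν] in
lemma hp_snd_le [Nonempty B] (hν : Iid ν p) (hB : lam.map prB = ν) (N : ℕ) :
    partEnt lam (fun (z : ℤ → A × B) (j : Fin N) => (z (j : ℤ)).2) ≤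
      N * ∑ b, Real.negMulLog (p b) := by
  refine (partEnt_pi_le lam N fun i => fMeas_coord (Prod.snd : A × B → B) (i : ℤ)).trans ?_
  have : ∀ i : Fin N, partEnt lam (fun z : ℤ → A × B => (z (i : ℤ)).2) = ∑ b, Real.negMulLog (p b) := by
    intro i
    rw [partEnt_eq]
    refine Finset.sum_congr rfl fun b _ => ?_
    congr 1
    have h := hν.real_eq (ι := Unit) (e := fun _ => (i : ℤ)) (fun _ _ _ => rfl) (fun _ => b)
    rw [← hB, map_measureReal_apply measurable_prB] at h
    · simpa [prB, Set.preimage] using h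
    · simp only [forall_const]
      exact (measurable_pi_apply (i : ℤ) : Measurable fun x : ℤ → B => x i)
        (measurableSet_singleton b)
  simp [this]

omit [Fintype B] [DiscreteMeasurableSpace B] in
lemma block_code_aux {C : Set (ℤ → B)} (hst : Stat ν) {L N : ℕ} {G : Set (ℤ → B)}
    (hG : MeasurableSet G) (hC : MeasurableSet C)
    (hdisj : ∀ x ∈ G, ∀ i : ℕ, 0 < i → i < (L + 1) * N → zShift (i : ℤ) x ∉ G)
    {I : Finset ℕ} (hI : I ⊆ Finset.range N) {c : ℝ}
    (h : ∀ y ∈ G, c ≤ ∑ l : Fin L, ∑ t ∈ I,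
      if zShift ((((l : ℕ) + 1) * N + t : ℕ) : ℤ) y ∈ C then (1 : ℝ) else 0) :
    c * ν.real G ≤ ν.real C := by
  refine tower_lower_bound hst hG hC hdisj fun y hy => (h y hy).trans ?_
  exact sum_blocks_le (f := fun s : ℕ => if zShift (s : ℤ) y ∈ C then (1 : ℝ) else 0)
    (fun s => by split_ifs <;> norm_num) hI

lemma block_code_arith {θ x g L N I k : ℝ} (hθ : 0 < θ) (hx1 : x ≤ 1) (hxθ : θ < x)
    (hL : 0 ≤ L) (hk : 0 ≤ k) (hI : N - (2 * k + 2) ≤ I) (hg : 0 ≤ g) (hN : 2 * k + 3 ≤ N * (θ / 4))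
    (hLN : (1 - θ / 4) * (1 - θ / 8) ≤ L * N * g) : x - θ ≤ L * (I * x - 1) * g := by
  have h4 : N * (x - θ / 4) ≤ I * x - 1 := by
    nlinarith [mul_le_mul_of_nonneg_right hI (hθ.trans hxθ).le]
  have h5 : 0 ≤ L * g := by positivity
  have h6 : (L * N * g) * (x - θ / 4) ≤ L * (I * x - 1) * g := by
    linarith [mul_le_mul_of_nonneg_left h4 h5]
  have h7 : (1 - θ / 4) * (1 - θ / 8) * (x - θ / 4) ≤ (L * N * g) * (x - θ / 4) :=
    mul_le_mul_of_nonneg_right hLN (by linarith)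
  have h8 : 1 - θ / 4 - θ / 8 ≤ (1 - θ / 4) * (1 - θ / 8) := by nlinarith
  have h9 := mul_le_mul_of_nonneg_right h8 (show 0 ≤ x - θ / 4 by linarith)
  nlinarith

/-- **Block coding.** A joining of `ν = p^ℤ` whose `A`-marginal has entropy larger than that of `p`
is close to the graph of a finite code `φ`, whose inverse is almost a finite code. -/
theorem exists_block_code [Nonempty B] (hν : Iid ν p) (hp0 : ∀ b, 0 < p b) (hp1 : ∑ b, p b = 1)
    {b₁ : B} (hb₁ : p b₁ < 1) {a₀ a₁ : A} (ha : a₀ ≠ a₁) (hst : Stat lam) (hB : lam.map prB = ν)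
    {κ : ℝ} (hκ : 0 < κ)
    (hent : ∀ n : ℕ, n * (∑ b, Real.negMulLog (p b) + κ) ≤ hp lam Prod.fst n)
    (k : ℕ) {θ : ℝ} (hθ : 0 < θ) (hθ1 : θ ≤ 1) :
    ∃ (φ : (ℤ → B) → A) (m : ℕ), Loc m φ ∧
      (∃ (m' : ℕ) (g : (ℤ → A) → B), Loc m' g ∧
        (ν.map (joinMap φ)).real {z | (z 0).2 ≠ g (prA z)} < θ) ∧
      ∀ γ, lam.real (win k ⁻¹' {γ}) - θ ≤ (ν.map (joinMap φ)).real (win k ⁻¹' {γ}) := by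
  have : Nonempty A := ⟨a₀⟩
  obtain ⟨N, hN1, hN2, hN3⟩ : ∃ N : ℕ, 0 < N ∧ 2 * Real.log (Fintype.card A) < N * κ ∧
      2 * (k : ℝ) + 3 ≤ N * (θ / 4) := by
    obtain ⟨N₁, h1⟩ := exists_nat_gt (2 * Real.log (Fintype.card A) / κ)
    obtain ⟨N₂, h2⟩ := exists_nat_gt ((2 * (k : ℝ) + 3) / (θ / 4))
    rw [div_lt_iff₀ hκ] at h1
    rw [div_lt_iff₀ (by positivity)] at h2
    refine ⟨N₁ + N₂ + 1, by omega, ?_, ?_⟩ <;> push_cast <;> nlinarith [N₁.cast_nonneg (α := ℝ),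
      N₂.cast_nonneg (α := ℝ)]
  set q : (Fin N → A) × (Fin N → B) → ℝ := fun a => lam.real (pairWord a₀ N ⁻¹' {a}) with hq
  have hpw := fMeas_pairWord (B := B) a₀ N
  have hq0 : ∀ a, 0 ≤ q a := fun a => measureReal_nonneg
  have hq1 : ∑ a, q a = 1 := sum_real_fiber_univ lam hpw
  have hqW : ∀ w, ∑ u, q (u, w) = ∏ i, p (w i) := by
    intro w
    rw [← real_word_snd hν hB N w]
    exact sum_real_pair_fst lam (hpw.comp Prod.fst) (hpw.comp Prod.snd) w
  have hHW : ∑ w, Real.negMulLog (∑ u, q (u, w)) ≤ N * ∑ b, Real.negMulLog (p b) := by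
    refine le_trans (le_of_eq ?_) (hp_snd_le (lam := lam) hν hB N)
    rw [partEnt_eq]
    exact Finset.sum_congr rfl fun w _ => by rw [hqW, real_word_snd hν hB]
  have hHU : ∑ u, Real.negMulLog (∑ w, q (u, w)) =
      partEnt lam (fun z => (pairWord a₀ N z).1) := by
    rw [partEnt_eq]
    refine Finset.sum_congr rfl fun u _ => ?_
    congr 1
    exact sum_real_pair_snd lam (hpw.comp Prod.fst) (hpw.comp Prod.snd) u
  have hlt : ∑ w, Real.negMulLog (∑ u, q (u, w)) < ∑ u, Real.negMulLog (∑ w, q (u, w)) := by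
    have h1 := hp_le_frame (lam := lam) a₀ N
    have h2 := hent N
    rw [hHU]
    nlinarith
  set F : (Fin (2 * k + 1) → A × B) → (Fin N → A) × (Fin N → B) → ℝ := fun γ a =>
    ∑ t ∈ innerRange N k, if SeesAt γ t a then (1 : ℝ) else 0 with hF
  obtain ⟨L₀, hL₀⟩ := exists_matching hq0 hq1 hlt F one_pos (show 0 < θ / 16 by positivity)
  obtain ⟨L₁, hL₁⟩ := exists_nat_gt (1 / (θ / 4))
  rw [div_lt_iff₀ (by positivity)] at hL₁
  set L := L₀ + L₁ with hL
  obtain ⟨T, ψ, hinj, hpos, hT, hTp⟩ := hL₀ L (by omega)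
  have hfr : ∀ w ∈ T, ∀ l, Framed a₀ (ψ w l) := by
    intro w hw l
    obtain ⟨z, hz⟩ := nonempty_of_measureReal_ne_zero (hpos w hw l).ne'
    have : (pairWord a₀ N z).1 = ψ w l := congrArg Prod.fst hz
    rw [← this]
    exact framed_frame _ _
  have hrw : FMeas (readWords N L : (ℤ → B) → _) := FMeas.pi fun l => FMeas.pi fun j =>
    fMeas_coord (id : B → B) _
  have hgood : ν.real {y | readWords N L y ∈ T} = ∑ w ∈ T, ∏ i, ∑ u, q (u, w i) := by
    have h1 := sum_real_fiber ν hrw {w | w ∈ T}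
    refine Eq.trans h1.symm ?_
    refine Finset.sum_congr (by ext; simp) fun w _ => ?_
    simp only [hqW]
    have h2 := hν.real_eq (e := fun i : Fin L × Fin N => ((((i.1 : ℕ) + 1) * N + i.2 : ℕ) : ℤ))
      (fun i j h => by
        obtain ⟨h3, h4⟩ := block_index_unique (Nat.cast_injective h)
        exact Prod.ext (Fin.ext h3) h4) (fun i => w i.1 i.2)
    rw [← Fintype.prod_prod_type', ← h2]
    congr 1
    ext x
    simp [readWords, funext_iff]
  have hbadm : MeasurableSet {y : ℤ → B | readWords N L y ∉ T} := hrw {w | w ∉ T}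
  have hbad : ν.real {y | readWords N L y ∉ T} ≤ θ / 16 := by
    have h1 := measureReal_compl (μ := ν) (hrw {w | w ∈ T})
    have h2 : ν.real (readWords N L ⁻¹' {w | w ∈ T}) = ∑ w ∈ T, ∏ i, ∑ u, q (u, w i) := hgood
    rw [h2, probReal_univ] at h1
    have h3 : ν.real {y | readWords N L y ∉ T} = ν.real (readWords N L ⁻¹' {w | w ∈ T})ᶜ := rfl
    linarith
  obtain ⟨R, E, hE, hEd, hE1, hE2⟩ := hν.exists_tower hp0 hp1 hb₁
    (show 0 < (L + 1) * N by positivity) (show 0 < θ / 16 by positivity) hbadm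
  set G := E ∩ {y | readWords N L y ∈ T} with hG
  have hdisj : ∀ x ∈ G, ∀ i : ℕ, 0 < i → i < (L + 1) * N → zShift (i : ℤ) x ∉ G :=
    fun x hx i h1 h2 h3 => hEd x hx.1 i h1 h2 h3.1
  have hrl : Loc ((L + 1) * N) (readWords N L : (ℤ → B) → _) := by
    intro x y hxy
    funext l j
    have := block_lt l j
    exact hxy _ (by omega) (by omega)
  have hGl : Loc (R + (L + 1) * N) (· ∈ G) := by
    intro x y hxy
    have h1 := (hE.mono (Nat.le_add_right R ((L + 1) * N))) x y hxy
    have h2 := (hrl.mono (Nat.le_add_left ((L + 1) * N) R)) x y hxy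
    simp only [hG, Set.mem_inter_iff, Set.mem_ofPred_eq, h2]
    simp only [h1]
  have hGm : MeasurableSet G := hGl.measurableSet
  have hMG : 1 - θ / 8 ≤ ((L + 1) * N : ℕ) * ν.real G := by
    have h1 : ν.real E ≤ ν.real G + ν.real (E ∩ {y | readWords N L y ∉ T}) := by
      refine (measureReal_mono ?_).trans (measureReal_union_le _ _)
      intro y hy
      by_cases h : readWords N L y ∈ T
      · exact Or.inl ⟨hy, h⟩
      · exact Or.inr ⟨hy, h⟩
    have h2 := mul_le_mul_of_nonneg_left h1 (Nat.cast_nonneg (α := ℝ) ((L + 1) * N))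
    linarith
  set φ := blockCode a₁ G ψ with hφ
  have hφl := loc_blockCode a₁ ψ hdisj hGl
  rw [← hφ] at hφl
  have hjm := measurable_joinMap hφl
  have hval : ∀ y ∈ G, ∀ (l : Fin L) (j : Fin N),
      joinMap φ y ((((l : ℕ) + 1) * N + j : ℕ) : ℤ) = (ψ (readWords N L y) l j, readWords N L y l j) := by
    intro y hy l j
    rw [hφ, joinMap_blockCode a₁ ψ hdisj hy (block_lt l j), codeWord_block]
    rfl
  have hLN : (1 - θ / 4) * (1 - θ / 8) ≤ L * N * ν.real G := by
    have h1 : (1 - θ / 4) * (L + 1) ≤ (L : ℝ) := by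
      have : (L₁ : ℝ) ≤ L := by exact_mod_cast (by omega : L₁ ≤ L)
      nlinarith
    have h2 : 0 ≤ N * ν.real G := by positivity
    push_cast at hMG
    nlinarith [mul_le_mul_of_nonneg_right h1 h2, mul_le_mul_of_nonneg_left hMG
      (show 0 ≤ 1 - θ / 4 by linarith)]
  refine ⟨φ, _, hφl, ⟨_, decode a₁ T ψ, loc_decode a₁ T ψ, ?_⟩, fun γ => ?_⟩
  · have hdm := measurableSet_mismatch' (A := A) (B := B) (loc_decode a₁ T ψ)
    rw [map_measureReal_apply hjm hdm]
    have h1 : L * N * ν.real G ≤ ν.real (joinMap φ ⁻¹' {z | (z 0).2 ≠ decode a₁ T ψ (prA z)})ᶜ := by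
      refine block_code_aux hν.stat hGm (hjm hdm).compl hdisj (Finset.Subset.refl _) fun y hy => ?_
      have hone : (L : ℝ) * N = ∑ _l : Fin L, ∑ _t ∈ Finset.range N, (1 : ℝ) := by simp
      rw [hone]
      refine Finset.sum_le_sum fun l _ => Finset.sum_le_sum fun t ht => ?_
      rw [if_pos]
      obtain ⟨j, rfl⟩ : ∃ j : Fin N, (j : ℕ) = t := ⟨⟨t, Finset.mem_range.1 ht⟩, rfl⟩
      simp only [Set.mem_compl_iff, Set.mem_preimage, Set.mem_ofPred_eq, not_not]
      rw [joinMap_zShift, decode_eq ha hinj hfr (w := readWords N L y) hy.2 (l := l) (k := j)]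
      · simp only [zShift, zero_add]
        rw [hval y hy]
      · intro s hs
        simp only [prA, zShift, sub_add_cancel]
        rw [hφ, joinMap_blockCode a₁ ψ hdisj hy hs]
    rw [measureReal_compl (hjm hdm), probReal_univ] at h1
    nlinarith
  · have hcm := measurableSet_win_fiber (D := A × B) k γ
    rw [map_measureReal_apply hjm hcm]
    set x := lam.real (win k ⁻¹' {γ}) with hx
    have hx1 : x ≤ 1 := measureReal_le_one
    rcases le_or_gt x θ with hxθ | hxθ
    · exact (sub_nonpos.2 hxθ).trans measureReal_nonneg
    have h1 : L * ((innerRange N k).card * x - 1) * ν.real G ≤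
        ν.real (joinMap φ ⁻¹' (win k ⁻¹' {γ})) := by
      refine block_code_aux hν.stat hGm (hjm hcm) hdisj (innerRange_subset N k) fun y hy => ?_
      have h2 := hT _ hy.2 γ
      rw [sum_sees hst] at h2
      refine h2.trans (Finset.sum_le_sum fun l _ => Finset.sum_le_sum fun t ht => ?_)
      by_cases hs : SeesAt γ t (ψ (readWords N L y) l, readWords N L y l)
      · have ht' := ht
        simp only [innerRange, Finset.mem_filter, Finset.mem_range] at ht'
        rw [if_pos hs, if_pos]
        rw [Set.mem_preimage, joinMap_zShift]
        refine Set.mem_singleton_iff.2 (funext fun i => ?_)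
        have hi := i.2
        rw [← hs i ⟨t + i - k, by omega⟩ (by simp only; omega)]
        simp only
        rw [← hval y hy]
        simp only [win, zShift]
        congr 1
        have : t + (i : ℕ) - k + k = t + i := by omega
        push_cast
        omega
      · rw [if_neg hs]
        split_ifs <;> norm_num
    refine le_trans ?_ h1
    exact block_code_arith hθ hx1 hxθ (Nat.cast_nonneg _) (Nat.cast_nonneg k) (card_innerRange N k)
      measureReal_nonneg hN3 hLN

end BlockCoding


section WeakTopology

variable {D : Type} [Finite D] [TopologicalSpace D] [DiscreteTopology D] [MeasurableSpace D]
  [BorelSpace D]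

omit [Finite D] [DiscreteTopology D] [MeasurableSpace D] [BorelSpace D] in
lemma continuous_zShift (k : ℤ) : Continuous (zShift k : (ℤ → D) → ℤ → D) :=
  continuous_pi fun n => continuous_apply (n + k)

omit [Finite D] [MeasurableSpace D] [BorelSpace D] in
lemma Loc.isOpen {m : ℕ} {s : Set (ℤ → D)} (hs : Loc m (· ∈ s)) : IsOpen s := by
  obtain ⟨F, hF⟩ := hs.exists_win
  have : s = win m ⁻¹' {a | F a} := by ext x; exact iff_of_eq (hF x)
  rw [this]
  exact (isOpen_discrete _).preimage (continuous_pi fun i => continuous_apply _)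

omit [Finite D] [TopologicalSpace D] [DiscreteTopology D] [MeasurableSpace D] [BorelSpace D] in
lemma Loc.compl {m : ℕ} {s : Set (ℤ → D)} (hs : Loc m (· ∈ s)) : Loc m (· ∈ sᶜ) := by
  intro x y h
  simp only [Set.mem_compl_iff]
  exact congrArg Not (hs x y h)

lemma Loc.continuous_real {m : ℕ} {s : Set (ℤ → D)} (hs : Loc m (· ∈ s)) :
    Continuous fun μ : ProbabilityMeasure (ℤ → D) => (μ : Measure (ℤ → D)).real s := by
  refine continuous_iff_continuousAt.2 fun μ => ?_
  have hfr : (μ : Measure (ℤ → D)) (frontier s) = 0 := by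
    rw [IsClopen.frontier_eq ⟨⟨hs.compl.isOpen⟩, hs.isOpen⟩]
    simp
  have := ProbabilityMeasure.tendsto_measure_of_null_frontier_of_tendsto' (L := nhds μ)
    (μs := id) tendsto_id hfr
  exact (ENNReal.tendsto_toReal (measure_ne_top _ _)).comp this

omit [Finite D] [TopologicalSpace D] [DiscreteTopology D] [MeasurableSpace D] [BorelSpace D] in
lemma loc_win_mem (m : ℕ) (t : Set (Fin (2 * m + 1) → D)) : Loc m (· ∈ (win m ⁻¹' t : Set (ℤ → D))) := by
  intro x y h
  simp only [Set.mem_preimage, loc_win m x y h]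

/-- Masses of the window cylinders. -/
noncomputable def winMass (μ : ProbabilityMeasure (ℤ → D)) (q : Σ m : ℕ, Fin (2 * m + 1) → D) : ℝ :=
  (μ : Measure (ℤ → D)).real (win q.1 ⁻¹' {q.2})

lemma isClosedEmbedding_winMass :
    Topology.IsClosedEmbedding (winMass : ProbabilityMeasure (ℤ → D) → _) := by
  refine Continuous.isClosedEmbedding (continuous_pi fun q => (loc_win_mem q.1 {q.2}).continuous_real) ?_
  intro μ ν h
  have := μ.2
  have := ν.2
  refine Subtype.ext (ext_win fun m a => ?_)
  exact congrFun h ⟨m, a⟩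

instance secondCountableTopology_processes : SecondCountableTopology (ProbabilityMeasure (ℤ → D)) :=
  isClosedEmbedding_winMass.isInducing.secondCountableTopology

omit [TopologicalSpace D] [DiscreteTopology D] [MeasurableSpace D] [BorelSpace D] in
lemma Loc.abs_real_sub_le [Fintype D] [MeasurableSpace D] [DiscreteMeasurableSpace D]
    {μ ν : Measure (ℤ → D)} [IsProbabilityMeasure μ] [IsProbabilityMeasure ν] {k : ℕ} {s : Set (ℤ → D)}
    (hs : Loc k (· ∈ s)) :
    |μ.real s - ν.real s| ≤ ∑ γ, |μ.real (win k ⁻¹' {γ}) - ν.real (win k ⁻¹' {γ})| := by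
  obtain ⟨F, hF⟩ := hs.exists_win
  have : s = win k ⁻¹' {a | F a} := by ext x; exact iff_of_eq (hF x)
  rw [this, ← sum_real_fiber μ (fMeas_win k), ← sum_real_fiber ν (fMeas_win k),
    ← Finset.sum_sub_distrib]
  refine (Finset.abs_sum_le_sum_abs _ _).trans ?_
  exact Finset.sum_le_sum_of_subset_of_nonneg (Finset.filter_subset _ _) fun _ _ _ => abs_nonneg _

/-- Closeness of the masses of the `k`-window cylinders is a basis of neighbourhoods. -/
lemma exists_winMass_nhds [Fintype D] {μ : ProbabilityMeasure (ℤ → D)} {U : Set (ProbabilityMeasure (ℤ → D))}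
    (hU : U ∈ nhds μ) : ∃ (k : ℕ) (δ : ℝ), 0 < δ ∧ ∀ ν : ProbabilityMeasure (ℤ → D),
      (∀ γ, |(ν : Measure (ℤ → D)).real (win k ⁻¹' {γ}) - (μ : Measure (ℤ → D)).real (win k ⁻¹' {γ})| < δ) →
      ν ∈ U := by
  rw [isClosedEmbedding_winMass.isInducing.nhds_eq_comap, mem_comap] at hU
  obtain ⟨t, ht, htU⟩ := hU
  rw [nhds_pi, Filter.mem_pi'] at ht
  obtain ⟨I, u, hu, hIu⟩ := ht
  have h1 : ∀ q, ∃ δ > 0, Metric.ball (winMass μ q) δ ⊆ u q := fun q => Metric.mem_nhds_iff.1 (hu q)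
  choose δ hδ hball using h1
  obtain ⟨δ₀, hδ₀, hmin⟩ : ∃ δ₀ > 0, ∀ q ∈ I, δ₀ ≤ δ q := by
    rcases I.eq_empty_or_nonempty with rfl | hI
    · exact ⟨1, one_pos, by simp⟩
    · refine ⟨I.inf' hI δ, ?_, fun q hq => Finset.inf'_le _ hq⟩
      exact (Finset.lt_inf'_iff hI).2 fun q _ => hδ q
  set k := I.sup Sigma.fst with hk
  have hcard : (0 : ℝ) < Fintype.card (Fin (2 * k + 1) → D) + 1 := by positivity
  refine ⟨k, δ₀ / (Fintype.card (Fin (2 * k + 1) → D) + 1), by positivity, fun ν hν => htU (hIu ?_)⟩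
  intro q hq
  refine hball q ?_
  rw [Metric.mem_ball, Real.dist_eq]
  refine lt_of_lt_of_le ?_ (hmin q hq)
  have hqk : q.1 ≤ k := Finset.le_sup (f := Sigma.fst) hq
  have := ((loc_win_mem q.1 {q.2}).mono hqk).abs_real_sub_le (μ := (ν : Measure (ℤ → D)))
    (ν := (μ : Measure (ℤ → D)))
  refine this.trans_lt ?_
  refine (Finset.sum_le_sum fun γ _ => (hν γ).le).trans_lt ?_
  rw [Finset.sum_const, nsmul_eq_mul, Finset.card_univ, ← mul_div_assoc, div_lt_iff₀ hcard]
  nlinarith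

end WeakTopology

/-- Category argument: a property which holds on a countable intersection of dense open sets `W k`
upstairs, at the points of which `π` is open, transfers to a dense `G_δ` downstairs. -/
lemma exists_dense_gdelta {Z Y : Type} [TopologicalSpace Z] [CompactSpace Z] [T2Space Z]
    [SecondCountableTopology Z] [TopologicalSpace Y] [BaireSpace Y] [T2Space Y] {π : Z → Y}
    (hπ : Continuous π) (hsurj : Function.Surjective π) {W : ℕ → Set Z} (hWo : ∀ k, IsOpen (W k))
    (hWd : ∀ k, Dense (W k)) (hopen : ∀ z ∈ ⋂ k, W k, ∀ V ∈ nhds z, π '' V ∈ nhds (π z)) :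
    ∃ C : Set Y, IsGδ C ∧ Dense C ∧ ∀ y ∈ C, ∃ z ∈ ⋂ k, W k, π z = y := by
  obtain ⟨ℬ, hℬc, -, hℬ⟩ := TopologicalSpace.exists_countable_basis Z
  have : Countable ℬ := hℬc
  set U : ℬ × ℕ → Set Y := fun q => (closure (π '' q.1.1))ᶜ ∪ interior (π '' (q.1.1 ∩ W q.2)) with hU
  have hUo : ∀ q, IsOpen (U q) := fun q => isClosed_closure.isOpen_compl.union isOpen_interior
  have hWd' : Dense (⋂ k, W k) := dense_iInter_of_isOpen hWo hWd
  have hUd : ∀ q, Dense (U q) := by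
    intro q
    refine dense_iff_inter_open.2 fun O hO hne => ?_
    by_cases h : O ⊆ closure (π '' q.1.1)
    · obtain ⟨y, hy⟩ := hne
      obtain ⟨_, hyO, z, hzV, rfl⟩ := mem_closure_iff.1 (h hy) O hO hy
      have hqo : IsOpen q.1.1 := hℬ.isOpen q.1.2
      obtain ⟨z', hz', hz'W⟩ := dense_iff_inter_open.1 hWd' (q.1.1 ∩ π ⁻¹' O)
        (hqo.inter (hO.preimage hπ)) ⟨z, hzV, hyO⟩
      refine ⟨π z', hz'.2, Or.inr (mem_interior_iff_mem_nhds.2 (hopen z' hz'W _ ?_))⟩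
      exact (hqo.inter (hWo q.2)).mem_nhds ⟨hz'.1, Set.mem_iInter.1 hz'W q.2⟩
    · obtain ⟨y, hyO, hy⟩ := Set.not_subset.1 h
      exact ⟨y, hyO, Or.inl hy⟩
  refine ⟨⋂ q, U q, IsGδ.iInter_of_isOpen hUo, dense_iInter_of_isOpen hUo hUd, fun y hy => ?_⟩
  have hJc : IsClosed (π ⁻¹' {y}) := isClosed_singleton.preimage hπ
  have : CompactSpace (π ⁻¹' {y}) := isCompact_iff_compactSpace.1 hJc.isCompact
  obtain ⟨z₀, hz₀⟩ := hsurj y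
  have : Nonempty (π ⁻¹' {y}) := ⟨⟨z₀, hz₀⟩⟩
  have hd : Dense (⋂ k, (Subtype.val ⁻¹' W k : Set (π ⁻¹' {y}))) := by
    refine dense_iInter_of_isOpen (fun k => (hWo k).preimage continuous_subtype_val) fun k => ?_
    refine dense_iff_inter_open.2 fun O hO ⟨z, hz⟩ => ?_
    obtain ⟨O', hO', rfl⟩ := isOpen_induced_iff.1 hO
    obtain ⟨V, hV, hzV, hVO⟩ := hℬ.exists_subset_of_mem_open hz hO'
    have h1 : y ∈ U (⟨V, hV⟩, k) := Set.mem_iInter.1 hy _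
    have h2 : y ∈ closure (π '' V) := subset_closure ⟨z, hzV, z.2⟩
    obtain ⟨z', hz', hzy⟩ := interior_subset (h1.resolve_left fun h => h h2)
    exact ⟨⟨z', hzy⟩, hVO hz'.1, hz'.2⟩
  obtain ⟨z, hz⟩ := hd.nonempty
  exact ⟨z, Set.mem_iInter.2 fun k => Set.mem_iInter.1 hz k, z.2⟩


section Joinings

variable {A B : Type} [Fintype A] [MeasurableSpace A] [Finite B] [MeasurableSpace B]

lemma blockEntZ_eq (μ : Measure (ℤ → A)) (n : ℕ) : blockEntZ μ n = hp μ id n := by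
  refine Finset.sum_congr rfl fun w _ => ?_
  congr 3
  ext x
  simp [funext_iff]

lemma entZ_eq (μ : Measure (ℤ → A)) : entZ μ = hent μ id := by
  simp only [entZ, hent, blockEntZ_eq]

variable [DiscreteMeasurableSpace A] [DiscreteMeasurableSpace B]

omit [DiscreteMeasurableSpace B] [Finite B] in
lemma hp_map_prA (lam : Measure (ℤ → A × B)) (n : ℕ) : hp (lam.map prA) id n = hp lam Prod.fst n := by
  refine Finset.sum_congr rfl fun w _ => ?_
  have h := fMeas_block (D := A) (W := A) id n 0 {w}
  simp only [add_zero] at h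
  rw [Measure.map_apply measurable_prA h]
  rfl

omit [DiscreteMeasurableSpace B] [Finite B] in
lemma hent_map_prA (lam : Measure (ℤ → A × B)) : hent (lam.map prA) id = hent lam Prod.fst := by
  simp only [hent, hp_map_prA]

omit [Fintype A] [DiscreteMeasurableSpace A] [DiscreteMeasurableSpace B] [Finite B] in
lemma Stat.map_prA {lam : Measure (ℤ → A × B)} (h : Stat lam) : Stat (lam.map prA) := by
  rw [Stat, Measure.map_map (measurable_zShift _) measurable_prA]
  conv_rhs => rw [← h, Measure.map_map measurable_prA (measurable_zShift _)]
  rfl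

omit [Fintype A] [DiscreteMeasurableSpace A] [DiscreteMeasurableSpace B] [Finite B] in
/-- Every pair of stationary processes has a stationary joining. -/
lemma exists_joining {μ : Measure (ℤ → A)} {ν : Measure (ℤ → B)} [IsProbabilityMeasure μ]
    [IsProbabilityMeasure ν] (hμ : Stat μ) (hν : Stat ν) :
    ∃ lam : Measure (ℤ → A × B), IsProbabilityMeasure lam ∧ Stat lam ∧ lam.map prA = μ ∧
      lam.map prB = ν := by
  set zip : (ℤ → A) × (ℤ → B) → ℤ → A × B := fun q n => (q.1 n, q.2 n) with hzip
  have hm : Measurable zip := measurable_pi_lambda _ fun n =>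
    ((measurable_pi_apply n).comp measurable_fst).prodMk ((measurable_pi_apply n).comp measurable_snd)
  refine ⟨(μ.prod ν).map zip, Measure.isProbabilityMeasure_map hm.aemeasurable, ?_, ?_, ?_⟩
  · rw [Stat, Measure.map_map (measurable_zShift _) hm]
    have h1 := ((MeasurePreserving.mk (measurable_zShift 1) hμ).prod
      (MeasurePreserving.mk (measurable_zShift 1) hν)).map_eq
    conv_rhs => rw [← h1, Measure.map_map hm ((measurable_zShift 1).prodMap (measurable_zShift 1))]
    rfl
  · rw [Measure.map_map measurable_prA hm]
    have : (prA ∘ zip : (ℤ → A) × (ℤ → B) → _) = Prod.fst := rfl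
    rw [this, Measure.map_fst_prod]
    simp
  · rw [Measure.map_map measurable_prB hm]
    have : (prB ∘ zip : (ℤ → A) × (ℤ → B) → _) = Prod.snd := rfl
    rw [this, Measure.map_snd_prod]
    simp

end Joinings

section Closedness

variable {D : Type} [Finite D] [TopologicalSpace D] [DiscreteTopology D] [MeasurableSpace D]
  [BorelSpace D]

lemma continuous_hp {W : Type} [Fintype W] (π : D → W) (n : ℕ) :
    Continuous fun μ : ProbabilityMeasure (ℤ → D) => hp (μ : Measure (ℤ → D)) π n := by
  refine continuous_finsetSum _ fun w _ => Real.continuous_negMulLog.comp ?_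
  refine Loc.continuous_real (m := n) fun x y h => ?_
  have : (fun i : Fin n => π (x (i : ℤ))) = fun i : Fin n => π (y (i : ℤ)) := by
    funext i
    rw [h _ (by omega) (by omega)]
  simp only [Set.mem_preimage, this]

lemma isClosed_stat : IsClosed {μ : ProbabilityMeasure (ℤ → D) | Stat (μ : Measure (ℤ → D))} := by
  have h := isClosed_eq (ProbabilityMeasure.continuous_map (continuous_zShift (D := D) 1)) continuous_id
  convert h using 1
  ext μ
  simp only [Set.mem_ofPred_eq, id, Stat]
  exact ⟨fun h => Subtype.ext h, fun h => congrArg Subtype.val h⟩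

lemma isClosed_entropy {W : Type} [Fintype W] (π : D → W) (c : ℝ) :
    IsClosed {μ : ProbabilityMeasure (ℤ → D) | ∀ n : ℕ, n * c ≤ hp (μ : Measure (ℤ → D)) π n} := by
  simp only [Set.ofPred_forall]
  exact isClosed_iInter fun n => isClosed_le continuous_const (continuous_hp π n)

end Closedness

section Marginals

variable {A B : Type} [Finite A] [TopologicalSpace A] [DiscreteTopology A] [MeasurableSpace A]
  [BorelSpace A] [Finite B] [TopologicalSpace B] [DiscreteTopology B] [MeasurableSpace B]
  [BorelSpace B]

omit [Finite A] [DiscreteTopology A] [MeasurableSpace A] [BorelSpace A] [Finite B] [DiscreteTopology B] [MeasurableSpace B] [BorelSpace B] in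
lemma continuous_prA : Continuous (prA : (ℤ → A × B) → ℤ → A) :=
  continuous_pi fun n => continuous_fst.comp (continuous_apply n)

omit [Finite A] [DiscreteTopology A] [MeasurableSpace A] [BorelSpace A] [Finite B] [DiscreteTopology B] [MeasurableSpace B] [BorelSpace B] in
lemma continuous_prB : Continuous (prB : (ℤ → A × B) → ℤ → B) :=
  continuous_pi fun n => continuous_snd.comp (continuous_apply n)

/-- The `A`-marginal of a joining. -/
noncomputable def margA (lam : ProbabilityMeasure (ℤ → A × B)) : ProbabilityMeasure (ℤ → A) :=
  lam.map measurable_prA.aemeasurable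

lemma continuous_margA : Continuous (margA : ProbabilityMeasure (ℤ → A × B) → _) :=
  ProbabilityMeasure.continuous_map continuous_prA

lemma isClosed_margB (ν : Measure (ℤ → B)) :
    IsClosed {lam : ProbabilityMeasure (ℤ → A × B) | (lam : Measure (ℤ → A × B)).map prB = ν} := by
  by_cases hν : IsProbabilityMeasure ν
  · let ν' : ProbabilityMeasure (ℤ → B) := ⟨ν, hν⟩
    have h := isClosed_eq (ProbabilityMeasure.continuous_map (continuous_prB (A := A) (B := B)))
      (continuous_const (y := ν'))
    convert h using 1
    ext μ
    exact ⟨fun h => Subtype.ext h, fun h => congrArg Subtype.val h⟩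
  · convert isClosed_empty
    refine Set.eq_empty_of_forall_notMem fun lam h => hν ?_
    rw [← show Measure.map prB (lam : Measure (ℤ → A × B)) = ν from h]
    exact Measure.isProbabilityMeasure_map measurable_prB.aemeasurable

end Marginals


section Isomorphism

variable {A B : Type} [Finite A] [MeasurableSpace A] [DiscreteMeasurableSpace A]
  [Finite B] [MeasurableSpace B] [DiscreteMeasurableSpace B]

/-- Eventual value of a sequence of codes. -/
noncomputable def limCode [Nonempty B] (g : ℕ → (ℤ → A) → B) (a : ℤ → A) : B :=
  if h : ∃ b, ∃ K, ∀ k ≥ K, g k a = b then h.choose else Classical.arbitrary B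

omit [Finite A] [MeasurableSpace A] [DiscreteMeasurableSpace A] [Finite B] [MeasurableSpace B]
  [DiscreteMeasurableSpace B] in
lemma limCode_eq [Nonempty B] {g : ℕ → (ℤ → A) → B} {a : ℤ → A} {b : B}
    (h : ∀ᶠ k in atTop, g k a = b) : limCode g a = b := by
  obtain ⟨K, hK⟩ := eventually_atTop.1 h
  have hex : ∃ b, ∃ K, ∀ k ≥ K, g k a = b := ⟨b, K, hK⟩
  obtain ⟨K', hK'⟩ := hex.choose_spec
  rw [limCode, dif_pos hex, ← hK' _ (le_max_left K' K), hK _ (le_max_right K' K)]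

omit [Finite A] [DiscreteMeasurableSpace A] [DiscreteMeasurableSpace B] in
lemma measurable_limCode [Nonempty B] {g : ℕ → (ℤ → A) → B} (hg : ∀ k, FMeas (g k)) :
    Measurable (limCode g) := by
  have hE : ∀ b, MeasurableSet {a | ∃ K, ∀ k ≥ K, g k a = b} := by
    intro b
    simp only [Set.ofPred_exists, Set.ofPred_forall]
    exact MeasurableSet.iUnion fun K => MeasurableSet.iInter fun k => MeasurableSet.iInter fun _ =>
      hg k {b}
  refine measurable_to_countable' fun b => ?_
  have : limCode g ⁻¹' {b} = {a | ∃ K, ∀ k ≥ K, g k a = b} ∪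
      ((⋃ b', {a | ∃ K, ∀ k ≥ K, g k a = b'})ᶜ ∩ {_a | Classical.arbitrary B = b}) := by
    ext a
    simp only [Set.mem_preimage, Set.mem_singleton_iff, Set.mem_union, Set.mem_inter_iff,
      Set.mem_compl_iff, Set.mem_iUnion, Set.mem_ofPred_eq]
    by_cases h : ∃ b', ∃ K, ∀ k ≥ K, g k a = b'
    · obtain ⟨b', K, hK⟩ := h
      have h1 : limCode g a = b' := limCode_eq (eventually_atTop.2 ⟨K, hK⟩)
      constructor
      · intro h2
        exact Or.inl ⟨K, h2 ▸ h1 ▸ hK⟩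
      · rintro (⟨K', hK'⟩ | h2)
        · exact limCode_eq (eventually_atTop.2 ⟨K', hK'⟩)
        · exact absurd ⟨b', K, hK⟩ h2.1
    · rw [limCode, dif_neg h]
      simp only [h, not_false_iff, true_and]
      exact ⟨Or.inr, fun h' => h'.resolve_left fun hb => h ⟨b, hb⟩⟩
  rw [this]
  exact (hE b).union ((MeasurableSet.iUnion hE).compl.inter (.const _))

omit [Finite B] in
/-- A process which is approximated by finite codes of another one is an equivariant function of
it. -/
lemma exists_factor_of_codes [Finite B] [Nonempty B] {D : Type} [MeasurableSpace D] {lam : Measure (ℤ → D)}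
    [IsProbabilityMeasure lam] (hst : Stat lam) {u : (ℤ → D) → ℤ → A} {v : (ℤ → D) → ℤ → B}
    (hu : ∀ z k, u (zShift k z) = zShift k (u z)) (hv : ∀ z k, v (zShift k z) = zShift k (v z))
    (hum : Measurable u) (hvm : Measurable v)
    (h : ∀ ε : ℝ, 0 < ε → ∃ (m : ℕ) (g : (ℤ → A) → B), Loc m g ∧
      lam.real {z | v z 0 ≠ g (u z)} < ε) :
    ∃ F : (ℤ → A) → ℤ → B, Measurable F ∧ (∀ a k, F (zShift k a) = zShift k (F a)) ∧
      ∀ᵐ z ∂lam, F (u z) = v z := by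
  choose m g hg hε using fun k : ℕ => h ((1 / 2) ^ k) (by positivity)
  have hlim := measurable_limCode fun k => (hg k).fMeas
  refine ⟨fun a n => limCode g (zShift n a), measurable_pi_lambda _ fun n =>
    hlim.comp (measurable_zShift n), fun a k => ?_, ?_⟩
  · funext n
    simp only [zShift_zShift]
    simp only [zShift]
  have hms : ∀ k, MeasurableSet {z | v z 0 ≠ g k (u z)} := by
    intro k
    have h1 : Measurable fun z => (v z 0, g k (u z)) :=
      ((measurable_pi_apply 0).comp hvm).prodMk (Measurable.comp (fun s _ => (hg k).fMeas s) hum)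
    exact h1 (MeasurableSet.of_discrete (s := {q : B × B | q.1 ≠ q.2}))
  have hall : ∀ n : ℤ, ∀ᵐ z ∂lam, limCode g (zShift n (u z)) = v z n := by
    intro n
    have hsum : ∑' k, lam (zShift n ⁻¹' {z | v z 0 ≠ g k (u z)}) ≠ ∞ := by
      simp only [hst.measure_preimage n (hms _)]
      have h2 : ∀ k, lam {z | v z 0 ≠ g k (u z)} ≤ ENNReal.ofReal ((1 / 2) ^ k) := fun k => by
        rw [← ofReal_measureReal]
        exact ENNReal.ofReal_le_ofReal (hε k).le
      refine ne_top_of_le_ne_top ?_ (ENNReal.tsum_le_tsum h2)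
      rw [← ENNReal.ofReal_tsum_of_nonneg (fun k => by positivity)
        (summable_geometric_of_lt_one (by norm_num) (by norm_num))]
      exact ENNReal.ofReal_ne_top
    filter_upwards [ae_eventually_notMem hsum] with z hz
    refine limCode_eq (hz.mono fun k hk => ?_)
    simp only [Set.mem_preimage, Set.mem_ofPred_eq, not_not, hu, hv] at hk
    rw [← hk]
    simp [zShift]
  filter_upwards [ae_all_iff.2 hall] with z hz
  exact funext hz

omit [Finite A] in
lemma measurableSet_fix [Finite A] {F : (ℤ → A) → ℤ → A} (hF : Measurable F) :
    MeasurableSet {y | F y = y} := by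
  simp only [funext_iff, Set.ofPred_forall]
  refine MeasurableSet.iInter fun n => ?_
  have h1 : Measurable fun y : ℤ → A => (F y n, y n) :=
    ((measurable_pi_apply n).comp hF).prodMk (measurable_pi_apply n)
  exact h1 (MeasurableSet.of_discrete (s := {q : A × A | q.1 = q.2}))

/-- If the two coordinates of a stationary joining are approximated by finite codes of each other,
then its marginals are isomorphic. -/
theorem isMeasIsoZ_of_codes [Nonempty A] [Nonempty B] {lam : Measure (ℤ → A × B)}
    [IsProbabilityMeasure lam] (hst : Stat lam)
    (hAB : ∀ ε : ℝ, 0 < ε → ∃ (m : ℕ) (f : (ℤ → B) → A), Loc m f ∧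
      lam.real {z | (z 0).1 ≠ f (prB z)} < ε)
    (hBA : ∀ ε : ℝ, 0 < ε → ∃ (m : ℕ) (g : (ℤ → A) → B), Loc m g ∧
      lam.real {z | (z 0).2 ≠ g (prA z)} < ε) :
    IsMeasIsoZ (lam.map prA) (lam.map prB) (zShift 1) (zShift 1) := by
  obtain ⟨F, hF, hFs, hFe⟩ := exists_factor_of_codes (u := prA) (v := prB) hst (fun _ _ => rfl)
    (fun _ _ => rfl) measurable_prA measurable_prB hBA
  obtain ⟨G, hG, hGs, hGe⟩ := exists_factor_of_codes (u := prB) (v := prA) hst (fun _ _ => rfl)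
    (fun _ _ => rfl) measurable_prB measurable_prA hAB
  refine ⟨F, G, hF, hG, ?_, ?_, ae_of_all _ fun y => hFs y 1, ?_, ?_⟩
  · rw [Measure.map_map hF measurable_prA]
    exact Measure.map_congr hFe
  · rw [Measure.map_map hG measurable_prB]
    exact Measure.map_congr hGe
  · refine (ae_map_iff measurable_prA.aemeasurable (measurableSet_fix (hG.comp hF))).2 ?_
    filter_upwards [hFe, hGe] with z h1 h2
    rw [Function.comp_apply, h1, h2]
  · refine (ae_map_iff measurable_prB.aemeasurable (measurableSet_fix (hF.comp hG))).2 ?_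
    filter_upwards [hFe, hGe] with z h1 h2
    rw [Function.comp_apply, h2, h1]

end Isomorphism

section CodedEntropy

variable {A B : Type} [Fintype A] [MeasurableSpace A] [DiscreteMeasurableSpace A]
  [Fintype B] [MeasurableSpace B] [DiscreteMeasurableSpace B]

omit [Fintype B] [DiscreteMeasurableSpace B] in
lemma Iid.isIIDZ [Nonempty B] {ν : Measure (ℤ → B)} [IsProbabilityMeasure ν] {p : B → ℝ} (hν : Iid ν p)
    (hp : ∀ b, 0 ≤ p b) : IsIIDZ ν fun b => ENNReal.ofReal (p b) := by
  intro F α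
  rw [← ENNReal.ofReal_prod_of_nonneg fun _ _ => hp _,
    ← hν.real_eq (e := fun n : F => (n : ℤ)) Subtype.val_injective α, ofReal_measureReal]

/-- A coordinate which is well coded by the other one has little more entropy. -/
lemma exists_hent_le_of_code (A : Type) [Fintype A] [MeasurableSpace A] [DiscreteMeasurableSpace A]
    (B : Type) [Fintype B] [MeasurableSpace B] [DiscreteMeasurableSpace B] {τ : ℝ} (hτ : 0 < τ) :
    ∃ ε > 0, ∀ (lam : Measure (ℤ → A × B)) [IsProbabilityMeasure lam], Stat lam →
      ((∃ (m : ℕ) (f : (ℤ → B) → A), Loc m f ∧ lam.real {z | (z 0).1 ≠ f (prB z)} < ε) →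
        hent lam Prod.fst ≤ hent lam Prod.snd + τ) ∧
      ((∃ (m : ℕ) (g : (ℤ → A) → B), Loc m g ∧ lam.real {z | (z 0).2 ≠ g (prA z)} < ε) →
        hent lam Prod.snd ≤ hent lam Prod.fst + τ) := by
  obtain ⟨ε₁, hε₁, h1⟩ := exists_partEnt_lt (Option A) hτ
  obtain ⟨ε₂, hε₂, h2⟩ := exists_partEnt_lt (Option B) hτ
  refine ⟨min ε₁ ε₂, lt_min hε₁ hε₂, fun lam _ hst => ⟨?_, ?_⟩⟩
  · rintro ⟨m, f, hf, hlt⟩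
    refine hst.hent_le_of_code Prod.fst Prod.snd hf (h1 lam ?_ none ?_).le
    · have h3 : FMeas fun z : ℤ → A × B => ((z 0).1, f (prB z)) :=
        (fMeas_coord Prod.fst 0).prod (loc_prB hf).fMeas
      exact h3.comp fun q => if q.1 = q.2 then none else some q.1
    · refine lt_of_le_of_lt (le_of_eq ?_) (hlt.trans_le (min_le_left _ _))
      congr 1
      ext z
      simp only [ne_eq, Set.mem_ofPred_eq, ite_eq_left_iff, reduceCtorEq, imp_false, not_not]
      rfl
  · rintro ⟨m, g, hg, hlt⟩
    refine hst.hent_le_of_code Prod.snd Prod.fst hg (h2 lam ?_ none ?_).le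
    · have h3 : FMeas fun z : ℤ → A × B => ((z 0).2, g (prA z)) :=
        (fMeas_coord Prod.snd 0).prod (loc_prA hg).fMeas
      exact h3.comp fun q => if q.1 = q.2 then none else some q.1
    · refine lt_of_le_of_lt (le_of_eq ?_) (hlt.trans_le (min_le_right _ _))
      congr 1
      ext z
      simp only [ne_eq, Set.mem_ofPred_eq, ite_eq_left_iff, reduceCtorEq, imp_false, not_not]
      rfl

lemma hent_snd_le [Nonempty B] {ν : Measure (ℤ → B)} {p : B → ℝ} (hν : Iid ν p)
    {lam : Measure (ℤ → A × B)} [IsProbabilityMeasure lam] (hst : Stat lam) (hB : lam.map prB = ν) :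
    hent lam Prod.snd ≤ ∑ b, Real.negMulLog (p b) := by
  have h1 := hst.hent_le (Prod.snd : A × B → B) one_ne_zero
  have h2 := hp_snd_le hν hB 1
  simp only [Nat.cast_one, div_one, one_mul] at h1 h2
  exact h1.trans h2

end CodedEntropy


section Distributions

variable {B : Type} [Fintype B]

lemma exists_iid [MeasurableSpace B] [DiscreteMeasurableSpace B] {p : B → ℝ} (hp : ∀ b, 0 ≤ p b)
    (hp1 : ∑ b, p b = 1) : ∃ ν : Measure (ℤ → B), IsProbabilityMeasure ν ∧ Iid ν p := by
  let P : Measure B := ∑ b, ENNReal.ofReal (p b) • Measure.dirac b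
  have hP : ∀ b, P {b} = ENNReal.ofReal (p b) := by
    intro b
    simp [P, Set.indicator_apply]
  have : IsProbabilityMeasure P := ⟨by
    simp only [P, Measure.coe_finsetSum, Finset.sum_apply, Measure.smul_apply, measure_univ,
      smul_eq_mul, mul_one]
    rw [← ENNReal.ofReal_sum_of_nonneg fun b _ => hp b, hp1, ENNReal.ofReal_one]⟩
  refine ⟨Measure.infinitePi fun _ => P, inferInstance, fun s a => ?_⟩
  have h : {x : ℤ → B | ∀ n ∈ s, x n = a n} = Set.pi s fun n => {a n} := by
    ext x; simp
  rw [h, Measure.real, Measure.infinitePi_pi _ fun _ _ => measurableSet_singleton _]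
  simp only [hP, ENNReal.toReal_prod, ENNReal.toReal_ofReal (hp _)]

lemma exists_distribution [Nonempty B] {c : ℝ} (hc : 0 < c) (hcl : c ≤ Real.log (Fintype.card B)) :
    ∃ p : B → ℝ, (∀ b, 0 < p b) ∧ ∑ b, p b = 1 ∧ ∑ b, Real.negMulLog (p b) = c := by
  set N : ℝ := (Fintype.card B : ℝ) with hN
  have hN0 : 0 < N := by rw [hN]; exact_mod_cast Fintype.card_pos
  let b₀ : B := Classical.arbitrary B
  let q : ℝ → B → ℝ := fun t b => (1 - t) * (if b = b₀ then 1 else 0) + t * N⁻¹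
  have hq : ContinuousOn (fun t => ∑ b, Real.negMulLog (q t b)) (Set.Icc 0 1) := by
    refine (continuous_finsetSum _ fun b _ => Real.continuous_negMulLog.comp ?_).continuousOn
    fun_prop
  have h0 : ∑ b, Real.negMulLog (q 0 b) = 0 := by
    refine Finset.sum_eq_zero fun b _ => ?_
    simp only [q]
    split_ifs <;> simp
  have h1 : ∑ b, Real.negMulLog (q 1 b) = Real.log N := by
    simp only [q, sub_self, zero_mul, zero_add, one_mul, Finset.sum_const, Finset.card_univ,
      nsmul_eq_mul, Real.negMulLog, Real.log_inv, ← hN]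
    field_simp
  obtain ⟨t, ht, htc⟩ := intermediate_value_Icc zero_le_one hq
    (show c ∈ Set.Icc _ _ by rw [h0, h1]; exact ⟨hc.le, hcl⟩)
  have ht0 : 0 < t := ht.1.lt_of_ne (by rintro rfl; simp only [h0] at htc; exact hc.ne htc)
  refine ⟨q t, fun b => ?_, ?_, htc⟩
  · have : 0 ≤ (1 - t) * (if b = b₀ then (1 : ℝ) else 0) :=
      mul_nonneg (by linarith [ht.2]) (by split_ifs <;> simp)
    have : 0 < t * N⁻¹ := by positivity
    simp only [q]
    linarith
  · simp only [q, Finset.sum_add_distrib, ← Finset.mul_sum, Finset.sum_const, Finset.card_univ,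
      nsmul_eq_mul, ← hN, Finset.sum_ite_eq', Finset.mem_univ, if_true]
    field_simp
    ring

lemma sum_negMulLog_prod {p : B → ℝ} (hp1 : ∑ b, p b = 1) (N : ℕ) :
    ∑ w : Fin N → B, Real.negMulLog (∏ i, p (w i)) = N * ∑ b, Real.negMulLog (p b) := by
  induction N with
  | zero => simp
  | succ N ih =>
    rw [sum_fin_cons]
    simp only [Fin.prod_univ_succ, Fin.cons_zero, Fin.cons_succ, Real.negMulLog_mul,
      Finset.sum_add_distrib, ← Finset.mul_sum, ← Finset.sum_mul, ih, sum_prod_pow_eq_one hp1]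
    rw [hp1]
    push_cast
    ring

variable {A : Type} [MeasurableSpace A] [MeasurableSpace B]

lemma hp_snd_eq [DiscreteMeasurableSpace B] [Nonempty B] {ν : Measure (ℤ → B)} {p : B → ℝ} (hp1 : ∑ b, p b = 1) (hν : Iid ν p)
    {lam : Measure (ℤ → A × B)} [IsProbabilityMeasure lam] (hB : lam.map prB = ν) (n : ℕ) :
    hp lam Prod.snd n = n * ∑ b, Real.negMulLog (p b) := by
  rw [← sum_negMulLog_prod hp1, hp, partEnt_eq]
  exact Finset.sum_congr rfl fun w _ => by rw [real_word_snd hν hB]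

lemma hp_id_eq [Nonempty B] {ν : Measure (ℤ → B)} {p : B → ℝ} (hp1 : ∑ b, p b = 1) (hν : Iid ν p)
    (n : ℕ) : hp ν id n = n * ∑ b, Real.negMulLog (p b) := by
  rw [← sum_negMulLog_prod hp1, hp, partEnt_eq]
  refine Finset.sum_congr rfl fun w _ => ?_
  rw [← hν.real_eq (e := fun i : Fin n => ((i : ℕ) : ℤ)) (fun i j h => Fin.ext (by simpa using h)) w]
  congr 2
  ext x
  simp [funext_iff]

end Distributions

section Mixtures

variable {D : Type} [MeasurableSpace D]

/-- The mixture of two measures with weights `1 - t` and `t`. -/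
noncomputable def mix (t : ℝ) (μ₀ μ₁ : Measure (ℤ → D)) : Measure (ℤ → D) :=
  ENNReal.ofReal (1 - t) • μ₀ + ENNReal.ofReal t • μ₁

variable {t : ℝ} {μ₀ μ₁ : Measure (ℤ → D)} [IsProbabilityMeasure μ₀] [IsProbabilityMeasure μ₁]

omit [IsProbabilityMeasure μ₀] [IsProbabilityMeasure μ₁] in
lemma map_mix {E : Type} [MeasurableSpace E] {φ : (ℤ → D) → ℤ → E} (hφ : Measurable φ) :
    (mix t μ₀ μ₁).map φ = mix t (μ₀.map φ) (μ₁.map φ) := by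
  rw [mix, Measure.map_add _ _ hφ, Measure.map_smul, Measure.map_smul, mix]

omit [IsProbabilityMeasure μ₀] [IsProbabilityMeasure μ₁] in
lemma mix_self (h0 : 0 ≤ t) (h1 : t ≤ 1) : mix t μ₀ μ₀ = μ₀ := by
  rw [mix, ← add_smul, ← ENNReal.ofReal_add (by linarith) h0]
  simp

omit [IsProbabilityMeasure μ₀] [IsProbabilityMeasure μ₁] in
lemma Stat.mix (hs0 : Stat μ₀) (hs1 : Stat μ₁) : Stat (mix t μ₀ μ₁) := by
  rw [Stat, map_mix (measurable_zShift 1), hs0, hs1]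

lemma isProbabilityMeasure_mix (h0 : 0 ≤ t) (h1 : t ≤ 1) : IsProbabilityMeasure (mix t μ₀ μ₁) := by
  refine ⟨?_⟩
  simp only [mix, Measure.add_apply, Measure.smul_apply, measure_univ, smul_eq_mul, mul_one]
  rw [← ENNReal.ofReal_add (by linarith) h0]
  simp

lemma real_mix (h0 : 0 ≤ t) (h1 : t ≤ 1) (s : Set (ℤ → D)) :
    (mix t μ₀ μ₁).real s = (1 - t) * μ₀.real s + t * μ₁.real s := by
  simp only [mix, Measure.real, Measure.add_apply, Measure.smul_apply, smul_eq_mul]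
  rw [ENNReal.toReal_add (ENNReal.mul_ne_top ENNReal.ofReal_ne_top (measure_ne_top _ _))
    (ENNReal.mul_ne_top ENNReal.ofReal_ne_top (measure_ne_top _ _)), ENNReal.toReal_mul,
    ENNReal.toReal_mul, ENNReal.toReal_ofReal (by linarith), ENNReal.toReal_ofReal h0]

lemma hp_mix_ge {W : Type} [Fintype W] (h0 : 0 ≤ t) (h1 : t ≤ 1) (π : D → W) (n : ℕ) :
    (1 - t) * hp μ₀ π n + t * hp μ₁ π n ≤ hp (mix t μ₀ μ₁) π n := by
  simp only [hp, partEnt_eq, Finset.mul_sum]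
  rw [← Finset.sum_add_distrib]
  refine Finset.sum_le_sum fun w _ => ?_
  rw [real_mix h0 h1]
  exact Real.concaveOn_negMulLog.2 measureReal_nonneg measureReal_nonneg (by linarith) h0 (by ring)

lemma abs_real_mix_sub_le (h0 : 0 ≤ t) (h1 : t ≤ 1) (s : Set (ℤ → D)) :
    |(mix t μ₀ μ₁).real s - μ₀.real s| ≤ t := by
  rw [real_mix h0 h1, show (1 - t) * μ₀.real s + t * μ₁.real s - μ₀.real s =
    t * (μ₁.real s - μ₀.real s) by ring, abs_mul, abs_of_nonneg h0]
  refine mul_le_of_le_one_right h0 (abs_le.2 ⟨?_, ?_⟩) <;>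
  linarith [measureReal_le_one (μ := μ₀) (s := s), measureReal_le_one (μ := μ₁) (s := s),
    measureReal_nonneg (μ := μ₀) (s := s), measureReal_nonneg (μ := μ₁) (s := s)]

end Mixtures


section CodedJoinings

/-- The first coordinate of a joining is coded by the second one up to error `ε`. -/
def CodesFst {A B : Type} [MeasurableSpace A] [MeasurableSpace B] (lam : Measure (ℤ → A × B))
    (ε : ℝ) : Prop :=
  ∃ (m : ℕ) (f : (ℤ → B) → A), Loc m f ∧ lam.real {z | (z 0).1 ≠ f (prB z)} < ε

/-- The second coordinate of a joining is coded by the first one up to error `ε`. -/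
def CodesSnd {A B : Type} [MeasurableSpace A] [MeasurableSpace B] (lam : Measure (ℤ → A × B))
    (ε : ℝ) : Prop :=
  ∃ (m : ℕ) (g : (ℤ → A) → B), Loc m g ∧ lam.real {z | (z 0).2 ≠ g (prA z)} < ε

lemma abs_sub_le_card_mul {ι : Type} [Fintype ι] {u v : ι → ℝ} (hu : ∑ i, u i = 1)
    (hv : ∑ i, v i = 1) {θ : ℝ} (hθ : 0 ≤ θ) (h : ∀ i, u i - θ ≤ v i) (i : ι) :
    |v i - u i| ≤ Fintype.card ι * θ := by
  have h1 : ∑ j ∈ Finset.univ.erase i, (u j - v j) ≤ (Fintype.card ι - 1 : ℝ) * θ := by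
    refine (Finset.sum_le_card_nsmul _ _ θ fun j _ => by linarith [h j]).trans (le_of_eq ?_)
    rw [Finset.card_erase_of_mem (Finset.mem_univ i), Finset.card_univ, nsmul_eq_mul,
      Nat.cast_sub (Fintype.card_pos_iff.2 ⟨i⟩), Nat.cast_one]
  have h2 : ∑ j, (u j - v j) = 0 := by rw [Finset.sum_sub_distrib, hu, hv, sub_self]
  rw [← Finset.add_sum_erase _ _ (Finset.mem_univ i)] at h2
  have h3 : (1 : ℝ) ≤ Fintype.card ι := by exact_mod_cast Fintype.card_pos_iff.2 ⟨i⟩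
  rw [abs_le]
  constructor
  · nlinarith [h i]
  · nlinarith [h i]

variable {A B : Type} [Fintype A] [MeasurableSpace A] [DiscreteMeasurableSpace A]
  [Fintype B] [MeasurableSpace B] [DiscreteMeasurableSpace B]

/-- Joinings whose coordinates code each other are dense among the joinings of large entropy. -/
theorem exists_coded_joining [Nonempty B] {ν : Measure (ℤ → B)} [IsProbabilityMeasure ν]
    {p : B → ℝ} (hν : Iid ν p) (hp0 : ∀ b, 0 < p b) (hp1 : ∑ b, p b = 1) {b₁ : B} (hb₁ : p b₁ < 1)
    {a₀ a₁ : A} (ha : a₀ ≠ a₁) {c : ℝ} (hpc : ∑ b, Real.negMulLog (p b) = c)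
    (hc : c < Real.log (Fintype.card A)) {lam : Measure (ℤ → A × B)} [IsProbabilityMeasure lam]
    (hst : Stat lam) (hB : lam.map prB = ν) (hlc : ∀ n : ℕ, n * c ≤ hp lam Prod.fst n) (k : ℕ)
    {δ ε : ℝ} (hδ : 0 < δ) (hε : 0 < ε) :
    ∃ lam' : Measure (ℤ → A × B), IsProbabilityMeasure lam' ∧ Stat lam' ∧ lam'.map prB = ν ∧
      (∀ n : ℕ, n * c ≤ hp lam' Prod.fst n) ∧ CodesFst lam' ε ∧ CodesSnd lam' ε ∧
      ∀ γ, |lam'.real (win k ⁻¹' {γ}) - lam.real (win k ⁻¹' {γ})| < δ := by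
  have hA : Nonempty A := ⟨a₀⟩
  set l := Real.log (Fintype.card A) with hl
  have hcard : (0 : ℝ) < Fintype.card A := by exact_mod_cast Fintype.card_pos
  have hu1 : ∑ _a : A, (Fintype.card A : ℝ)⁻¹ = 1 := by
    rw [Finset.sum_const, Finset.card_univ, nsmul_eq_mul]; field_simp
  obtain ⟨υ, hυP, hυ⟩ := exists_iid (p := fun _ : A => (Fintype.card A : ℝ)⁻¹)
    (fun _ => by positivity) hu1
  obtain ⟨lu, hluP, hlus, hluA, hluB⟩ := exists_joining hυ.stat hν.stat
  have hluH : ∀ n : ℕ, hp lu Prod.fst n = n * l := by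
    intro n
    rw [← hp_map_prA, hluA, hp_id_eq hu1 hυ, hl]
    simp only [Real.negMulLog, Real.log_inv, Finset.sum_const, Finset.card_univ, nsmul_eq_mul]
    field_simp
  set η := min (δ / 4) (min (ε / 2) (1 / 2)) with hη
  have hη0 : 0 < η := by positivity
  have hη1 : η ≤ 1 := (min_le_right _ _).trans ((min_le_right _ _).trans (by norm_num))
  have hηε : η ≤ ε / 2 := (min_le_right _ _).trans (min_le_left _ _)
  have hηδ : η ≤ δ / 4 := min_le_left _ _
  have hτ : 0 < η * (l - c) := mul_pos hη0 (by linarith)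
  obtain ⟨ε', hε', hcode⟩ := exists_hent_le_of_code A B hτ
  set M : ℝ := (Fintype.card (Fin (2 * k + 1) → A × B) : ℝ) with hM
  have hM0 : 0 < M := by rw [hM]; exact_mod_cast Fintype.card_pos
  set θ := min (min 1 ε') (min (ε / 2) (δ / (4 * M))) with hθ
  have hθ0 : 0 < θ := by positivity
  have hθε : θ ≤ ε / 2 := (min_le_right _ _).trans (min_le_left _ _)
  have hθM : M * θ ≤ δ / 4 := by
    have : θ ≤ δ / (4 * M) := (min_le_right _ _).trans (min_le_right _ _)
    calc M * θ ≤ M * (δ / (4 * M)) := by gcongr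
      _ = δ / 4 := by field_simp
  have hPm : IsProbabilityMeasure (mix η lam lu) := isProbabilityMeasure_mix hη0.le hη1
  obtain ⟨φ, m, hφ, ⟨m', g, hg, hgθ⟩, hcell⟩ := exists_block_code (lam := mix η lam lu) hν hp0 hp1 hb₁ ha
    (hst.mix hlus) (by rw [map_mix measurable_prB, hB, hluB, mix_self hη0.le hη1]) hτ (fun n => by
      refine le_trans (le_of_eq ?_) ((add_le_add (mul_le_mul_of_nonneg_left (hlc n)
        (by linarith)) (le_of_eq rfl)).trans (hp_mix_ge hη0.le hη1 Prod.fst n))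
      rw [hluH, hpc]; ring) k hθ0 ((min_le_left _ _).trans (min_le_left _ _))
  have hjm := measurable_joinMap hφ
  set l₁ := ν.map (joinMap φ) with hl₁
  have hl₁P : IsProbabilityMeasure l₁ := Measure.isProbabilityMeasure_map hjm.aemeasurable
  have hl₁s : Stat l₁ := hν.stat.map_joinMap hφ
  have hl₁B : l₁.map prB = ν := by
    rw [hl₁, Measure.map_map measurable_prB hjm]
    exact Measure.map_id
  have hfst : l₁.real {z | (z 0).1 ≠ φ (prB z)} = 0 := by
    rw [hl₁, map_measureReal_apply hjm (measurableSet_mismatch hφ)]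
    convert measureReal_empty
    ext x
    simp only [Set.mem_preimage, Set.mem_ofPred_eq, Set.mem_empty_iff_false, prB_joinMap, joinMap,
      zShift_zero, ne_eq, not_true]
  have hsnd : c ≤ hent l₁ Prod.snd := hl₁s.le_hent (K := 0) Prod.snd fun n => by
    rw [hp_snd_eq hp1 hν hl₁B, hpc, add_zero]
  have hent1 : c - η * (l - c) ≤ hent l₁ Prod.fst := by
    have := (hcode l₁ hl₁s).2 ⟨m', g, hg, hgθ.trans_le ((min_le_left _ _).trans (min_le_right _ _))⟩
    linarith
  refine ⟨mix η l₁ lu, isProbabilityMeasure_mix hη0.le hη1, hl₁s.mix hlus, ?_, fun n => ?_,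
    ⟨m, φ, hφ, ?_⟩, ⟨m', g, hg, ?_⟩, fun γ => ?_⟩
  · rw [map_mix measurable_prB, hl₁B, hluB, mix_self hη0.le hη1]
  · refine le_trans ?_ (hp_mix_ge hη0.le hη1 Prod.fst n)
    rw [hluH]
    have h1 := hl₁s.mul_hent_le (Prod.fst : A × B → A) n
    have h2 : n * (c - η * (l - c)) ≤ hp l₁ Prod.fst n :=
      (mul_le_mul_of_nonneg_left hent1 (Nat.cast_nonneg n)).trans h1
    have h3 := mul_le_mul_of_nonneg_left h2 (sub_nonneg.2 hη1)
    have h4 : 0 ≤ (n : ℝ) * (η * (η * (l - c))) := by positivity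
    linarith
  · rw [real_mix hη0.le hη1, hfst]
    have := mul_le_of_le_one_right hη0.le (measureReal_le_one (μ := lu) (s := {z | (z 0).1 ≠ φ (prB z)}))
    linarith
  · rw [real_mix hη0.le hη1]
    have h1 := mul_le_of_le_one_right hη0.le (measureReal_le_one (μ := lu) (s := {z | (z 0).2 ≠ g (prA z)}))
    have h2 := mul_le_of_le_one_left (measureReal_nonneg (μ := l₁) (s := {z | (z 0).2 ≠ g (prA z)}))
      (show 1 - η ≤ 1 by linarith)
    linarith
  · have h1 := abs_real_mix_sub_le (μ₀ := l₁) (μ₁ := lu) hη0.le hη1 (win k ⁻¹' {γ})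
    have h2 := abs_real_mix_sub_le (μ₀ := lam) (μ₁ := lu) hη0.le hη1 (win k ⁻¹' {γ})
    have h3 := abs_sub_le_card_mul (sum_real_fiber_univ (mix η lam lu) (fMeas_win k))
      (sum_real_fiber_univ l₁ (fMeas_win k)) hθ0.le hcell γ
    rw [abs_le] at h1 h2 h3
    rw [abs_lt]
    constructor <;> linarith [h1.1, h1.2, h2.1, h2.2, h3.1, h3.2]

end CodedJoinings


section Extension

/-- A coupling of the law of a finite-valued map with another finite law is realised on an
extension of the space. -/
lemma exists_extension {Ω W V : Type} [MeasurableSpace Ω] (μ : Measure Ω) [IsProbabilityMeasure μ]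
    [Fintype W] [Fintype V] [MeasurableSpace V] [DiscreteMeasurableSpace V] {R : Ω → W}
    (hR : FMeas R) {ξ : W → V → ℝ} (h0 : ∀ w v, 0 ≤ ξ w v)
    (hξ : ∀ w, ∑ v, ξ w v = μ.real (R ⁻¹' {w})) :
    ∃ ρ : Measure (Ω × V), IsProbabilityMeasure ρ ∧ ρ.map Prod.fst = μ ∧
      ∀ P : W → V → Prop, MeasurableSet {q : Ω × V | P (R q.1) q.2} ∧
        ρ.real {q | P (R q.1) q.2} = ∑ w, ∑ v, if P w v then ξ w v else 0 := by
  have hm : ∀ v : V, Measurable fun ω : Ω => (ω, v) := fun v => measurable_prodMk_right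
  let ρ : Measure (Ω × V) := ∑ w, ∑ v, ENNReal.ofReal (ξ w v / μ.real (R ⁻¹' {w})) •
    (μ.restrict (R ⁻¹' {w})).map fun ω => (ω, v)
  have hfst : ρ.map Prod.fst = μ := by
    ext t ht
    have h1 : ∀ w, ∑ v, ENNReal.ofReal (ξ w v / μ.real (R ⁻¹' {w})) * μ (t ∩ R ⁻¹' {w}) =
        μ (t ∩ R ⁻¹' {w}) := by
      intro w
      by_cases hw : μ.real (R ⁻¹' {w}) = 0
      · have : μ (t ∩ R ⁻¹' {w}) = 0 :=
          measure_mono_null Set.inter_subset_right ((measureReal_eq_zero_iff).1 hw)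
        simp [this]
      · rw [← Finset.sum_mul, ← ENNReal.ofReal_sum_of_nonneg
          fun v _ => div_nonneg (h0 w v) measureReal_nonneg, ← Finset.sum_div, hξ, div_self hw,
          ENNReal.ofReal_one, one_mul]
    have h2 : ∀ (w : W) (v : V), (Measure.map (fun ω => (ω, v)) (μ.restrict (R ⁻¹' {w}))) (Prod.fst ⁻¹' t) =
        μ (t ∩ R ⁻¹' {w}) := by
      intro w v
      rw [Measure.map_apply (hm v) (measurable_fst ht)]
      exact Measure.restrict_apply ht
    rw [Measure.map_apply measurable_fst ht]
    simp only [ρ, Measure.coe_finsetSum, Finset.sum_apply, Measure.smul_apply, smul_eq_mul, h2, h1]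
    rw [← measure_biUnion_finset]
    · congr 1
      ext ω
      simp
    · intro i _ j _ hij
      exact Set.disjoint_left.2 fun ω hi hj => hij (hi.2.symm.trans hj.2)
    · exact fun w _ => ht.inter (hR {w})
  have hP : IsProbabilityMeasure ρ := ⟨by
    have h := congrArg (fun m : Measure Ω => m Set.univ) hfst
    simpa [Measure.map_apply measurable_fst MeasurableSet.univ] using h⟩
  refine ⟨ρ, hP, hfst, fun P => ?_⟩
  have hmeas : MeasurableSet {q : Ω × V | P (R q.1) q.2} := by
    have : {q : Ω × V | P (R q.1) q.2} = ⋃ v, (R ⁻¹' {w | P w v}) ×ˢ {v} := by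
      ext q; simp
    rw [this]
    exact MeasurableSet.iUnion fun v => (hR _).prod (measurableSet_singleton v)
  refine ⟨hmeas, ?_⟩
  have h1 : ρ {q | P (R q.1) q.2} = ∑ w, ∑ v, ENNReal.ofReal (if P w v then ξ w v else 0) := by
    simp only [ρ, Measure.coe_finsetSum, Finset.sum_apply, Measure.smul_apply, smul_eq_mul]
    refine Finset.sum_congr rfl fun w _ => Finset.sum_congr rfl fun v _ => ?_
    rw [Measure.map_apply (hm v) hmeas, Measure.restrict_apply (hm v hmeas)]
    by_cases h : P w v
    · have : (fun ω => (ω, v)) ⁻¹' {q : Ω × V | P (R q.1) q.2} ∩ R ⁻¹' {w} = R ⁻¹' {w} := by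
        refine Set.inter_eq_right.2 fun ω hω => ?_
        rw [Set.mem_preimage, Set.mem_ofPred_eq, show R ω = w from hω]
        exact h
      rw [this, if_pos h, ← ofReal_measureReal, ← ENNReal.ofReal_mul
        (div_nonneg (h0 w v) measureReal_nonneg)]
      congr 1
      by_cases hw : μ.real (R ⁻¹' {w}) = 0
      · have h2 : ξ w v ≤ 0 := by
          rw [← hw, ← hξ]
          exact Finset.single_le_sum (fun v _ => h0 w v) (Finset.mem_univ v)
        rw [hw, mul_zero, le_antisymm h2 (h0 w v)]
      · field_simp
    · have : (fun ω => (ω, v)) ⁻¹' {q : Ω × V | P (R q.1) q.2} ∩ R ⁻¹' {w} = ∅ := by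
        refine Set.eq_empty_of_forall_notMem fun ω hω => h ?_
        have h3 := hω.1
        rwa [Set.mem_preimage, Set.mem_ofPred_eq, show R ω = w from hω.2] at h3
      rw [this, if_neg h]
      simp
  have hnn : ∀ w v, 0 ≤ if P w v then ξ w v else 0 := fun w v => by
    split_ifs
    exacts [h0 w v, le_rfl]
  rw [Measure.real, h1]
  simp only [← ENNReal.ofReal_sum_of_nonneg fun v _ => hnn _ v]
  rw [← ENNReal.ofReal_sum_of_nonneg fun w _ => Finset.sum_nonneg fun v _ => hnn w v,
    ENNReal.toReal_ofReal (Finset.sum_nonneg fun w _ => Finset.sum_nonneg fun v _ => hnn w v)]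

end Extension

section Averages

variable {D : Type} [MeasurableSpace D]

/-- The average of the first `n` translates of a measure. -/
noncomputable def cesaro (n : ℕ) (ρ : Measure (ℤ → D)) : Measure (ℤ → D) :=
  ∑ j ∈ Finset.range n, ENNReal.ofReal (n : ℝ)⁻¹ • ρ.map (zShift (j : ℤ))

variable {ρ : Measure (ℤ → D)} [IsProbabilityMeasure ρ] {n : ℕ}

lemma cesaro_real {s : Set (ℤ → D)} (hs : MeasurableSet s) :
    (cesaro n ρ).real s = (∑ j ∈ Finset.range n, ρ.real (zShift (j : ℤ) ⁻¹' s)) / n := by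
  rw [Measure.real, cesaro]
  simp only [Measure.coe_finsetSum, Finset.sum_apply, Measure.smul_apply, smul_eq_mul,
    Measure.map_apply (measurable_zShift _) hs]
  rw [ENNReal.toReal_sum fun j _ => ENNReal.mul_ne_top ENNReal.ofReal_ne_top (measure_ne_top _ _),
    Finset.sum_div]
  refine Finset.sum_congr rfl fun j _ => ?_
  rw [ENNReal.toReal_mul, ENNReal.toReal_ofReal (by positivity), Measure.real]
  ring

omit [IsProbabilityMeasure ρ] in
lemma map_cesaro {E : Type} [MeasurableSpace E] {φ : (ℤ → D) → ℤ → E} (hφ : Measurable φ)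
    (h : ∀ z k, φ (zShift k z) = zShift k (φ z)) : (cesaro n ρ).map φ = cesaro n (ρ.map φ) := by
  rw [cesaro, Measure.map_finset_sum hφ.aemeasurable]
  refine Finset.sum_congr rfl fun j _ => ?_
  rw [Measure.map_smul, Measure.map_map hφ (measurable_zShift _),
    Measure.map_map (measurable_zShift _) hφ]
  congr 2
  funext z
  exact h z j

omit [IsProbabilityMeasure ρ] in
lemma Stat.cesaro_eq (h : Stat ρ) (hn : 0 < n) : cesaro n ρ = ρ := by
  simp only [cesaro, h.map_zShift, Finset.sum_const, Finset.card_range]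
  rw [← Nat.cast_smul_eq_nsmul ℝ≥0∞, smul_smul, ← ENNReal.ofReal_natCast,
    ← ENNReal.ofReal_mul (Nat.cast_nonneg n), mul_inv_cancel₀ (by positivity), ENNReal.ofReal_one,
    one_smul]

lemma isProbabilityMeasure_cesaro (hn : 0 < n) : IsProbabilityMeasure (cesaro n ρ) := by
  refine ⟨?_⟩
  simp only [cesaro, Measure.coe_finsetSum, Finset.sum_apply, Measure.smul_apply, smul_eq_mul,
    Measure.map_apply (measurable_zShift _) MeasurableSet.univ, Set.preimage_univ, measure_univ,
    mul_one, Finset.sum_const, Finset.card_range]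
  rw [nsmul_eq_mul, ← ENNReal.ofReal_natCast, ← ENNReal.ofReal_mul (Nat.cast_nonneg n),
    mul_inv_cancel₀ (by positivity), ENNReal.ofReal_one]

lemma abs_cesaro_shift_sub_le {s : Set (ℤ → D)} (hs : MeasurableSet s) :
    |(cesaro n ρ).real (zShift 1 ⁻¹' s) - (cesaro n ρ).real s| ≤ 1 / n := by
  rw [cesaro_real (measurable_zShift 1 hs), cesaro_real hs, ← sub_div, abs_div, Nat.abs_cast]
  refine div_le_div_of_nonneg_right ?_ (Nat.cast_nonneg n)
  rw [← Finset.sum_sub_distrib]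
  have h1 : ∀ j : ℕ, (zShift (j : ℤ) ⁻¹' (zShift 1 ⁻¹' s) : Set (ℤ → D)) =
      zShift ((j + 1 : ℕ) : ℤ) ⁻¹' s := by
    intro j
    ext z
    simp only [Set.mem_preimage, zShift_zShift]
    push_cast
    rw [add_comm]
  simp only [h1]
  rw [Finset.sum_range_sub fun j : ℕ => ρ.real (zShift (j : ℤ) ⁻¹' s), abs_le]
  constructor <;>
  linarith [measureReal_nonneg (μ := ρ) (s := zShift (n : ℤ) ⁻¹' s),
    measureReal_nonneg (μ := ρ) (s := zShift ((0 : ℕ) : ℤ) ⁻¹' s),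
    measureReal_le_one (μ := ρ) (s := zShift (n : ℤ) ⁻¹' s),
    measureReal_le_one (μ := ρ) (s := zShift ((0 : ℕ) : ℤ) ⁻¹' s)]

/-- If the inner translates of an event have the right mass, then so does its average, up to
boundary terms. -/
lemma abs_cesaro_sub_le {s : Set (ℤ → D)} (hs : MeasurableSet s) (hn : 0 < n) {K : ℕ} {v : ℝ}
    (hv0 : 0 ≤ v) (hv1 : v ≤ 1)
    (h : ∀ j : ℕ, K ≤ j → j + K < n → ρ.real (zShift (j : ℤ) ⁻¹' s) = v) :
    |(cesaro n ρ).real s - v| ≤ 2 * K / n := by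
  have hn' : (n : ℝ) ≠ 0 := by positivity
  rw [cesaro_real hs, show v = (∑ _j ∈ Finset.range n, v) / n by
    rw [Finset.sum_const, Finset.card_range, nsmul_eq_mul]; field_simp, ← sub_div, abs_div,
    Nat.abs_cast]
  refine div_le_div_of_nonneg_right ?_ (Nat.cast_nonneg n)
  rw [← Finset.sum_sub_distrib]
  have h1 : ∀ j ∈ Finset.range n, |ρ.real (zShift (j : ℤ) ⁻¹' s) - v| ≤
      if j ∈ Finset.range K ∪ Finset.Ico (n - K) n then 1 else 0 := by
    intro j hj
    split_ifs with hjb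
    · rw [abs_le]
      constructor <;> linarith [measureReal_nonneg (μ := ρ) (s := zShift (j : ℤ) ⁻¹' s),
        measureReal_le_one (μ := ρ) (s := zShift (j : ℤ) ⁻¹' s)]
    · simp only [Finset.mem_union, Finset.mem_range, Finset.mem_Ico] at hjb hj
      rw [h j (by omega) (by omega), sub_self, abs_zero]
  refine (Finset.abs_sum_le_sum_abs _ _).trans ((Finset.sum_le_sum h1).trans ?_)
  rw [Finset.sum_ite_mem, Finset.sum_const, nsmul_eq_mul, mul_one]
  have h2 : (Finset.range n ∩ (Finset.range K ∪ Finset.Ico (n - K) n)).card ≤ K + K := by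
    refine (Finset.card_le_card Finset.inter_subset_right).trans
      ((Finset.card_union_le _ _).trans ?_)
    rw [Finset.card_range, Nat.card_Ico]
    omega
  calc ((Finset.range n ∩ (Finset.range K ∪ Finset.Ico (n - K) n)).card : ℝ)
      ≤ ((K + K : ℕ) : ℝ) := by exact_mod_cast h2
    _ = 2 * K := by push_cast; ring

end Averages


section ApproximateJoinings

/-- Extension of a finite word by a constant. -/
noncomputable def extWord {B : Type} [Nonempty B] {n : ℕ} (v : Fin n → B) (i : ℤ) : B :=
  if h : 0 ≤ i ∧ i < n then v ⟨i.toNat, by omega⟩ else Classical.arbitrary B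

lemma extWord_coe {B : Type} [Nonempty B] {n : ℕ} (v : Fin n → B) (i : Fin n) :
    extWord v (i : ℤ) = v i := by
  rw [extWord, dif_pos ⟨by omega, by omega⟩]
  congr 1

lemma extWord_restrict {B : Type} [Nonempty B] {n : ℕ} (x : ℤ → B) {i : ℤ} (h : 0 ≤ i ∧ i < n) :
    extWord (fun j : Fin n => x j) i = x i := by
  rw [extWord, dif_pos h]
  congr 1
  simp [h.1]

variable {A B : Type} [Fintype A] [MeasurableSpace A] [DiscreteMeasurableSpace A]
  [Fintype B] [MeasurableSpace B] [DiscreteMeasurableSpace B]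

/-- The word of length `n` coded by `g`. -/
def codedWord (g : (ℤ → A) → B) (n : ℕ) (a : ℤ → A) : Fin n → B := fun i => g (zShift (i : ℤ) a)

omit [Fintype B] [MeasurableSpace B] [DiscreteMeasurableSpace B] in
lemma fMeas_codedWord [Finite B] {m : ℕ} {g : (ℤ → A) → B} (hg : Loc m g) (n : ℕ) :
    FMeas (codedWord g n) :=
  FMeas.pi fun i s => measurable_zShift (i : ℤ) (hg.fMeas s)

/-- An almost stationary joining built from a coupling of words. -/
lemma exists_approx_joining [Nonempty B] {ν : Measure (ℤ → B)} [IsProbabilityMeasure ν]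
    {p : B → ℝ} (hν : Iid ν p) {μ : Measure (ℤ → A)} [IsProbabilityMeasure μ] (hμ : Stat μ)
    {m : ℕ} {g : (ℤ → A) → B} (hg : Loc m g) {n : ℕ} (hn : 0 < n)
    {ξ : (Fin n → B) → (Fin n → B) → ℝ} (h0 : ∀ w v, 0 ≤ ξ w v)
    (hξ : ∀ w, ∑ v, ξ w v = μ.real (codedWord g n ⁻¹' {w})) (hξ' : ∀ v, ∑ w, ξ w v = ∏ i, p (v i))
    {δ : ℝ} (hδ : ∑ w, ∑ v, ξ w v * mism w v ≤ n * δ) :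
    ∃ lam : Measure (ℤ → A × B), IsProbabilityMeasure lam ∧ lam.map prA = μ ∧
      (∀ s, MeasurableSet s → |lam.real (zShift 1 ⁻¹' s) - lam.real s| ≤ 1 / n) ∧
      (∀ (K : ℕ) (b : Fin (2 * K + 1) → B),
        |lam.real (prB ⁻¹' (win K ⁻¹' {b})) - ν.real (win K ⁻¹' {b})| ≤ 2 * K / n) ∧
      lam.real {z | (z 0).2 ≠ g (prA z)} ≤ δ := by
  obtain ⟨ρ, hρP, hρfst, hρ⟩ := exists_extension μ (fMeas_codedWord hg n) h0 hξ
  let glue : (ℤ → A) × (Fin n → B) → ℤ → A × B := fun q i => (q.1 i, extWord q.2 i)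
  have hglue : Measurable glue := measurable_pi_lambda _ fun i =>
    ((measurable_pi_apply i).comp measurable_fst).prodMk
      ((Measurable.of_discrete (f := fun v : Fin n → B => extWord v i)).comp measurable_snd)
  have hPP : IsProbabilityMeasure (ρ.map glue) := Measure.isProbabilityMeasure_map hglue.aemeasurable
  have hA : (ρ.map glue).map prA = μ := by
    rw [Measure.map_map measurable_prA hglue, ← hρfst]
    rfl
  refine ⟨cesaro n (ρ.map glue), isProbabilityMeasure_cesaro hn, ?_,
    fun s hs => abs_cesaro_shift_sub_le hs, fun K b => ?_, ?_⟩
  · rw [map_cesaro measurable_prA fun _ _ => rfl, hA, hμ.cesaro_eq hn]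
  · have hs : MeasurableSet (win K ⁻¹' {b} : Set (ℤ → B)) := fMeas_win K {b}
    refine abs_cesaro_sub_le (measurable_prB hs) hn measureReal_nonneg measureReal_le_one
      fun j h1 h2 => ?_
    rw [map_measureReal_apply hglue (measurable_zShift _ (measurable_prB hs))]
    have e1 : glue ⁻¹' (zShift (j : ℤ) ⁻¹' (prB ⁻¹' (win K ⁻¹' {b}))) =
        {q : (ℤ → A) × (Fin n → B) | win K (zShift (j : ℤ) (extWord q.2)) = b} := rfl
    have e2 : (zShift (j : ℤ) ⁻¹' (win K ⁻¹' {b}) : Set (ℤ → B)) =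
        (fun x (i : Fin n) => x (i : ℤ)) ⁻¹'
          {v : Fin n → B | win K (zShift (j : ℤ) (extWord v)) = b} := by
      ext x
      have : win K (zShift (j : ℤ) (extWord fun i : Fin n => x i)) = win K (zShift (j : ℤ) x) := by
        funext i
        simp only [win, zShift]
        exact extWord_restrict x ⟨by omega, by omega⟩
      simp only [Set.mem_preimage, Set.mem_singleton_iff, Set.mem_ofPred_eq, this]
    have hF : FMeas fun (x : ℤ → B) (i : Fin n) => x (i : ℤ) := by
      simpa using fMeas_block (D := B) id n 0
    rw [e1, (hρ fun _ v => win K (zShift (j : ℤ) (extWord v)) = b).2, ← hν.stat.real_preimage j hs,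
      e2, ← sum_real_fiber ν hF, Finset.sum_comm, Finset.sum_filter]
    refine Finset.sum_congr rfl fun v _ => ?_
    simp only [Set.mem_ofPred_eq]
    have e3 : ν.real ((fun (x : ℤ → B) (i : Fin n) => x (i : ℤ)) ⁻¹' {v}) = ∏ i, p (v i) := by
      rw [← hν.real_eq (e := fun i : Fin n => ((i : ℕ) : ℤ)) (fun i j h => Fin.ext (by simpa using h)) v]
      congr 1
      ext x
      simp [funext_iff]
    split_ifs
    · rw [hξ', e3]
    · simp
  · have hs := measurableSet_mismatch' (A := A) (B := B) hg
    rw [cesaro_real hs, div_le_iff₀ (by exact_mod_cast hn), mul_comm]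
    refine le_trans (le_of_eq ?_) hδ
    rw [Finset.sum_range]
    have e1 : ∀ j : Fin n, (ρ.map glue).real (zShift ((j : ℕ) : ℤ) ⁻¹' {z | (z 0).2 ≠ g (prA z)}) =
        ∑ w, ∑ v, if w j ≠ v j then ξ w v else 0 := by
      intro j
      rw [map_measureReal_apply hglue (measurable_zShift _ hs)]
      refine Eq.trans ?_ ((hρ fun w v => w j ≠ v j).2.trans
        (Finset.sum_congr rfl fun w _ => Finset.sum_congr rfl fun v _ => by congr))
      congr 1
      ext q
      have : glue q (0 + ((j : ℕ) : ℤ)) = (q.1 j, q.2 j) := by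
        rw [zero_add]
        exact Prod.ext rfl (extWord_coe q.2 j)
      simp only [Set.mem_preimage, Set.mem_ofPred_eq, zShift, this]
      exact ne_comm
    simp only [e1, mism, Finset.mul_sum, mul_ite, mul_one, mul_zero]
    rw [Finset.sum_comm]
    refine Finset.sum_congr rfl fun w _ => ?_
    rw [Finset.sum_comm]

end ApproximateJoinings

section Limits

variable {A B : Type} [Fintype A] [TopologicalSpace A] [DiscreteTopology A] [MeasurableSpace A]
  [BorelSpace A] [Fintype B] [TopologicalSpace B] [DiscreteTopology B] [MeasurableSpace B]
  [BorelSpace B]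

/-- If a code of `μ` has words which can be coupled well with i.i.d. words, then `μ` has a
joining with the i.i.d. process which is close to this code. -/
theorem exists_joining_near_code [Nonempty B] {ν : Measure (ℤ → B)} [IsProbabilityMeasure ν]
    {p : B → ℝ} (hν : Iid ν p) {μ : Measure (ℤ → A)} [IsProbabilityMeasure μ] (hμ : Stat μ)
    {m : ℕ} {g : (ℤ → A) → B} (hg : Loc m g) {δ : ℝ}
    (h : ∀ n : ℕ, ∃ ξ : (Fin n → B) → (Fin n → B) → ℝ, (∀ w v, 0 ≤ ξ w v) ∧
      (∀ w, ∑ v, ξ w v = μ.real (codedWord g n ⁻¹' {w})) ∧ (∀ v, ∑ w, ξ w v = ∏ i, p (v i)) ∧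
      ∑ w, ∑ v, ξ w v * mism w v ≤ n * δ) :
    ∃ lam : Measure (ℤ → A × B), IsProbabilityMeasure lam ∧ Stat lam ∧ lam.map prA = μ ∧
      lam.map prB = ν ∧ lam.real {z | (z 0).2 ≠ g (prA z)} ≤ δ := by
  choose ξ h0 h1 h2 h3 using h
  choose x hxP hxA hxs hxB hxg using fun n : ℕ =>
    exists_approx_joining hν hμ hg n.succ_pos (h0 _) (h1 _) (h2 _) (h3 (n + 1))
  let X : ℕ → ProbabilityMeasure (ℤ → A × B) := fun n => ⟨x n, hxP n⟩
  obtain ⟨L, φ, hφ, hL⟩ := CompactSpace.tendsto_subseq X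
  have hlim : ∀ {k : ℕ} {s : Set (ℤ → A × B)}, Loc k (· ∈ s) →
      Tendsto (fun i => (x (φ i)).real s) atTop (nhds ((L : Measure (ℤ → A × B)).real s)) :=
    fun hs => (hs.continuous_real.tendsto L).comp hL
  have hinv : ∀ C : ℝ, Tendsto (fun i => C / ((φ i + 1 : ℕ) : ℝ)) atTop (nhds 0) := fun C =>
    (tendsto_const_div_atTop_nhds_zero_nat C).comp
      ((tendsto_add_atTop_nat 1).comp hφ.tendsto_atTop)
  have hLP := L.2
  have hsh : IsProbabilityMeasure (Measure.map (zShift 1) (L : Measure (ℤ → A × B))) :=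
    Measure.isProbabilityMeasure_map (measurable_zShift 1).aemeasurable
  have hBP : IsProbabilityMeasure (Measure.map prB (L : Measure (ℤ → A × B))) :=
    Measure.isProbabilityMeasure_map measurable_prB.aemeasurable
  refine ⟨L, hLP, ext_win fun k γ => ?_, ?_, ext_win fun k b => ?_, ?_⟩
  · have hs : MeasurableSet (win k ⁻¹' {γ} : Set (ℤ → A × B)) := fMeas_win k {γ}
    have hl1 : Loc k (· ∈ (win k ⁻¹' {γ} : Set (ℤ → A × B))) := loc_win_mem k {γ}
    have hl2 : Loc (k + 1) (· ∈ (zShift 1 ⁻¹' (win k ⁻¹' {γ}) : Set (ℤ → A × B))) := by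
      intro y z hyz
      exact hl1 _ _ fun i h1 h2 => hyz _ (by push_cast; omega) (by push_cast; omega)
    rw [map_measureReal_apply (measurable_zShift 1) hs]
    have := le_of_tendsto_of_tendsto ((hlim hl2).sub (hlim hl1)).abs (hinv 1)
      (Eventually.of_forall fun i => hxs (φ i) _ hs)
    exact sub_eq_zero.1 (abs_nonpos_iff.1 this)
  · have hA := (continuous_margA.tendsto L).comp hL
    have hc : ∀ i, margA (X (φ i)) = ⟨μ, inferInstance⟩ := fun i => Subtype.ext (hxA _)
    have := tendsto_nhds_unique hA (tendsto_const_nhds.congr fun i => (hc i).symm)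
    exact congrArg Subtype.val this
  · have hs : MeasurableSet (win k ⁻¹' {b} : Set (ℤ → B)) := fMeas_win k {b}
    have hl1 : Loc k (· ∈ (prB ⁻¹' (win k ⁻¹' {b}) : Set (ℤ → A × B))) :=
      loc_prB (loc_win_mem k {b})
    rw [map_measureReal_apply measurable_prB hs]
    have := le_of_tendsto_of_tendsto ((hlim hl1).sub_const _).abs (hinv (2 * k))
      (Eventually.of_forall fun i => hxB (φ i) k b)
    exact sub_eq_zero.1 (abs_nonpos_iff.1 this)
  · have hl : Loc m (· ∈ {z : ℤ → A × B | (z 0).2 ≠ g (prA z)}) := by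
      intro y z hyz
      have e : g (prA y) = g (prA z) := loc_prA hg y z hyz
      simp only [Set.mem_ofPred_eq]
      rw [e, hyz 0 (by omega) (by omega)]
    exact le_of_tendsto (hlim hl) (Eventually.of_forall fun i => hxg (φ i))

end Limits


section CodeMap

variable {A B : Type}

/-- The graph of the stationary code with local rule `g`, the code being the second coordinate. -/
def codeMap (g : (ℤ → A) → B) (a : ℤ → A) : ℤ → A × B := fun n => (a n, g (zShift n a))

lemma codeMap_zShift (g : (ℤ → A) → B) (k : ℤ) (a : ℤ → A) :
    codeMap g (zShift k a) = zShift k (codeMap g a) := by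
  funext n; simp [codeMap, zShift_zShift, zShift]

lemma loc_codeMap {m : ℕ} {g : (ℤ → A) → B} (hg : Loc m g) {W : Type} {k : ℕ}
    {f : (ℤ → A × B) → W} (hf : Loc k f) : Loc (m + k) (fun x => f (codeMap g x)) := by
  intro x y hxy
  refine hf _ _ fun i h1 h2 => ?_
  simp only [codeMap, Prod.mk.injEq]
  refine ⟨hxy _ (by push_cast; omega) (by push_cast; omega), hg _ _ fun j h3 h4 => ?_⟩
  exact hxy _ (by push_cast; omega) (by push_cast; omega)

variable [MeasurableSpace A] [MeasurableSpace B] [DiscreteMeasurableSpace A]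
  [DiscreteMeasurableSpace B] [Finite A] [Finite B]

omit [DiscreteMeasurableSpace B] [Finite B] in
lemma measurable_codeMap {m : ℕ} {g : (ℤ → A) → B} (hg : Loc m g) : Measurable (codeMap g) :=
  measurable_pi_lambda _ fun n =>
    Measurable.prodMk (measurable_pi_apply n) (fun s _ => measurable_zShift n (hg.fMeas s))

omit [DiscreteMeasurableSpace B] [Finite B] in
lemma Stat.map_codeMap {μ : Measure (ℤ → A)} (h : Stat μ) {m : ℕ} {g : (ℤ → A) → B}
    (hg : Loc m g) : Stat (μ.map (codeMap g)) := by
  have hm := measurable_codeMap hg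
  unfold Stat
  rw [Measure.map_map (measurable_zShift 1) hm]
  have : zShift 1 ∘ codeMap g = codeMap g ∘ zShift 1 := by
    funext x; exact (codeMap_zShift g 1 x).symm
  rw [this, ← Measure.map_map hm (measurable_zShift 1), h]

lemma Loc.abs_real_codeMap_sub_le {lam : Measure (ℤ → A × B)} [IsProbabilityMeasure lam]
    (hst : Stat lam) {m : ℕ} {g : (ℤ → A) → B} (hg : Loc m g) {k : ℕ} {s : Set (ℤ → A × B)}
    (hs : Loc k (· ∈ s)) :
    |((lam.map prA).map (codeMap g)).real s - lam.real s| ≤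
      (2 * k + 1) * lam.real {z | (z 0).2 ≠ g (prA z)} := by
  have hcm := measurable_codeMap hg
  have hms : MeasurableSet s := hs.measurableSet
  have hmm := measurableSet_mismatch' (A := A) (B := B) hg
  rw [map_measureReal_apply hcm hms, map_measureReal_apply measurable_prA (hcm hms)]
  refine (abs_measureReal_sub_le_measureReal_symmDiff
    (measurable_prA (hcm hms)).nullMeasurableSet hms.nullMeasurableSet).trans ?_
  have hsub : (prA ⁻¹' (codeMap g ⁻¹' s)) ∆ s ⊆
      ⋃ i ∈ Finset.Icc (-(k : ℤ)) k, zShift i ⁻¹' {z : ℤ → A × B | (z 0).2 ≠ g (prA z)} := by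
    intro z hz
    by_contra hcon
    simp only [Set.mem_iUnion, not_exists, Finset.mem_Icc, Set.mem_preimage, Set.mem_ofPred_eq,
      ne_eq, not_not] at hcon
    have e : (codeMap g (prA z) ∈ s) = (z ∈ s) := hs _ _ fun i h1 h2 => by
      have := hcon i ⟨h1, h2⟩
      simp only [zShift, zero_add] at this
      refine Prod.ext rfl ?_
      rw [this]
      rfl
    rcases hz with ⟨h1, h2⟩ | ⟨h1, h2⟩
    · exact h2 (e ▸ h1)
    · exact h2 (e.symm ▸ h1)
  refine (measureReal_mono hsub (measure_ne_top _ _)).trans ((measureReal_biUnion_finset_le _ _).trans (le_of_eq ?_))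
  rw [Finset.sum_congr rfl fun i _ => hst.real_preimage i hmm, Finset.sum_const, Int.card_Icc,
    nsmul_eq_mul]
  congr 1
  have : ((k : ℤ) + 1 - -(k : ℤ)).toNat = 2 * k + 1 := by omega
  rw [this]
  push_cast
  ring

end CodeMap

section Divergence

variable {D W : Type} [MeasurableSpace D] [DiscreteMeasurableSpace D] [Fintype W]

lemma Stat.sum_real_block_mul {κ : Measure (ℤ → D)} [IsProbabilityMeasure κ] (hκ : Stat κ)
    (π : D → W) (F : W → ℝ) (n : ℕ) :
    ∑ w : Fin n → W, κ.real ((fun z (i : Fin n) => π (z (i : ℕ))) ⁻¹' {w}) * ∑ i, F (w i) =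
      n * ∑ b, κ.real {z | π (z 0) = b} * F b := by
  have hR : FMeas fun (z : ℤ → D) (i : Fin n) => π (z (i : ℕ)) := by
    simpa using fMeas_block π n 0
  simp only [Finset.mul_sum]
  rw [Finset.sum_comm]
  have key : ∀ i : Fin n, ∑ w : Fin n → W,
      κ.real ((fun z (i : Fin n) => π (z (i : ℕ))) ⁻¹' {w}) * F (w i) =
      ∑ b, κ.real {z | π (z 0) = b} * F b := by
    intro i
    rw [← Finset.sum_fiberwise_of_maps_to (g := fun w : Fin n → W => w i)
      (t := Finset.univ) fun _ _ => Finset.mem_univ _]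
    refine Finset.sum_congr rfl fun b _ => ?_
    have e1 : κ.real {z | π (z 0) = b} = κ.real ((fun z (i : Fin n) => π (z (i : ℕ))) ⁻¹'
        {w : Fin n → W | w i = b}) := by
      rw [← hκ.real_preimage (i : ℕ) 
        (show MeasurableSet {z : ℤ → D | π (z 0) = b} from fMeas_coord π 0 {b})]
      congr 1
      ext z
      simp [zShift]
    rw [e1, ← sum_real_fiber κ hR, Finset.sum_mul]
    refine Finset.sum_congr (by ext w; simp) fun w hw => ?_
    rw [(Finset.mem_filter.1 hw).2]
  rw [Finset.sum_congr rfl fun i _ => key i]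
  simp [Finset.mul_sum]

/-- The divergence of the words of a stationary process from i.i.d. words. -/
lemma Stat.divergence_le {κ : Measure (ℤ → D)} [IsProbabilityMeasure κ] (hκ : Stat κ)
    (π : D → W) {p : W → ℝ} {τ σ : ℝ}
    (hent_le : ∑ b, Real.negMulLog (p b) - τ ≤ hent κ π)
    (hclose : ∀ b, |κ.real {z | π (z 0) = b} - p b| ≤ σ) (n : ℕ) :
    ∑ w : Fin n → W, (κ.real ((fun z (i : Fin n) => π (z (i : ℕ))) ⁻¹' {w}) *
        Real.log (κ.real ((fun z (i : Fin n) => π (z (i : ℕ))) ⁻¹' {w})) -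
      κ.real ((fun z (i : Fin n) => π (z (i : ℕ))) ⁻¹' {w}) * ∑ i, Real.log (p (w i))) ≤
      n * (τ + σ * ∑ b, |Real.log (p b)|) := by
  rw [Finset.sum_sub_distrib, hκ.sum_real_block_mul π (fun b => Real.log (p b))]
  have h1 : ∑ w : Fin n → W, κ.real ((fun z (i : Fin n) => π (z (i : ℕ))) ⁻¹' {w}) *
        Real.log (κ.real ((fun z (i : Fin n) => π (z (i : ℕ))) ⁻¹' {w})) = - hp κ π n := by
    rw [hp, partEnt_eq, ← Finset.sum_neg_distrib]
    simp [Real.negMulLog]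
  have h2 : n * (∑ b, Real.negMulLog (p b) - τ) ≤ hp κ π n :=
    (mul_le_mul_of_nonneg_left hent_le (Nat.cast_nonneg n)).trans (hκ.mul_hent_le π n)
  have h3 : -∑ b, κ.real {z | π (z 0) = b} * Real.log (p b) ≤
      ∑ b, Real.negMulLog (p b) + σ * ∑ b, |Real.log (p b)| := by
    rw [Finset.mul_sum, ← Finset.sum_add_distrib, ← Finset.sum_neg_distrib]
    refine Finset.sum_le_sum fun b _ => ?_
    have h4 := mul_le_mul_of_nonneg_right (hclose b) (abs_nonneg (Real.log (p b)))
    rw [← abs_mul] at h4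
    have := neg_le_of_abs_le h4
    rw [Real.negMulLog]
    linarith
  have h5 := mul_le_mul_of_nonneg_left h3 (Nat.cast_nonneg (α := ℝ) n)
  rw [h1]
  linarith

end Divergence

section Openness

variable {A B : Type} [Fintype A] [TopologicalSpace A] [DiscreteTopology A] [MeasurableSpace A]
  [BorelSpace A] [Fintype B] [TopologicalSpace B] [DiscreteTopology B] [MeasurableSpace B]
  [BorelSpace B] [Nonempty B] {ν : Measure (ℤ → B)} [IsProbabilityMeasure ν] {p : B → ℝ}

/-- Every process near the first marginal of a joining which is a two-sided code has itself a
joining with the i.i.d. process near the given one. -/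
theorem exists_joining_near (hν : Iid ν p) (hp0 : ∀ b, 0 < p b) (hp1 : ∑ b, p b = 1)
    {lam : Measure (ℤ → A × B)} [IsProbabilityMeasure lam] (hst : Stat lam) (hB : lam.map prB = ν)
    (hF : ∀ ε, 0 < ε → CodesFst lam ε) (hS : ∀ ε, 0 < ε → CodesSnd lam ε) (k : ℕ) {δ : ℝ}
    (hδ : 0 < δ) :
    ∃ (l : ℕ) (η : ℝ), 0 < η ∧ ∀ (μ : Measure (ℤ → A)) [IsProbabilityMeasure μ], Stat μ →
      (∀ n : ℕ, n * ∑ b, Real.negMulLog (p b) ≤ hp μ id n) →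
      (∀ γ, |μ.real (win l ⁻¹' {γ}) - (lam.map prA).real (win l ⁻¹' {γ})| < η) →
      ∃ lam' : Measure (ℤ → A × B), IsProbabilityMeasure lam' ∧ Stat lam' ∧ lam'.map prA = μ ∧
        lam'.map prB = ν ∧ ∀ γ, |lam'.real (win k ⁻¹' {γ}) - lam.real (win k ⁻¹' {γ})| < δ := by
  set M : ℝ := 2 * (k : ℝ) + 1 with hM
  have hM0 : 0 < M := by positivity
  set ρ := δ / (4 * M) with hρ
  have hρ0 : 0 < ρ := by positivity
  set L := ∑ b, |Real.log (p b)| with hL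
  have hL0 : 0 ≤ L := Finset.sum_nonneg fun _ _ => abs_nonneg _
  set τ := ρ / 2 * ρ / 4 with hτ
  set σ := ρ / 2 * ρ / (4 * (L + 1)) with hσ
  have hτ0 : 0 < τ := by positivity
  have hσ0 : 0 < σ := by positivity
  have hσL : σ * L ≤ τ := by
    have : σ * (L + 1) = τ := by rw [hσ, hτ]; field_simp
    linarith
  obtain ⟨ε, hε, hcode⟩ := exists_hent_le_of_code A B hτ0
  obtain ⟨n₁, f, hf, hfε⟩ := hF (ε / 2) (by positivity)
  set K := max k n₁ with hK
  set r := min (ε / 4) (min (σ / 2) (δ / 4)) with hr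
  have hr0 : 0 < r := by positivity
  have hrε : r ≤ ε / 4 := min_le_left _ _
  have hrσ : r ≤ σ / 2 := (min_le_right _ _).trans (min_le_left _ _)
  have hrδ : r ≤ δ / 4 := (min_le_right _ _).trans (min_le_right _ _)
  obtain ⟨m, g, hg, hgr⟩ := hS (r / (2 * K + 1)) (by positivity)
  rw [lt_div_iff₀ (by positivity), mul_comm] at hgr
  set N : ℝ := (Fintype.card (Fin (2 * (m + K) + 1) → A) : ℝ) with hN
  have hN0 : 0 ≤ N := Nat.cast_nonneg _
  refine ⟨m + K, r / (N + 1), by positivity, fun μ _ hμ hent_ge hnear => ?_⟩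
  have hcm := measurable_codeMap hg
  set κ := μ.map (codeMap g) with hκ
  have hκP : IsProbabilityMeasure κ := Measure.isProbabilityMeasure_map hcm.aemeasurable
  have hκs : Stat κ := hμ.map_codeMap hg
  have hκA : κ.map prA = μ := by
    rw [hκ, Measure.map_map measurable_prA hcm]
    exact Measure.map_id
  have hlA : IsProbabilityMeasure (lam.map prA) :=
    Measure.isProbabilityMeasure_map measurable_prA.aemeasurable
  have hclose : ∀ {s : Set (ℤ → A × B)}, Loc K (· ∈ s) → |κ.real s - lam.real s| ≤ 2 * r := by
    intro s hs
    have h1 := hg.abs_real_codeMap_sub_le hst hs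
    have h2 : |κ.real s - ((lam.map prA).map (codeMap g)).real s| ≤ r := by
      rw [hκ, map_measureReal_apply hcm hs.measurableSet, map_measureReal_apply hcm hs.measurableSet]
      refine (Loc.abs_real_sub_le (s := codeMap g ⁻¹' s) (loc_codeMap hg hs)).trans
        ((Finset.sum_le_card_nsmul _ _ _ fun γ _ => (hnear γ).le).trans ?_)
      rw [nsmul_eq_mul, Finset.card_univ, ← hN, mul_div_assoc', div_le_iff₀ (by positivity)]
      nlinarith
    have := abs_sub_le (κ.real s) (((lam.map prA).map (codeMap g)).real s) (lam.real s)
    linarith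
  have hcodeκ : κ.real {z | (z 0).1 ≠ f (prB z)} < ε := by
    have hl : Loc K (· ∈ {z : ℤ → A × B | (z 0).1 ≠ f (prB z)}) := by
      refine Loc.mono (le_max_right k n₁) fun y z hyz => ?_
      have e : f (prB y) = f (prB z) := loc_prB hf y z hyz
      simp only [Set.mem_ofPred_eq]
      rw [e, hyz 0 (by omega) (by omega)]
    have := (abs_le.1 (hclose hl)).2
    linarith
  have hent1 : ∑ b, Real.negMulLog (p b) - τ ≤ hent κ Prod.snd := by
    have h1 := (hcode κ hκs).1 ⟨n₁, f, hf, hcodeκ⟩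
    have h2 : ∑ b, Real.negMulLog (p b) ≤ hent κ Prod.fst := hκs.le_hent (K := 0) _ fun n => by
      rw [add_zero, ← hp_map_prA, hκA]
      exact hent_ge n
    linarith
  have hmarg : ∀ b, |κ.real {z | (z 0).2 = b} - p b| ≤ σ := by
    intro b
    have hl : Loc K (· ∈ {z : ℤ → A × B | (z 0).2 = b}) := fun y z hyz => by
      simp only [Set.mem_ofPred_eq]
      rw [hyz 0 (by omega) (by omega)]
    have h1 := hclose hl
    have h2 : lam.real {z | (z 0).2 = b} = p b := by
      have := real_word_snd hν hB 1 fun _ => b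
      rw [Fin.prod_univ_one] at this
      rw [← this]
      congr 1
      ext z
      simp [funext_iff]
    rw [h2] at h1
    linarith
  have hword : ∀ (n : ℕ) (w : Fin n → B),
      κ.real ((fun z (i : Fin n) => (z (i : ℕ)).2) ⁻¹' {w}) = μ.real (codedWord g n ⁻¹' {w}) := by
    intro n w
    have hR : FMeas fun (z : ℤ → A × B) (i : Fin n) => (z (i : ℕ)).2 := by
      simpa using fMeas_block (Prod.snd : A × B → B) n 0
    rw [hκ, map_measureReal_apply hcm (hR {w})]
    rfl
  obtain ⟨lam', h1, h2, h3, h4, h5⟩ := exists_joining_near_code hν hμ hg (δ := ρ) fun n => by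
    have hsum := sum_real_fiber_univ μ (fMeas_codedWord hg n)
    obtain ⟨ξ, hξ0, hξ1, hξ2, hξ3⟩ := exists_coupling_pow hp0 hp1 (half_pos hρ0) n
      (fun w => μ.real (codedWord g n ⁻¹' {w})) (fun _ => measureReal_nonneg) hsum
    refine ⟨ξ, hξ0, hξ1, hξ2, hξ3.trans ?_⟩
    have hdiv := hκs.divergence_le Prod.snd hent1 hmarg n
    simp only [hword] at hdiv
    have h6 : (n : ℝ) * (τ + σ * L) ≤ n * (ρ / 2 * (ρ / 2)) := by
      gcongr
      rw [hτ] at hσL ⊢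
      linarith
    have h7 := div_le_div_of_nonneg_right (hdiv.trans h6) (half_pos hρ0).le
    have h8 : (n : ℝ) * (ρ / 2 * (ρ / 2)) / (ρ / 2) = n * (ρ / 2) := by field_simp
    linarith
  refine ⟨lam', h1, h2, h3, h4, fun γ => ?_⟩
  have h6 := hg.abs_real_codeMap_sub_le h2
    (loc_win_mem k {γ} : Loc k (· ∈ (win k ⁻¹' {γ} : Set (ℤ → A × B))))
  rw [h3, ← hκ, ← hM] at h6
  have h7 := hclose (Loc.mono (le_max_left k n₁)
    (loc_win_mem k {γ} : Loc k (· ∈ (win k ⁻¹' {γ} : Set (ℤ → A × B)))))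
  have h8 : M * lam'.real {z | (z 0).2 ≠ g (prA z)} ≤ δ / 4 := by
    calc M * lam'.real {z | (z 0).2 ≠ g (prA z)} ≤ M * ρ := by gcongr
      _ = δ / 4 := by rw [hρ]; field_simp
  rw [abs_le] at h6 h7
  rw [abs_lt]
  constructor <;> linarith [h6.1, h6.2, h7.1, h7.2]

end Openness


section Entropy

variable {A : Type} [Fintype A] [MeasurableSpace A] [DiscreteMeasurableSpace A]

lemma Stat.le_entZ_iff {μ : Measure (ℤ → A)} [IsProbabilityMeasure μ] (hμ : Stat μ) {c : ℝ} :
    c ≤ entZ μ ↔ ∀ n : ℕ, n * c ≤ hp μ id n := by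
  rw [entZ_eq]
  refine ⟨fun h n => ?_, fun h => hμ.le_hent (K := 0) id fun n => by simpa using h n⟩
  exact (mul_le_mul_of_nonneg_left h (Nat.cast_nonneg n)).trans (hμ.mul_hent_le id n)

lemma sum_ofReal_eq_one {n : ℕ} {p : Fin n → ℝ} (hp0 : ∀ b, 0 ≤ p b) (hp1 : ∑ b, p b = 1) :
    ∑ b, ENNReal.ofReal (p b) = 1 := by
  rw [← ENNReal.ofReal_sum_of_nonneg fun b _ => hp0 b, hp1, ENNReal.ofReal_one]

/-- The words of a process of maximal entropy are uniformly distributed. -/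
lemma Stat.real_win_of_max [Nonempty A] {μ : Measure (ℤ → A)} [IsProbabilityMeasure μ]
    (hμ : Stat μ) (hmax : ∀ n : ℕ, n * Real.log (Fintype.card A) ≤ hp μ id n) (m : ℕ)
    (a : Fin (2 * m + 1) → A) :
    μ.real (win m ⁻¹' {a}) = ((Fintype.card A : ℝ) ^ (2 * m + 1))⁻¹ := by
  have hR : FMeas fun (z : ℤ → A) (i : Fin (2 * m + 1)) => z (i : ℕ) := by
    simpa using fMeas_block (id : A → A) (2 * m + 1) 0
  have e : (win m ⁻¹' {a} : Set (ℤ → A)) = zShift (-(m : ℤ)) ⁻¹'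
      ((fun (z : ℤ → A) (i : Fin (2 * m + 1)) => z (i : ℕ)) ⁻¹' {a}) := rfl
  rw [e, hμ.real_preimage _ (hR {a})]
  have hN : (0 : ℝ) < Fintype.card A := by exact_mod_cast Fintype.card_pos
  have hr : (0 : ℝ) < ((Fintype.card A : ℝ) ^ (2 * m + 1))⁻¹ := by positivity
  have hsum := sum_real_fiber_univ μ hR
  have h1 := sum_hellinger_le
    (fun w => μ.real ((fun (z : ℤ → A) (i : Fin (2 * m + 1)) => z (i : ℕ)) ⁻¹' {w}))
    (fun _ => ((Fintype.card A : ℝ) ^ (2 * m + 1))⁻¹) (fun _ => measureReal_nonneg)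
    (fun _ => hr.le) (by
      rw [hsum]
      simp [hN.ne']) (fun _ h => absurd h hr.ne')
  rw [Finset.sum_sub_distrib, ← Finset.sum_mul, hsum, Real.log_inv, Real.log_pow] at h1
  have h2 := hmax (2 * m + 1)
  have h3 : hp μ id (2 * m + 1) = -∑ w : Fin (2 * m + 1) → A,
      μ.real ((fun (z : ℤ → A) (i : Fin (2 * m + 1)) => z (i : ℕ)) ⁻¹' {w}) *
        Real.log (μ.real ((fun (z : ℤ → A) (i : Fin (2 * m + 1)) => z (i : ℕ)) ⁻¹' {w})) := by
    rw [hp, partEnt_eq, ← Finset.sum_neg_distrib]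
    simp [Real.negMulLog]
  have h4 := (Finset.single_le_sum (fun _ _ => sq_nonneg _) (Finset.mem_univ a)).trans h1
  have h5 := pow_eq_zero_iff (two_ne_zero) |>.1 (le_antisymm (h4.trans (by linarith)) (sq_nonneg _))
  exact (Real.sqrt_inj measureReal_nonneg hr.le).1 (sub_eq_zero.1 h5)

lemma Iid.isBernoulliZ [Nonempty A] {μ : Measure (ℤ → A)} [IsProbabilityMeasure μ] {p : A → ℝ}
    (hμ : Iid μ p) (hp0 : ∀ a, 0 ≤ p a) (hp1 : ∑ a, p a = 1) : IsBernoulliZ μ (zShift 1) := by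
  let e := Fintype.equivFin A
  let f : (ℤ → A) → ℤ → Fin (Fintype.card A) := fun z i => e (z i)
  let f' : (ℤ → Fin (Fintype.card A)) → ℤ → A := fun z i => e.symm (z i)
  have hf : Measurable f := measurable_pi_lambda _ fun i =>
    (Measurable.of_discrete (f := e)).comp (measurable_pi_apply i)
  have hf' : Measurable f' := measurable_pi_lambda _ fun i =>
    (Measurable.of_discrete (f := e.symm)).comp (measurable_pi_apply i)
  have h1 : ∀ z, f' (f z) = z := fun z => by simp [f, f']
  have h2 : ∀ z, f (f' z) = z := fun z => by simp [f, f']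
  have hP : IsProbabilityMeasure (μ.map f) := Measure.isProbabilityMeasure_map hf.aemeasurable
  have hne : Nonempty (Fin (Fintype.card A)) := ⟨e (Classical.arbitrary A)⟩
  have hiid : Iid (μ.map f) fun b => p (e.symm b) := by
    intro s a
    have hms : MeasurableSet {x : ℤ → Fin (Fintype.card A) | ∀ n ∈ s, x n = a n} := by
      have : {x : ℤ → Fin (Fintype.card A) | ∀ n ∈ s, x n = a n} = Set.pi s fun n => {a n} := by
        ext x; simp
      rw [this]
      exact MeasurableSet.pi s.countable_toSet fun _ _ => measurableSet_singleton _
    rw [map_measureReal_apply hf hms, ← hμ s fun n => e.symm (a n)]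
    congr 1
    ext z
    simp [f, Equiv.eq_symm_apply]
  refine ⟨Fintype.card A, _, μ.map f, ?_, hiid.isIIDZ fun b => hp0 _, f, f', hf, hf', rfl, ?_,
    Eventually.of_forall fun _ => rfl, Eventually.of_forall h1, Eventually.of_forall h2⟩
  · exact sum_ofReal_eq_one (fun b => hp0 _) ((Equiv.sum_comp e.symm p).trans hp1)
  · rw [Measure.map_map hf' hf]
    have : f' ∘ f = id := funext h1
    rw [this, Measure.map_id]

lemma Stat.isBernoulliZ_of_max [Nonempty A] {μ : Measure (ℤ → A)} [IsProbabilityMeasure μ]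
    (hμ : Stat μ) (hmax : ∀ n : ℕ, n * Real.log (Fintype.card A) ≤ hp μ id n) :
    IsBernoulliZ μ (zShift 1) := by
  have hN : (0 : ℝ) < Fintype.card A := by exact_mod_cast Fintype.card_pos
  have hp0 : ∀ _ : A, (0 : ℝ) ≤ (Fintype.card A : ℝ)⁻¹ := fun _ => by positivity
  have hp1 : ∑ _ : A, (Fintype.card A : ℝ)⁻¹ = 1 := by simp
  obtain ⟨ν, hνP, hν⟩ := exists_iid hp0 hp1
  have hmaxν : ∀ n : ℕ, n * Real.log (Fintype.card A) ≤ hp ν id n := fun n => by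
    rw [hp_id_eq hp1 hν]
    simp [Real.negMulLog, hN.ne']
  have : μ = ν := ext_win fun m a => by
    rw [hμ.real_win_of_max hmax, hν.stat.real_win_of_max hmaxν]
  rw [this]
  exact hν.isBernoulliZ hp0 hp1

end Entropy

section Genericity

variable {A : Type} [Fintype A] [TopologicalSpace A] [DiscreteTopology A] [MeasurableSpace A]
  [BorelSpace A]

lemma isClosed_stat_entropy (c : ℝ) :
    IsClosed {μ : ProbabilityMeasure (ℤ → A) | Stat (μ : Measure (ℤ → A)) ∧
      ∀ n : ℕ, n * c ≤ hp (μ : Measure (ℤ → A)) id n} :=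
  isClosed_stat.inter (isClosed_entropy id c)

variable {B : Type} [Fintype B] [TopologicalSpace B] [DiscreteTopology B] [MeasurableSpace B]
  [BorelSpace B]

lemma isOpen_codesFst (ε : ℝ) :
    IsOpen {lam : ProbabilityMeasure (ℤ → A × B) | CodesFst (lam : Measure (ℤ → A × B)) ε} := by
  simp only [CodesFst, Set.ofPred_exists]
  refine isOpen_iUnion fun m => isOpen_iUnion fun f => ?_
  by_cases hf : Loc m f
  · have hl : Loc m (· ∈ {z : ℤ → A × B | (z 0).1 ≠ f (prB z)}) := fun y z hyz => by
      have e : f (prB y) = f (prB z) := loc_prB hf y z hyz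
      simp only [Set.mem_ofPred_eq]
      rw [e, hyz 0 (by omega) (by omega)]
    simpa [hf] using isOpen_lt hl.continuous_real continuous_const
  · simp [hf]

lemma isOpen_codesSnd (ε : ℝ) :
    IsOpen {lam : ProbabilityMeasure (ℤ → A × B) | CodesSnd (lam : Measure (ℤ → A × B)) ε} := by
  simp only [CodesSnd, Set.ofPred_exists]
  refine isOpen_iUnion fun m => isOpen_iUnion fun g => ?_
  by_cases hg : Loc m g
  · have hl : Loc m (· ∈ {z : ℤ → A × B | (z 0).2 ≠ g (prA z)}) := fun y z hyz => by
      have e : g (prA y) = g (prA z) := loc_prA hg y z hyz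
      simp only [Set.mem_ofPred_eq]
      rw [e, hyz 0 (by omega) (by omega)]
    simpa [hg] using isOpen_lt hl.continuous_real continuous_const
  · simp [hg]

/-- Joinings of an i.i.d. process with processes of entropy at least `c` which are two-sided codes
up to arbitrarily small errors are mapped onto a residual set of processes. -/
theorem exists_dense_gdelta_coded [Nonempty B] {ν : Measure (ℤ → B)} [IsProbabilityMeasure ν]
    {p : B → ℝ} (hν : Iid ν p) (hp0 : ∀ b, 0 < p b) (hp1 : ∑ b, p b = 1) {b₁ : B}
    (hb₁ : p b₁ < 1) {a₀ a₁ : A} (ha : a₀ ≠ a₁) {c : ℝ} (hpc : ∑ b, Real.negMulLog (p b) = c)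
    (hc : c < Real.log (Fintype.card A)) :
    ∃ C : Set ↥{μ : ProbabilityMeasure (ℤ → A) | Stat (μ : Measure (ℤ → A)) ∧
        ∀ n : ℕ, n * c ≤ hp (μ : Measure (ℤ → A)) id n}, IsGδ C ∧ Dense C ∧
      ∀ μ ∈ C, ∃ lam : Measure (ℤ → A × B), IsProbabilityMeasure lam ∧ Stat lam ∧
        lam.map prA = (μ.1 : Measure (ℤ → A)) ∧ lam.map prB = ν ∧
        (∀ ε, 0 < ε → CodesFst lam ε) ∧ ∀ ε, 0 < ε → CodesSnd lam ε := by
  set Mc := {μ : ProbabilityMeasure (ℤ → A) | Stat (μ : Measure (ℤ → A)) ∧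
    ∀ n : ℕ, n * c ≤ hp (μ : Measure (ℤ → A)) id n} with hMc
  set Z := {lam : ProbabilityMeasure (ℤ → A × B) | (Stat (lam : Measure (ℤ → A × B)) ∧
    (lam : Measure (ℤ → A × B)).map prB = ν) ∧
    ∀ n : ℕ, n * c ≤ hp (lam : Measure (ℤ → A × B)) Prod.fst n} with hZ
  have hMcc : CompactSpace Mc := isCompact_iff_compactSpace.1 (isClosed_stat_entropy c).isCompact
  have hZc : CompactSpace Z := isCompact_iff_compactSpace.1
    ((isClosed_stat.inter (isClosed_margB ν)).inter (isClosed_entropy Prod.fst c)).isCompact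
  have hsc : SecondCountableTopology (ProbabilityMeasure (ℤ → A × B)) :=
    secondCountableTopology_processes
  have hmem : ∀ z : Z, margA z.1 ∈ Mc := fun z => ⟨Stat.map_prA z.2.1.1, fun n =>
    (z.2.2 n).trans (hp_map_prA (z.1 : Measure (ℤ → A × B)) n).ge⟩
  let π : Z → Mc := fun z => ⟨margA z.1, hmem z⟩
  have hπ : Continuous π := (continuous_margA.comp continuous_subtype_val).subtype_mk _
  let W : ℕ → Set Z := fun k => {z | CodesFst (z.1 : Measure (ℤ → A × B)) (1 / (k + 1)) ∧
    CodesSnd (z.1 : Measure (ℤ → A × B)) (1 / (k + 1))}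
  have hW : ∀ z ∈ ⋂ k, W k, (∀ ε, 0 < ε → CodesFst (z.1 : Measure (ℤ → A × B)) ε) ∧
      ∀ ε, 0 < ε → CodesSnd (z.1 : Measure (ℤ → A × B)) ε := by
    intro z hz
    rw [Set.mem_iInter] at hz
    constructor <;> intro ε hε <;> obtain ⟨k, hk⟩ := exists_nat_one_div_lt hε
    · obtain ⟨m, f, hf, h⟩ := (hz k).1
      exact ⟨m, f, hf, h.trans hk⟩
    · obtain ⟨m, f, hf, h⟩ := (hz k).2
      exact ⟨m, f, hf, h.trans hk⟩
  have hsurj : Function.Surjective π := by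
    rintro ⟨μ, hμ, hμc⟩
    obtain ⟨lam, hlP, hls, hlA, hlB⟩ := exists_joining hμ hν.stat
    refine ⟨⟨⟨lam, hlP⟩, ⟨hls, hlB⟩, fun n => ?_⟩, Subtype.ext (Subtype.ext hlA)⟩
    refine (hμc n).trans (le_of_eq ?_)
    rw [← hlA]
    exact hp_map_prA lam n
  have hdense : ∀ k, Dense (W k) := by
    intro k z
    rw [mem_closure_iff_nhds]
    intro V hV
    obtain ⟨U, hU, hUV⟩ := mem_nhds_subtype Z z V |>.1 hV
    obtain ⟨l, δ, hδ, hl⟩ := exists_winMass_nhds hU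
    obtain ⟨lam', hP, hst, hB, hlc, hF, hS, hnear⟩ := exists_coded_joining hν hp0 hp1 hb₁ ha hpc hc
      z.2.1.1 z.2.1.2 z.2.2 l hδ (show (0 : ℝ) < 1 / (k + 1) by positivity)
    exact ⟨⟨⟨lam', hP⟩, ⟨hst, hB⟩, hlc⟩, hUV (hl ⟨lam', hP⟩ hnear), hF, hS⟩
  have hopen : ∀ z ∈ ⋂ k, W k, ∀ V ∈ nhds z, π '' V ∈ nhds (π z) := by
    intro z hz V hV
    obtain ⟨U, hU, hUV⟩ := mem_nhds_subtype Z z V |>.1 hV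
    obtain ⟨k, δ, hδ, hk⟩ := exists_winMass_nhds hU
    obtain ⟨l, η, hη, hl⟩ := exists_joining_near hν hp0 hp1 z.2.1.1 z.2.1.2 (hW z hz).1 (hW z hz).2
      k hδ
    have hev : ∀ᶠ y : Mc in nhds (π z), ∀ γ, |(y.1 : Measure (ℤ → A)).real (win l ⁻¹' {γ}) -
        ((z.1 : Measure (ℤ → A × B)).map prA).real (win l ⁻¹' {γ})| < η := by
      rw [eventually_all]
      intro γ
      have hcont : Continuous fun y : Mc => (y.1 : Measure (ℤ → A)).real (win l ⁻¹' {γ}) :=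
        (loc_win_mem l {γ}).continuous_real.comp continuous_subtype_val
      refine (isOpen_lt (hcont.sub continuous_const).abs continuous_const).mem_nhds ?_
      change |((z.1 : Measure (ℤ → A × B)).map prA).real (win l ⁻¹' {γ}) -
        ((z.1 : Measure (ℤ → A × B)).map prA).real (win l ⁻¹' {γ})| < η
      rwa [sub_self, abs_zero]
    filter_upwards [hev] with y hy
    obtain ⟨lam', hP, hst, hA, hB, hnear⟩ := hl y.1 y.2.1 (by rw [hpc]; exact y.2.2) hy
    refine ⟨⟨⟨lam', hP⟩, ⟨hst, hB⟩, fun n => ?_⟩, hUV (hk ⟨lam', hP⟩ hnear),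
      Subtype.ext (Subtype.ext hA)⟩
    refine (y.2.2 n).trans (le_of_eq ?_)
    rw [← hA]
    exact hp_map_prA lam' n
  obtain ⟨C, hC1, hC2, hC3⟩ := exists_dense_gdelta hπ hsurj
    (fun k => ((isOpen_codesFst _).inter (isOpen_codesSnd _)).preimage continuous_subtype_val)
    hdense hopen
  refine ⟨C, hC1, hC2, fun μ hμ => ?_⟩
  obtain ⟨z, hz, rfl⟩ := hC3 μ hμ
  exact ⟨z.1, inferInstance, z.2.1.1, rfl, z.2.1.2, hW z hz⟩

end Genericity

/-- **Rudolph's theorem (for `ℤ`).** For `X = A^ℤ` with the shift `S` and `0 < c ≤ log |A|`,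
there is a dense `G_δ` subset `C` of the set `M_c` of shift-invariant measures with entropy at
least `c` such that every `μ ∈ C` has entropy exactly `c` and is isomorphic to a Bernoulli
shift. -/
theorem rudolph_theorem_Z
    {A : Type} [Fintype A] [MeasurableSpace A]
    [TopologicalSpace A] [DiscreteTopology A] [BorelSpace A]
    (c : ℝ) (hc0 : 0 < c) (hclog : c ≤ Real.log (Fintype.card A))
    (Mc : Set (ProbabilityMeasure (ℤ → A)))
    (hMc : Mc = {μ : ProbabilityMeasure (ℤ → A) |
      Measure.map (zShift 1) (μ : Measure (ℤ → A)) = (μ : Measure (ℤ → A)) ∧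
      c ≤ entZ (μ : Measure (ℤ → A))}) :
    ∃ C : Set ↥Mc, IsGδ C ∧ Dense C ∧
      ∀ μ ∈ C, entZ (μ.1 : Measure (ℤ → A)) = c ∧
        IsBernoulliZ (μ.1 : Measure (ℤ → A)) (zShift 1) := by
  have hcard : 1 < Fintype.card A := by
    by_contra h
    have : (Fintype.card A : ℝ) ≤ 1 := by exact_mod_cast not_lt.1 h
    linarith [Real.log_nonpos (Nat.cast_nonneg _) this]
  obtain ⟨a₀, a₁, ha⟩ := Fintype.one_lt_card_iff.1 hcard
  have hneA : Nonempty A := ⟨a₀⟩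
  have hMc' : Mc = {μ : ProbabilityMeasure (ℤ → A) | Stat (μ : Measure (ℤ → A)) ∧
      ∀ n : ℕ, n * c ≤ hp (μ : Measure (ℤ → A)) id n} := by
    rw [hMc]
    ext μ
    exact and_congr_right fun h => Stat.le_entZ_iff h
  subst hMc'
  rcases hclog.lt_or_eq with hlt | rfl
  · have hb : 1 < Fintype.card (Fin (Fintype.card A)) := by rwa [Fintype.card_fin]
    obtain ⟨b₀, b₁, hb⟩ := Fintype.one_lt_card_iff.1 hb
    have hneB : Nonempty (Fin (Fintype.card A)) := ⟨b₀⟩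
    obtain ⟨p, hp0, hp1, hpc⟩ := exists_distribution (B := Fin (Fintype.card A)) hc0
      (by rwa [Fintype.card_fin])
    obtain ⟨ν, hνP, hν⟩ := exists_iid (fun b => (hp0 b).le) hp1
    have hb₁ : p b₁ < 1 := by
      have := Finset.add_le_sum (fun b _ => (hp0 b).le) (Finset.mem_univ b₀) (Finset.mem_univ b₁) hb
      linarith [hp0 b₀]
    obtain ⟨C, hC1, hC2, hC3⟩ := exists_dense_gdelta_coded hν hp0 hp1 hb₁ ha hpc hlt
    refine ⟨C, hC1, hC2, fun μ hμ => ?_⟩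
    obtain ⟨lam, hlP, hst, hA, hB, hF, hS⟩ := hC3 μ hμ
    refine ⟨le_antisymm ?_ ((Stat.le_entZ_iff μ.2.1).2 μ.2.2), Fintype.card A, _, ν,
      sum_ofReal_eq_one (fun b => (hp0 b).le) hp1, hν.isIIDZ fun b => (hp0 b).le, ?_⟩
    · rw [entZ_eq, ← hA, hent_map_prA]
      refine le_of_forall_pos_le_add fun τ hτ => ?_
      obtain ⟨ε, hε, hcode⟩ := exists_hent_le_of_code A (Fin (Fintype.card A)) hτ
      have h1 := (hcode lam hst).1 (hF ε hε)
      have h2 := hent_snd_le hν hst hB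
      linarith
    · rw [← hA, ← hB]
      exact isMeasIsoZ_of_codes hst hF hS
  · refine ⟨Set.univ, IsGδ.univ, dense_univ, fun μ _ => ⟨le_antisymm ?_
      ((Stat.le_entZ_iff μ.2.1).2 μ.2.2), Stat.isBernoulliZ_of_max μ.2.1 μ.2.2⟩⟩
    rw [entZ_eq]
    exact (Stat.hent_le μ.2.1 id one_ne_zero).trans (by simpa using hp_le id 1)
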